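/- Let Ξ ⊆ Ω be a prediction set satisfying Assumption A, with associated set Ξ̄. Then Φ̄(ξ̄) = sup_{Q̄ ∈ M̄(Ξ̄)} E_{Q̄}[ξ̄] for every function ξ̄ : Ω̄ → [0,∞] which can be written as ξ̄ = liminf_{n→∞} ξ̄_n, where each ξ̄_n : Ω̄ → [0,∞) is bounded and upper semicontinuous. -/

import Mathlib

open MeasureTheory Filter Set Topology
open scoped ENNReal Classical

noncomputable section

namespace PathwiseSuperhedging

/-- The path space `C[0,T]`: continuous functions on `[0,T]` with the sup-norm. -/
abbrev Path (T : ℝ) := C(Set.Icc (0:ℝ) T, ℝ)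

variable (T : ℝ)

instance : MeasurableSpace (Path T) := borel _
instance : BorelSpace (Path T) := ⟨rfl⟩

variable (hT : 0 ≤ T)

/-- time `0` as an element of `[0,T]`. -/
def t0 : Set.Icc (0:ℝ) T := ⟨0, le_refl 0, hT⟩

/-- clamp a real time into `[0,T]`. -/
def clamp (t : ℝ) : Set.Icc (0:ℝ) T := Set.projIcc 0 T hT t

/-- evaluation of a path at a (clamped) real time. -/
def ev (ω : Path T) (t : ℝ) : ℝ := ω (clamp T hT t)

/-- The stopping times `σ^m_k`:  `σ^m_0 = 0` and
`σ^m_{k+1} = inf { t ≥ σ^m_k : |S_t - S_{σ^m_k}| ≥ 2^{-m} }` (equal to `T+1` if no such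
time `t ≤ T` exists). -/
def sig (m : ℕ) : ℕ → Path T → ℝ
  | 0 => fun _ => 0
  | k + 1 => fun ω =>
      sInf ({t : ℝ | sig m k ω ≤ t ∧ t ≤ T ∧
        (2:ℝ) ^ (-(m:ℤ)) ≤ |ev T hT ω t - ev T hT ω (sig m k ω)|} ∪ {T + 1})

/-- The discretized integral `𝕊^m_t = ∑_k S_{σ^m_k} (S_{σ^m_{k+1} ∧ t} - S_{σ^m_k ∧ t})`. -/
def Sm (m : ℕ) (t : ℝ) (ω : Path T) : ℝ :=
  ∑' k : ℕ, ev T hT ω (sig T hT m k ω) *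
    (ev T hT ω (min (sig T hT m (k + 1) ω) t) - ev T hT ω (min (sig T hT m k ω) t))

/-- The pathwise integral `𝕊_t = liminf_m 𝕊^m_t`. -/
def SS (t : ℝ) (ω : Path T) : ℝ := Filter.liminf (fun m => Sm T hT m t ω) Filter.atTop

/-- The candidate quadratic variation `S_t² - S_0² - 2 𝕊_t`. -/
def qvRaw (ω : Path T) (t : ℝ) : ℝ := (ev T hT ω t) ^ 2 - (ev T hT ω 0) ^ 2 - 2 * SS T hT t ω

/-- The set `Ω` of paths for which `𝕊^m → 𝕊` uniformly and
`t ↦ S_t² - S_0² - 2𝕊_t` is nondecreasing. -/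
def BigOmega : Set (Path T) :=
  {ω | TendstoUniformly (fun m (t : Set.Icc (0:ℝ) T) => Sm T hT m (t : ℝ) ω)
        (fun t => SS T hT (t : ℝ) ω) Filter.atTop ∧
      MonotoneOn (qvRaw T hT ω) (Set.Icc (0:ℝ) T)}

/-- The pathwise quadratic variation `⟨ω⟩`, as an element of `C[0,T]`; it equals
`S² - S_0² - 2𝕊` for `ω ∈ Ω` (this function being continuous there) and `0` otherwise. -/
def qv (ω : Path T) : Path T :=
  if h : ω ∈ BigOmega T hT ∧ Continuous fun t : Set.Icc (0:ℝ) T => qvRaw T hT ω (t : ℝ)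
  then ⟨fun t => qvRaw T hT ω (t : ℝ), h.2⟩ else 0

/-- The raw filtration `F_t = σ(S_s : s ≤ t)` generated by the canonical process. -/
def Fraw (t : ℝ) : MeasurableSpace (Path T) :=
  ⨆ (s : Set.Icc (0:ℝ) T) (_ : (s : ℝ) ≤ t),
    MeasurableSpace.comap (fun ω : Path T => ω s) inferInstance

/-- The right-continuous filtration `F_{t+} = ⋂_{s > t} F_{s ∧ T}`. -/
def Fplus (t : ℝ) : MeasurableSpace (Path T) :=
  ⨅ (s : ℝ) (_ : t < s), Fraw T (min s T)

/-- `τ` is a stopping time for the raw filtration `𝔽`. -/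
def IsStopRaw (τ : Path T → ℝ) : Prop :=
  ∀ t ∈ Set.Icc (0:ℝ) T, MeasurableSet[Fraw T t] {ω | τ ω ≤ t}

/-- `τ` is a stopping time for the right-continuous filtration `𝔽₊`. -/
def IsStopPlus (τ : Path T → ℝ) : Prop :=
  ∀ t ∈ Set.Icc (0:ℝ) T, MeasurableSet[Fplus T t] {ω | τ ω ≤ t}

/-- `f` is measurable with respect to the σ-field `F_{τ+}`. -/
def MeasAtStopPlus (τ f : Path T → ℝ) : Prop :=
  ∀ B : Set ℝ, MeasurableSet B → ∀ t ∈ Set.Icc (0:ℝ) T,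
    MeasurableSet[Fplus T t] (f ⁻¹' B ∩ {ω | τ ω ≤ t})

/-- The set `ℋ` of simple trading strategies `H = ∑_{l=1}^L h_l 1_{(τ_l, τ_{l+1}]}`
with `𝔽₊`-stopping times `0 ≤ τ_1 ≤ ⋯ ≤ τ_{L+1} ≤ T` and bounded `F_{τ_l+}`-measurable
coefficients `h_l`. -/
structure SimpleStrategy where
  L : ℕ
  τ : Fin (L + 1) → Path T → ℝ
  coeff : Fin L → Path T → ℝ
  τ_nonneg : ∀ ω, 0 ≤ τ 0 ω
  τ_mono : ∀ (l : Fin L) (ω), τ l.castSucc ω ≤ τ l.succ ω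
  τ_le : ∀ ω, τ (Fin.last L) ω ≤ T
  τ_stop : ∀ l, IsStopPlus T (τ l)
  coeff_bdd : ∀ l, ∃ C : ℝ, ∀ ω, |coeff l ω| ≤ C
  coeff_meas : ∀ l : Fin L, MeasAtStopPlus T (τ l.castSucc) (coeff l)

/-- The pathwise stochastic integral `(H · X)_t(ω)` of a simple strategy against a process. -/
def integ (H : SimpleStrategy T) (X : ℝ → Path T → ℝ) (t : ℝ) (ω : Path T) : ℝ :=
  ∑ l : Fin H.L, H.coeff l ω *
    (X (min (H.τ l.succ ω) t) ω - X (min (H.τ l.castSucc ω) t) ω)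

/-- The canonical process `S_t(ω) = ω(t)`. -/
def Sproc (t : ℝ) (ω : Path T) : ℝ := ev T hT ω t

/-- `X` is a `Q`-`𝔽`-martingale (on the time interval `[0,T]`). -/
def IsMart (Q : Measure (Path T)) (X : ℝ → Path T → ℝ) : Prop :=
  (∀ t ∈ Set.Icc (0:ℝ) T, Integrable (X t) Q) ∧
  ∀ s t : ℝ, s ∈ Set.Icc (0:ℝ) T → t ∈ Set.Icc (0:ℝ) T → s ≤ t →
    ∀ A : Set (Path T), MeasurableSet[Fraw T s] A →
      ∫ ω in A, X t ω ∂Q = ∫ ω in A, X s ω ∂Q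

/-- `X` is a `Q`-`𝔽`-local martingale: there are `𝔽`-stopping times increasing `Q`-a.s.
to `∞` such that each stopped process is a `Q`-`𝔽`-martingale. -/
def IsLocalMart (Q : Measure (Path T)) (X : ℝ → Path T → ℝ) : Prop :=
  ∃ τ : ℕ → Path T → ℝ,
    (∀ m, IsStopRaw T (τ m)) ∧
    (∀ᵐ ω ∂Q, Monotone (fun m => τ m ω) ∧ Tendsto (fun m => τ m ω) atTop atTop) ∧
    (∀ m, IsMart T Q (fun t ω => X (min (τ m ω) t) ω))

/-- The set `M(Ξ)` of local martingale measures concentrated on `Ξ`. -/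
def MSet (Ξ : Set (Path T)) : Set (Measure (Path T)) :=
  {Q | IsProbabilityMeasure Q ∧ IsLocalMart T Q (Sproc T hT) ∧ Q Ξ = 1}

/-- The set `M_Z(Ξ)` of local martingale measures concentrated on `Ξ` with `E_Q[Z] < ∞`. -/
def MZSet (Ξ : Set (Path T)) (Z : Path T → ℝ≥0∞) : Set (Measure (Path T)) :=
  {Q | IsProbabilityMeasure Q ∧ IsLocalMart T Q (Sproc T hT) ∧ Q Ξ = 1 ∧
       ∫⁻ ω, Z ω ∂Q ≠ ⊤}

/-- The stopped path `ω^t(s) = ω(t ∧ s)`. -/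
def stopPath (ω : Path T) (t : Set.Icc (0:ℝ) T) : Path T :=
  ⟨fun s => ω ⟨min t.1 s.1, le_min t.2.1 s.2.1, (min_le_left _ _).trans t.2.2⟩,
    ω.continuous.comp ((continuous_const.min continuous_subtype_val).subtype_mk _)⟩

/-- Assumption A on the prediction set `Ξ` and its lift `Ξ̄`. -/
structure AssumptionA (Ξ : Set (Path T)) (Xibar : Set (Path T × Path T)) : Prop where
  xi_nonempty : Ξ.Nonempty
  xibar_nonempty : Xibar.Nonempty
  xi_eq : Ξ = {ω ∈ BigOmega T hT | (ω, qv T hT ω) ∈ Xibar}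
  A1 : ∃ K : ℕ → Set (Path T × Path T), (∀ n, IsCompact (K n)) ∧ Xibar = ⋃ n, K n
  A2 : ∀ p ∈ Xibar, p.2 (t0 T hT) = 0 ∧ Monotone p.2
  A3 : ∀ p ∈ Xibar, ∀ t : Set.Icc (0:ℝ) T, (stopPath T p.1 t, stopPath T p.2 t) ∈ Xibar

/-! ### The enlarged space -/

/-- The enlarged space `Ω̄ = C[0,T] × C[0,T]`. -/
abbrev PathPair (T : ℝ) := Path T × Path T

/-- The embedding `ψ(ω) = (ω, ⟨ω⟩)`. -/
def psiMap (ω : Path T) : PathPair T := (ω, qv T hT ω)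

/-- The diagonal set `Δ̄ = ψ(Ω)`. -/
def Delta : Set (PathPair T) := psiMap T hT '' BigOmega T hT

/-- The first canonical process `S̄_t(ω,ν) = ω(t)` on the enlarged space. -/
def SbarProc (t : ℝ) (p : PathPair T) : ℝ := ev T hT p.1 t

/-- The second canonical process `V̄_t(ω,ν) = ν(t)` on the enlarged space. -/
def VbarProc (t : ℝ) (p : PathPair T) : ℝ := ev T hT p.2 t

/-- The process `𝕊̄ = (S̄² - S̄_0² - V̄)/2` on the enlarged space. -/
def SSbarProc (t : ℝ) (p : PathPair T) : ℝ :=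
  ((ev T hT p.1 t) ^ 2 - (ev T hT p.1 0) ^ 2 - ev T hT p.2 t) / 2

/-- The raw filtration `F̄_t = σ(S̄_s, V̄_s : s ≤ t)` on the enlarged space. -/
def FbarRaw (t : ℝ) : MeasurableSpace (PathPair T) :=
  ⨆ (s : Set.Icc (0:ℝ) T) (_ : (s : ℝ) ≤ t),
    MeasurableSpace.comap (fun p : PathPair T => (p.1 s, p.2 s)) inferInstance

/-- The right-continuous filtration `F̄_{t+} = ⋂_{s>t} F̄_{s ∧ T}` on the enlarged space. -/
def FbarPlus (t : ℝ) : MeasurableSpace (PathPair T) :=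
  ⨅ (s : ℝ) (_ : t < s), FbarRaw T (min s T)

/-- The σ-field generated by all subsets of `Δ̄ᶜ`. -/
def nullDelta : MeasurableSpace (PathPair T) :=
  MeasurableSpace.generateFrom {N : Set (PathPair T) | N ⊆ (Delta T hT)ᶜ}

/-- The `Δ̄`-augmented raw filtration `F̄^Δ_t`. -/
def FbarDelta (t : ℝ) : MeasurableSpace (PathPair T) := FbarRaw T t ⊔ nullDelta T hT

/-- The `Δ̄`-augmented right-continuous filtration `F̄^Δ_{t+}`. -/
def FbarDeltaPlus (t : ℝ) : MeasurableSpace (PathPair T) := FbarPlus T t ⊔ nullDelta T hT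

/-- `τ` is a stopping time for the raw filtration `𝔽̄` on the enlarged space. -/
def IsStopBarRaw (τ : PathPair T → ℝ) : Prop :=
  ∀ t ∈ Set.Icc (0:ℝ) T, MeasurableSet[FbarRaw T t] {p | τ p ≤ t}

/-- `τ` is a stopping time for the filtration `𝔽̄₊^Δ`. -/
def IsStopBarDeltaPlus (τ : PathPair T → ℝ) : Prop :=
  ∀ t ∈ Set.Icc (0:ℝ) T, MeasurableSet[FbarDeltaPlus T hT t] {p | τ p ≤ t}

/-- `f` is measurable with respect to `F̄^Δ_{τ+}`. -/
def MeasAtStopBarDeltaPlus (τ f : PathPair T → ℝ) : Prop :=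
  ∀ B : Set ℝ, MeasurableSet B → ∀ t ∈ Set.Icc (0:ℝ) T,
    MeasurableSet[FbarDeltaPlus T hT t] (f ⁻¹' B ∩ {p | τ p ≤ t})

/-- The set `ℋ̄` of simple strategies on the enlarged space. -/
structure SimpleStrategyBar where
  L : ℕ
  τ : Fin (L + 1) → PathPair T → ℝ
  coeff : Fin L → PathPair T → ℝ
  τ_nonneg : ∀ p, 0 ≤ τ 0 p
  τ_mono : ∀ (l : Fin L) (p), τ l.castSucc p ≤ τ l.succ p
  τ_le : ∀ p, τ (Fin.last L) p ≤ T
  τ_stop : ∀ l, IsStopBarDeltaPlus T hT (τ l)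
  coeff_bdd : ∀ l, ∃ C : ℝ, ∀ p, |coeff l p| ≤ C
  coeff_meas : ∀ l : Fin L, MeasAtStopBarDeltaPlus T hT (τ l.castSucc) (coeff l)

/-- The pathwise stochastic integral on the enlarged space. -/
def integBar (H : SimpleStrategyBar T hT) (X : ℝ → PathPair T → ℝ) (t : ℝ)
    (p : PathPair T) : ℝ :=
  ∑ l : Fin H.L, H.coeff l p *
    (X (min (H.τ l.succ p) t) p - X (min (H.τ l.castSucc p) t) p)

/-- `X` is a `Q̄`-`𝔽̄`-martingale on the enlarged space. -/
def IsMartBar (Q : Measure (PathPair T)) (X : ℝ → PathPair T → ℝ) : Prop :=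
  (∀ t ∈ Set.Icc (0:ℝ) T, Integrable (X t) Q) ∧
  ∀ s t : ℝ, s ∈ Set.Icc (0:ℝ) T → t ∈ Set.Icc (0:ℝ) T → s ≤ t →
    ∀ A : Set (PathPair T), MeasurableSet[FbarRaw T s] A →
      ∫ p in A, X t p ∂Q = ∫ p in A, X s p ∂Q

/-- `X` is a `Q̄`-`𝔽̄`-local martingale on the enlarged space. -/
def IsLocalMartBar (Q : Measure (PathPair T)) (X : ℝ → PathPair T → ℝ) : Prop :=
  ∃ τ : ℕ → PathPair T → ℝ,
    (∀ m, IsStopBarRaw T (τ m)) ∧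
    (∀ᵐ p ∂Q, Monotone (fun m => τ m p) ∧ Tendsto (fun m => τ m p) atTop atTop) ∧
    (∀ m, IsMartBar T Q (fun t p => X (min (τ m p) t) p))

/-- The set `M̄(Ξ̄)` of measures on the enlarged space under which `S̄` and `𝕊̄` are local
martingales and which are concentrated on `Ξ̄`. -/
def MbarSet (Xibar : Set (PathPair T)) : Set (Measure (PathPair T)) :=
  {Q | IsProbabilityMeasure Q ∧ IsLocalMartBar T Q (SbarProc T hT) ∧
       IsLocalMartBar T Q (SSbarProc T hT) ∧ Q Xibar = 1}

/-- The set `M̄_{Z̄}(Ξ̄)`. -/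
def MbarZSet (Xibar : Set (PathPair T)) (Zbar : PathPair T → ℝ≥0∞) :
    Set (Measure (PathPair T)) :=
  {Q | IsProbabilityMeasure Q ∧ IsLocalMartBar T Q (SbarProc T hT) ∧
       IsLocalMartBar T Q (SSbarProc T hT) ∧ Q Xibar = 1 ∧ ∫⁻ p, Zbar p ∂Q ≠ ⊤}

/-! ### Expectations and superhedging functionals -/

/-- The positive part of an extended real number, as an element of `[0,∞]`. -/
def erealPos (x : EReal) : ℝ≥0∞ := if x = ⊤ then ⊤ else ENNReal.ofReal x.toReal

/-- The expectation `E_Q[ξ]` of an extended-real-valued random variable, as an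
extended real number (positive part minus negative part). -/
def expEReal {α : Type*} [MeasurableSpace α] (Q : Measure α) (ξ : α → EReal) : EReal :=
  ((∫⁻ x, erealPos (ξ x) ∂Q : ℝ≥0∞) : EReal) - ((∫⁻ x, erealPos (-ξ x) ∂Q : ℝ≥0∞) : EReal)

/-- The set of initial capitals `λ` that allow superhedging `ξ` on `Ξ`
(trading in `S` and `𝕊` with simple strategies, in the liminf sense). -/
def PhiSet (Ξ : Set (Path T)) (ξ : Path T → EReal) : Set ℝ :=
  {lam : ℝ | ∃ H G : ℕ → SimpleStrategy T,
    (∀ n : ℕ, ∀ t ∈ Set.Icc (0:ℝ) T, ∀ ω ∈ Ξ,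
      0 ≤ lam + integ T (H n) (Sproc T hT) t ω + integ T (G n) (SS T hT) t ω) ∧
    (∀ ω ∈ Ξ, ξ ω ≤ (lam : EReal) +
      Filter.liminf (fun n =>
        ((integ T (H n) (Sproc T hT) T ω + integ T (G n) (SS T hT) T ω : ℝ) : EReal))
        Filter.atTop)}

/-- The superhedging price `Φ(ξ)`. -/
def Phi (Ξ : Set (Path T)) (ξ : Path T → EReal) : EReal :=
  sInf ((fun lam : ℝ => (lam : EReal)) '' PhiSet T hT Ξ ξ)

/-- The supremum of the pricing functionals `E_Q[ξ]` over `Q ∈ M(Ξ)`,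
for a nonnegative claim `ξ`. -/
def supMart (Ξ : Set (Path T)) (ξ : Path T → ℝ≥0∞) : ℝ≥0∞ :=
  ⨆ Q ∈ MSet T hT Ξ, ∫⁻ ω, ξ ω ∂Q

/-- The liminf-closure `𝒢^Ξ_λ`: the smallest set of functions `C[0,T] → [-∞,∞]`
containing `λ + (H·S)_T` for admissible simple `H` and closed under countable liminf. -/
inductive GG (Ξ : Set (Path T)) (lam : ℝ) : (Path T → EReal) → Prop
  | base (H : SimpleStrategy T)
      (hadm : ∀ t ∈ Set.Icc (0:ℝ) T, ∀ ω ∈ Ξ, 0 ≤ lam + integ T H (Sproc T hT) t ω) :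
      GG Ξ lam (fun ω => ((lam + integ T H (Sproc T hT) T ω : ℝ) : EReal))
  | lim (X : ℕ → Path T → EReal) (h : ∀ n, GG Ξ lam (X n)) :
      GG Ξ lam (fun ω => Filter.liminf (fun n => X n ω) Filter.atTop)

/-- The superhedging price `Φ^cl(ξ)` defined via the liminf-closure. -/
def PhiCl (Ξ : Set (Path T)) (ξ : Path T → EReal) : EReal :=
  sInf {x : EReal | ∃ lam : ℝ, x = (lam : EReal) ∧
    ∃ Y : Path T → EReal, GG T hT Ξ lam Y ∧ ∀ ω ∈ Ξ, ξ ω ≤ Y ω}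


/-- The set of initial capitals allowing superhedging on the enlarged space
(superhedging on `Δ̄ ∩ Ξ̄`). -/
def PhiBarSet (Xibar : Set (PathPair T)) (ξ : PathPair T → EReal) : Set ℝ :=
  {lam : ℝ | ∃ H G : ℕ → SimpleStrategyBar T hT,
    (∀ n : ℕ, ∀ t ∈ Set.Icc (0:ℝ) T, ∀ p ∈ Delta T hT ∩ Xibar,
      0 ≤ lam + integBar T hT (H n) (SbarProc T hT) t p
            + integBar T hT (G n) (SSbarProc T hT) t p) ∧
    (∀ p ∈ Delta T hT ∩ Xibar, ξ p ≤ (lam : EReal) +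
      Filter.liminf (fun n =>
        ((integBar T hT (H n) (SbarProc T hT) T p
          + integBar T hT (G n) (SSbarProc T hT) T p : ℝ) : EReal)) Filter.atTop)}

/-- The superhedging price `Φ̄(ξ̄)` on the enlarged space. -/
def PhiBar (Xibar : Set (PathPair T)) (ξ : PathPair T → EReal) : EReal :=
  sInf ((fun lam : ℝ => (lam : EReal)) '' PhiBarSet T hT Xibar ξ)

/-- The supremum of pricing functionals over `M̄(Ξ̄)` for a nonnegative claim. -/
def supMartBar (Xibar : Set (PathPair T)) (ξ : PathPair T → ℝ≥0∞) : ℝ≥0∞ :=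
  ⨆ Q ∈ MbarSet T hT Xibar, ∫⁻ p, ξ p ∂Q

/-- Assumption B on the prediction set `Ξ`, determined by a growth function `Z̄`
(with values in `[1,∞]`). -/
structure AssumptionB (Ξ : Set (Path T)) (Zbar : PathPair T → ℝ≥0∞) : Prop where
  xi_nonempty : Ξ.Nonempty
  one_le : ∀ p, 1 ≤ Zbar p
  xi_eq : Ξ = {ω ∈ BigOmega T hT | Zbar (ω, qv T hT ω) ≠ ⊤}
  B1 : ∀ c : ℝ≥0∞, c ≠ ⊤ → IsCompact {p : PathPair T | Zbar p ≤ c}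
  B2 : ∀ p : PathPair T, Zbar p ≠ ⊤ → p.2 (t0 T hT) = 0 ∧ Monotone p.2
  B3 : ∀ p : PathPair T, ENNReal.ofReal (‖p.1‖ + ‖p.2‖) ≤ Zbar p

/-- The set of initial capitals allowing `Z`-admissible superhedging of `ξ` on `Ξ`. -/
def PhiZSet (Ξ : Set (Path T)) (Z : Path T → ℝ≥0∞) (ξ : Path T → EReal) : Set ℝ :=
  {lam : ℝ | ∃ c : ℝ, 0 ≤ c ∧ ∃ H G : ℕ → SimpleStrategy T,
    (∀ n : ℕ, ∀ ω ∈ Ξ,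
      -(c * (Z ω).toReal) ≤
        lam + integ T (H n) (Sproc T hT) T ω + integ T (G n) (SS T hT) T ω) ∧
    (∀ ω ∈ Ξ, ξ ω ≤ (lam : EReal) +
      Filter.liminf (fun n =>
        ((integ T (H n) (Sproc T hT) T ω + integ T (G n) (SS T hT) T ω : ℝ) : EReal))
        Filter.atTop)}

/-- The superhedging price `Φ^Z(ξ)`. -/
def PhiZ (Ξ : Set (Path T)) (Z : Path T → ℝ≥0∞) (ξ : Path T → EReal) : EReal :=
  sInf ((fun lam : ℝ => (lam : EReal)) '' PhiZSet T hT Ξ Z ξ)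

/-- The `α`-Hölder norm `‖ω‖_α = |ω(0)| + sup_{s ≠ t} |ω(t) - ω(s)| / |t-s|^α`,
with values in `[0,∞]`. -/
def holderNormE (α : ℝ) (ω : Path T) : ℝ≥0∞ :=
  ENNReal.ofReal |ω (t0 T hT)| +
    ⨆ (s : Set.Icc (0:ℝ) T) (t : Set.Icc (0:ℝ) T) (_ : s ≠ t),
      ENNReal.ofReal (|ω t - ω s| / |t.1 - s.1| ^ α)

/-- The set of Hölder continuous paths `⋃_n { ω : ‖ω‖_{1/n} ≤ n }`. -/
def CHolder : Set (Path T) :=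
  ⋃ n : ℕ, {ω : Path T | 0 < n ∧ holderNormE T hT (1 / n) ω ≤ (n : ℝ≥0∞)}

end PathwiseSuperhedging

namespace PathwiseSuperhedging

section Abstract

set_option linter.unusedSectionVars false

variable {Ω : Type*} [m0 : MeasurableSpace Ω] {Q : Measure Ω} {G : ℝ → MeasurableSpace Ω}

structure Filt (Q : Measure Ω) (G : ℝ → MeasurableSpace Ω) : Prop where
  mono : Monotone G
  null : ∀ s A, MeasurableSet[G s] A → NullMeasurableSet A Q

lemma Filt.aem (hF : Filt Q G) {s : ℝ} {f : Ω → ℝ} (hf : Measurable[G s] f) :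
    AEMeasurable f Q := by
  have : NullMeasurable f Q := fun B hB => hF.null s _ (hf hB)
  exact this.aemeasurable

lemma Filt.integrable_mul (hF : Filt Q G) {s : ℝ} {h D : Ω → ℝ} {c : ℝ}
    (hm : Measurable[G s] h) (hb : ∀ p, |h p| ≤ c) (hD : Integrable D Q) :
    Integrable (fun p => h p * D p) Q :=
  hD.bdd_mul (hF.aem hm).aestronglyMeasurable (Eventually.of_forall hb)

lemma Filt.int_mul_zero (hF : Filt Q G) {s : ℝ} {h D : Ω → ℝ} {c : ℝ}
    (hm : Measurable[G s] h) (hb : ∀ p, |h p| ≤ c) (hD : Integrable D Q)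
    (h0 : ∀ A, MeasurableSet[G s] A → ∫ p in A, D p ∂Q = 0) :
    ∫ p, h p * D p ∂Q = 0 := by
  have key : ∀ n : ℕ, |∫ p, h p * D p ∂Q| ≤ (1 / ((n : ℝ) + 1)) * ∫ p, |D p| ∂Q := by
    intro n
    set N : ℝ := (n : ℝ) + 1 with hN
    have hNpos : 0 < N := by positivity
    let K : ℤ := ⌈N * c⌉ + 1
    let fl : Ω → ℤ := fun p => ⌊N * h p⌋
    have hflK : ∀ p, fl p ∈ Finset.Icc (-K) K := by
      intro p
      have h1 := abs_le.1 (hb p)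
      have h2 : N * h p ≤ N * c := by gcongr; exact h1.2
      have h3 : -(N * c) ≤ N * h p := by nlinarith
      have h4 := Int.le_ceil (N * c)
      have h5 := Int.floor_le (N * h p)
      have h6 := Int.lt_floor_add_one (N * h p)
      rw [Finset.mem_Icc]
      constructor
      · have : (-(K : ℝ)) ≤ (fl p : ℝ) := by
          simp only [K, fl]; push_cast; linarith
        exact_mod_cast this
      · have : (fl p : ℝ) ≤ (K : ℝ) := by
          simp only [K, fl]; push_cast; linarith
        exact_mod_cast this
    have hflm : ∀ k, MeasurableSet[G s] {p | fl p = k} := by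
      intro k
      have : {p | fl p = k} = h ⁻¹' ((fun x => ⌊N * x⌋) ⁻¹' {k}) := rfl
      rw [this]
      apply hm
      have : Measurable (fun x : ℝ => ⌊N * x⌋) := Int.measurable_floor.comp (measurable_const_mul N)
      exact this (measurableSet_singleton k)
    have hsum : ∀ p, ((fl p : ℝ) / N) * D p =
        ∑ k ∈ Finset.Icc (-K) K, ({p | fl p = k}.indicator (fun p => ((k : ℝ) / N) * D p) p) := by
      intro p
      rw [Finset.sum_eq_single (fl p)]
      · simp
      · intro b _ hb; simp [Set.indicator, Ne.symm hb]
      · intro h; exact absurd (hflK p) h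
    have hi : ∀ k ∈ Finset.Icc (-K) K,
        Integrable ({p | fl p = k}.indicator (fun p => ((k : ℝ) / N) * D p)) Q := fun k _ =>
      (hD.const_mul _).indicator₀ (hF.null s _ (hflm k))
    have hz : ∫ p, ((fl p : ℝ) / N) * D p ∂Q = 0 := by
      simp_rw [hsum]
      rw [integral_finsetSum _ hi]
      apply Finset.sum_eq_zero
      intro k _
      rw [integral_indicator₀ (hF.null s _ (hflm k)), integral_const_mul, h0 _ (hflm k), mul_zero]
    have hint1 : Integrable (fun p => ((fl p : ℝ) / N) * D p) Q := by
      simp_rw [hsum]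
      exact integrable_finsetSum _ hi
    have hint2 := hF.integrable_mul hm hb hD
    have : ∫ p, h p * D p ∂Q = ∫ p, (h p * D p - ((fl p : ℝ) / N) * D p) ∂Q := by
      rw [integral_sub hint2 hint1, hz, sub_zero]
    rw [this, ← integral_const_mul]
    refine (abs_integral_le_integral_abs).trans (integral_mono (hint2.sub hint1).abs
      (hD.abs.const_mul _) ?_)
    intro p
    have h5 := Int.floor_le (N * h p)
    have h6 := Int.lt_floor_add_one (N * h p)
    simp only
    rw [← sub_mul, abs_mul]
    gcongr
    have : h p - (fl p : ℝ) / N = (N * h p - fl p) / N := by field_simp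
    rw [this, abs_div, abs_of_pos hNpos]
    gcongr
    rw [abs_le]; constructor <;> simp only [fl] <;> linarith
  have hlim : Tendsto (fun n : ℕ => (1 / ((n : ℝ) + 1)) * ∫ p, |D p| ∂Q) atTop (𝓝 (0 * ∫ p, |D p| ∂Q)) :=
    tendsto_one_div_add_atTop_nhds_zero_nat.mul_const _
  rw [zero_mul] at hlim
  have := ge_of_tendsto' hlim key
  exact abs_eq_zero.1 (le_antisymm this (abs_nonneg _))

/-- optional times -/
def Opt (G : ℝ → MeasurableSpace Ω) (τ : Ω → ℝ) : Prop := ∀ s, MeasurableSet[G s] {p | τ p < s}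

def HM (G : ℝ → MeasurableSpace Ω) (τ h : Ω → ℝ) : Prop :=
  ∀ s, Measurable[G s] ({p | τ p < s}.indicator h)

lemma Opt.inf {τ σ : Ω → ℝ} (h1 : Opt G τ) (h2 : Opt G σ) : Opt G (fun p => min (τ p) (σ p)) := by
  intro s
  have : {p | min (τ p) (σ p) < s} = {p | τ p < s} ∪ {p | σ p < s} := by
    ext p; simp
  rw [this]
  exact (h1 s).union (h2 s)

lemma Opt.const (c : ℝ) : Opt G (fun _ => c) := by
  intro s
  exact MeasurableSet.const _

lemma HM.mul {τ h k : Ω → ℝ} (h1 : HM G τ h) (h2 : HM G τ k) : HM G τ (fun p => h p * k p) := by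
  intro s
  have : {p | τ p < s}.indicator (fun p => h p * k p) =
      fun p => {p | τ p < s}.indicator h p * {p | τ p < s}.indicator k p := by
    ext p; by_cases hp : τ p < s <;> simp [Set.indicator, hp]
  rw [this]
  exact Measurable.mul (h1 s) (h2 s)

lemma HM.add {τ h k : Ω → ℝ} (h1 : HM G τ h) (h2 : HM G τ k) : HM G τ (fun p => h p + k p) := by
  intro s
  have : {p | τ p < s}.indicator (fun p => h p + k p) =
      fun p => {p | τ p < s}.indicator h p + {p | τ p < s}.indicator k p := by
    ext p; by_cases hp : τ p < s <;> simp [Set.indicator, hp]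
  rw [this]
  exact Measurable.add (h1 s) (h2 s)

lemma HM.const {τ : Ω → ℝ} (h : Opt G τ) (c : ℝ) : HM G τ (fun _ => c) := by
  intro s
  exact Measurable.indicator (m := G s) measurable_const (h s)

lemma HM.mono {τ σ h : Ω → ℝ} (h1 : HM G τ h) (hσ : Opt G σ) (hle : ∀ p, τ p ≤ σ p) : HM G σ h := by
  intro s
  have : {p | σ p < s}.indicator h = {p | σ p < s}.indicator ({p | τ p < s}.indicator h) := by
    ext p
    by_cases hp : σ p < s
    · have : τ p < s := (hle p).trans_lt hp
      simp [Set.indicator, hp, this]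
    · simp [Set.indicator, hp]
  rw [this]
  exact Measurable.indicator (h1 s) (hσ s)

/-- evaluation of a continuous adapted process at a bounded optional time -/
lemma meas_eval {m : MeasurableSpace Ω} {Z : ℝ → Ω → ℝ} (hc : ∀ p, Continuous fun t => Z t p) {r : ℝ}
    (hZ : ∀ u ≤ r, Measurable[m] (Z u)) {a : Ω → ℝ} (ha : Measurable[m] a) (har : ∀ p, a p ≤ r) :
    Measurable[m] (fun p => Z (a p) p) := by
  have h1 : Measurable (Function.uncurry (fun (u : ℝ) p => Z (min u r) p)) :=
    measurable_uncurry_of_continuous_of_measurable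
      (fun p => (hc p).comp (continuous_id.min continuous_const))
      (fun u => hZ _ (min_le_right _ _))
  have h2 : (fun p => Z (a p) p) = (Function.uncurry (fun (u : ℝ) p => Z (min u r) p)) ∘
      (fun p => (a p, p)) := by
    ext p; simp [Function.uncurry, har p]
  rw [h2]
  exact h1.comp (ha.prodMk measurable_id)

lemma Opt.meas_inf {τ : Ω → ℝ} (hF : Filt Q G) (hτ : Opt G τ) (r : ℝ) : Measurable[G r] (fun p => min (τ p) r) := by
  refine @measurable_of_Iio ℝ Ω _ _ _ (G r) _ _ _ _ ?_
  intro s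
  rcases le_or_gt s r with h | h
  · have : (fun p => min (τ p) r) ⁻¹' Iio s = {p | τ p < s} := by
      ext p; simp; intro h'; linarith
    rw [this]; exact hF.mono h _ (hτ s)
  · have : (fun p => min (τ p) r) ⁻¹' Iio s = univ := by
      ext p; simp [h]
    rw [this]; exact MeasurableSet.univ

lemma adapted_stop {τ : Ω → ℝ} {Z : ℝ → Ω → ℝ} (hF : Filt Q G) (hτ : Opt G τ)
    (hc : ∀ p, Continuous fun t => Z t p) (hZ : ∀ u, Measurable[G u] (Z u)) (r : ℝ) :
    Measurable[G r] (fun p => Z (min (τ p) r) p) :=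
  meas_eval hc (fun u hu => (hZ u).mono (hF.mono hu) le_rfl) (hτ.meas_inf hF r)
    (fun _ => min_le_right _ _)

lemma HM.eval {τ : Ω → ℝ} {Z : ℝ → Ω → ℝ} (hF : Filt Q G) (hτ : Opt G τ)
    (hc : ∀ p, Continuous fun t => Z t p) (hZ : ∀ u, Measurable[G u] (Z u)) :
    HM G τ (fun p => Z (τ p) p) := by
  intro s
  have : {p | τ p < s}.indicator (fun p => Z (τ p) p) =
      {p | τ p < s}.indicator (fun p => Z (min (τ p) s) p) := by
    ext p
    by_cases hp : τ p < s
    · simp [Set.indicator, hp, min_eq_left hp.le]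
    · simp [Set.indicator, hp]
  rw [this]
  exact Measurable.indicator (adapted_stop hF hτ hc hZ s) (hτ s)

/-- first time in `[0,T]` at which `Z ≥ c` (capped at `T`). -/
def hit (T : ℝ) (Z : ℝ → ℝ) (c : ℝ) : ℝ := sInf ({r | r ∈ Icc 0 T ∧ c ≤ Z r} ∪ {T})

lemma hit_nonempty (T : ℝ) (Z : ℝ → ℝ) (c : ℝ) : ({r | r ∈ Icc 0 T ∧ c ≤ Z r} ∪ {T}).Nonempty :=
  ⟨T, by simp⟩

lemma hit_bdd {T : ℝ} (hT : 0 ≤ T) (Z : ℝ → ℝ) (c : ℝ) :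
    BddBelow ({r | r ∈ Icc 0 T ∧ c ≤ Z r} ∪ {T}) := by
  refine ⟨0, ?_⟩
  rintro r (⟨h, _⟩ | h)
  · exact h.1
  · rw [mem_singleton_iff] at h; rw [h]; exact hT

lemma hit_nonneg {T : ℝ} (hT : 0 ≤ T) (Z : ℝ → ℝ) (c : ℝ) : 0 ≤ hit T Z c := by
  apply le_csInf (hit_nonempty T Z c)
  rintro r (⟨h, _⟩ | h)
  · exact h.1
  · rw [mem_singleton_iff] at h; rw [h]; exact hT

lemma hit_le {T : ℝ} (hT : 0 ≤ T) (Z : ℝ → ℝ) (c : ℝ) : hit T Z c ≤ T :=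
  csInf_le (hit_bdd hT Z c) (by simp)

lemma hit_le_of {T : ℝ} {Z : ℝ → ℝ} {c r : ℝ} (hr : r ∈ Icc 0 T) (h : c ≤ Z r) : hit T Z c ≤ r :=
  csInf_le (hit_bdd (hr.1.trans hr.2) Z c) (Or.inl ⟨hr, h⟩)

lemma lt_of_lt_hit {T : ℝ} {Z : ℝ → ℝ} {c r : ℝ} (hr : r ∈ Icc 0 T) (h : r < hit T Z c) : Z r < c := by
  by_contra h'
  exact absurd (hit_le_of hr (not_lt.1 h')) (not_le.2 h)

lemma hit_mem {T : ℝ} (hT : 0 ≤ T) {Z : ℝ → ℝ} (hZ : Continuous Z) {c : ℝ} :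
    hit T Z c = T ∨ c ≤ Z (hit T Z c) := by
  have hcl : IsClosed ({r | r ∈ Icc 0 T ∧ c ≤ Z r} ∪ {T}) :=
    (isClosed_Icc.inter (isClosed_le continuous_const hZ)).union isClosed_singleton
  rcases hcl.csInf_mem (hit_nonempty T Z c) (hit_bdd hT Z c) with h | h
  · exact Or.inr h.2
  · exact Or.inl h

/-- if `Z` is hit somewhere in `[0,T]` then it is hit at the hitting time -/
lemma hit_spec {T : ℝ} {Z : ℝ → ℝ} (hZ : Continuous Z) {c r : ℝ} (hr : r ∈ Icc 0 T) (h : c ≤ Z r) :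
    c ≤ Z (hit T Z c) := by
  rcases hit_mem (hr.1.trans hr.2) hZ (c := c) with h' | h'
  · have := hit_le_of hr h
    have : r = T := le_antisymm hr.2 (h' ▸ this)
    rw [h', ← this]; exact h
  · exact h'

/-- up to the hitting time `Z ≤ c` -/
lemma hit_upper {T : ℝ} {Z : ℝ → ℝ} (hT : 0 ≤ T) (hZ : Continuous Z) {c r : ℝ} (h0 : Z 0 ≤ c)
    (hr : 0 ≤ r) (h : r ≤ hit T Z c) : Z r ≤ c := by
  rcases hr.eq_or_lt with rfl | hr0
  · exact h0
  have : ∀ u ∈ Ico 0 r, Z u ≤ c := fun u hu =>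
    (lt_of_lt_hit ⟨hu.1, (hu.2.trans_le (h.trans (hit_le hT Z c))).le⟩ (hu.2.trans_le h)).le
  have hcl : closure (Ico 0 r) ⊆ {u | Z u ≤ c} :=
    closure_minimal this (isClosed_le hZ continuous_const)
  rw [closure_Ico hr0.ne] at hcl
  exact hcl ⟨hr, le_rfl⟩

lemma hit_opt {T : ℝ} (hT : 0 ≤ T) {Z : ℝ → Ω → ℝ} (hF : Filt Q G)
    (hc : ∀ p, Continuous fun t => Z t p) (hZ : ∀ u, Measurable[G u] (Z u)) (c : ℝ) :
    Opt G (fun p => hit T (fun t => Z t p) c) := by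
  intro s
  rcases lt_or_ge T s with hs | hs
  · have : {p | hit T (fun t => Z t p) c < s} = univ := by
      ext p; simp; exact (hit_le hT _ _).trans_lt hs
    rw [this]; exact MeasurableSet.univ
  -- `hit < s ↔ ∃ n, ∃ r ∈ [0, s - 1/n], c ≤ Z r`
  have h1 : {p | hit T (fun t => Z t p) c < s} =
      ⋃ n : ℕ, {p | ∃ r ∈ Icc 0 (s - 1 / ((n : ℝ) + 1)), c ≤ Z r p} := by
    ext p
    simp only [mem_ofPred_eq, mem_iUnion]
    constructor
    · intro h
      obtain ⟨r, hr, hrs⟩ := (csInf_lt_iff (hit_bdd hT _ c) (hit_nonempty T _ c)).1 h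
      rcases hr with hr | hr
      · obtain ⟨n, hn⟩ := exists_nat_one_div_lt (sub_pos.2 hrs)
        exact ⟨n, r, ⟨hr.1.1, by linarith⟩, hr.2⟩
      · rw [mem_singleton_iff] at hr; linarith
    · rintro ⟨n, r, hr, h⟩
      have hn : (0 : ℝ) < 1 / ((n : ℝ) + 1) := by positivity
      exact (hit_le_of ⟨hr.1, by linarith [hr.2]⟩ h).trans_lt (by linarith [hr.2])
  rw [h1]
  refine MeasurableSet.iUnion fun n => ?_
  set b := s - 1 / ((n : ℝ) + 1) with hb
  have hbs : b ≤ s := by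
    have hn : (0 : ℝ) < 1 / ((n : ℝ) + 1) := by positivity
    linarith
  rcases lt_or_ge b 0 with hb0 | hb0
  · have : {p | ∃ r ∈ Icc 0 b, c ≤ Z r p} = ∅ := by
      ext p; simp; intro r h1 h2; linarith
    rw [this]; exact @MeasurableSet.empty _ (G s)
  have h2 : {p | ∃ r ∈ Icc 0 b, c ≤ Z r p} =
      ⋂ k : ℕ, ⋃ q : ℚ, {p | c - 1 / ((k : ℝ) + 1) < Z (max 0 (min q b)) p} := by
    ext p
    simp only [mem_ofPred_eq, mem_iInter, mem_iUnion]
    have hcont : Continuous fun x : ℝ => Z (max 0 (min x b)) p :=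
      (hc p).comp (continuous_const.max (continuous_id.min continuous_const))
    constructor
    · rintro ⟨r, hr, h⟩ k
      have hk : (0 : ℝ) < 1 / ((k : ℝ) + 1) := by positivity
      have hop : IsOpen {x : ℝ | c - 1 / ((k : ℝ) + 1) < Z (max 0 (min x b)) p} :=
        isOpen_lt continuous_const hcont
      have hne : {x : ℝ | c - 1 / ((k : ℝ) + 1) < Z (max 0 (min x b)) p}.Nonempty := by
        refine ⟨r, ?_⟩
        simp only [mem_ofPred_eq, min_eq_left hr.2, max_eq_right hr.1]
        linarith
      obtain ⟨q, hq⟩ := Rat.denseRange_cast.exists_mem_open hop hne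
      exact ⟨q, hq⟩
    · intro h
      obtain ⟨r, hr, hmax⟩ := isCompact_Icc.exists_isMaxOn (nonempty_Icc.2 hb0) (hc p).continuousOn
      refine ⟨r, hr, ?_⟩
      have : ∀ k : ℕ, c - Z r p ≤ 1 / ((k : ℝ) + 1) := by
        intro k
        obtain ⟨q, hq⟩ := h k
        have := hmax (show max 0 (min (q:ℝ) b) ∈ Icc 0 b from ⟨le_max_left _ _, max_le hb0 (min_le_right _ _)⟩)
        simp only [mem_ofPred_eq] at this
        linarith
      have := ge_of_tendsto' tendsto_one_div_add_atTop_nhds_zero_nat this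
      linarith
  rw [h2]
  refine MeasurableSet.iInter fun k => MeasurableSet.iUnion fun q => ?_
  have : max 0 (min (q:ℝ) b) ≤ s := (max_le hb0 (min_le_right _ _)).trans hbs
  have hm := (hZ (max 0 (min (q:ℝ) b))).mono (hF.mono this) le_rfl
  exact hm measurableSet_Ioi

end Abstract

section Abstract2

set_option linter.unusedSectionVars false
variable {Ω : Type*} [m0 : MeasurableSpace Ω] {Q : Measure Ω} {G : ℝ → MeasurableSpace Ω} {T : ℝ}

structure GM (T : ℝ) (Q : Measure Ω) (G : ℝ → MeasurableSpace Ω) (M : ℝ → Ω → ℝ) : Prop where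
  cont : ∀ p, Continuous fun t => M t p
  int : ∀ t, 0 ≤ t → t ≤ T → Integrable (M t) Q
  mart : ∀ s t, 0 ≤ s → s ≤ t → t ≤ T → ∀ A, MeasurableSet[G s] A →
    ∫ p in A, (M t p - M s p) ∂Q = 0

lemma GM.os [IsProbabilityMeasure Q] (hF : Filt Q G) {M : ℝ → Ω → ℝ} (hM : GM T Q G M) {C : ℝ → Ω → ℝ}
    (Cc : ∀ p, Continuous fun t => C t p) (Ca : ∀ u, Measurable[G u] (C u))
    (hMC : ∀ t p, 0 ≤ t → t ≤ T → |M t p| ≤ C t p) {τ : Ω → ℝ} (hτ : Opt G τ)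
    (h0 : ∀ p, 0 ≤ τ p) (hτT : ∀ p, τ p ≤ T) {h : Ω → ℝ} (hh : HM G τ h) {b : ℝ}
    (hb : ∀ p, |h p| ≤ b) {c : ℝ} (hC : ∀ p, h p ≠ 0 → C (τ p) p ≤ c) :
    ∫ p, h p * (M T p - M (τ p) p) ∂Q = 0 := by
  obtain ⟨p0⟩ : Nonempty Ω := nonempty_of_isProbabilityMeasure Q
  have hT : 0 ≤ T := (h0 p0).trans (hτT p0)
  have hb0 : 0 ≤ b := (abs_nonneg _).trans (hb p0)
  let tj : ℕ → ℕ → ℝ := fun n j => min T (((j : ℝ) + 1) / ((n : ℝ) + 1))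
  let fl : ℕ → Ω → ℕ := fun n p => ⌊((n : ℝ) + 1) * τ p⌋₊
  let k : ℕ → ℕ → Ω → ℝ := fun n j p => {p | C (tj n j) p ≤ c + 1}.indicator (fun _ => (1:ℝ)) p
  let F : ℕ → Ω → ℝ := fun n p => h p * k n (fl n p) p * (M T p - M (tj n (fl n p)) p)
  have htj : ∀ n j, 0 ≤ tj n j ∧ tj n j ≤ T := fun n j => ⟨le_min hT (by positivity), min_le_left _ _⟩
  have hlow : ∀ n p, τ p ≤ tj n (fl n p) := by
    intro n p
    refine le_min (hτT p) ?_
    rw [le_div_iff₀ (by positivity)]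
    have := Nat.lt_floor_add_one (((n : ℝ) + 1) * τ p)
    simp only [fl]; linarith
  have hup : ∀ n p, tj n (fl n p) ≤ τ p + 1 / ((n : ℝ) + 1) := by
    intro n p
    refine (min_le_right _ _).trans ?_
    have hn : (0 : ℝ) < (n : ℝ) + 1 := by positivity
    have := Nat.floor_le (show 0 ≤ ((n : ℝ) + 1) * τ p from mul_nonneg hn.le (h0 p))
    rw [add_div]
    gcongr
    rw [div_le_iff₀ hn]
    simp only [fl]; linarith
  have hk1 : ∀ n j p, |k n j p| ≤ 1 := by
    intro n j p
    simp only [k, Set.indicator]; split_ifs <;> simp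
  -- pieces
  have hpm : ∀ n j, tj n j = ((j : ℝ) + 1) / ((n : ℝ) + 1) →
      Measurable[G (tj n j)] (fun p => {p | fl n p = j}.indicator (fun p => h p * k n j p) p) := by
    intro n j hj
    have hn : (0 : ℝ) < (n : ℝ) + 1 := by positivity
    have hset : {p | fl n p = j} = {p | τ p < tj n j} \ {p | τ p < (j : ℝ) / ((n : ℝ) + 1)} := by
      ext p
      simp only [mem_ofPred_eq, Set.mem_sdiff, not_lt, fl, hj]
      rw [Nat.floor_eq_iff (mul_nonneg hn.le (h0 p)), lt_div_iff₀ hn, div_le_iff₀ hn]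
      constructor
      · rintro ⟨h1, h2⟩; constructor <;> linarith
      · rintro ⟨h1, h2⟩; constructor <;> linarith
    have hms : MeasurableSet[G (tj n j)] {p | fl n p = j} := by
      rw [hset]
      refine (hτ _).diff (hF.mono ?_ _ (hτ _))
      rw [hj]; gcongr; linarith
    have hkm : Measurable[G (tj n j)] (k n j) := by
      refine Measurable.indicator (m := G (tj n j)) measurable_const ?_
      exact (Ca (tj n j)) measurableSet_Iic
    have heq : (fun p => {p | fl n p = j}.indicator (fun p => h p * k n j p) p) =
        {p | fl n p = j}.indicator (fun p => {p | τ p < tj n j}.indicator h p * k n j p) := by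
      ext p
      by_cases hp : fl n p = j
      · have : p ∈ {p | τ p < tj n j} := by
          have : p ∈ {p | fl n p = j} := hp
          rw [hset] at this; exact this.1
        simp only [Set.indicator, mem_ofPred_eq, hp, if_true]
        rw [mem_ofPred_eq] at this
        simp [this]
      · simp [Set.indicator, hp]
    rw [heq]
    exact Measurable.indicator (Measurable.mul (hh _) hkm) hms
  have hpz : ∀ n j, Integrable (fun p => {p | fl n p = j}.indicator (fun p => h p * k n j p) p *
      (M T p - M (tj n j) p)) Q ∧ ∫ p, {p | fl n p = j}.indicator (fun p => h p * k n j p) p *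
      (M T p - M (tj n j) p) ∂Q = 0 := by
    intro n j
    rcases le_or_gt (((j : ℝ) + 1) / ((n : ℝ) + 1)) T with hle | hgt
    · have hj : tj n j = ((j : ℝ) + 1) / ((n : ℝ) + 1) := min_eq_right hle
      have hbd : ∀ p, |{p | fl n p = j}.indicator (fun p => h p * k n j p) p| ≤ b := by
        intro p
        simp only [Set.indicator]
        split_ifs
        · rw [abs_mul]
          calc |h p| * |k n j p| ≤ b * 1 := by gcongr; exact hb p; exact hk1 n j p
            _ = b := mul_one b
        · simpa using hb0
      have hD : Integrable (fun p => M T p - M (tj n j) p) Q :=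
        (hM.int T hT le_rfl).sub (hM.int _ (htj n j).1 (htj n j).2)
      exact ⟨hF.integrable_mul (hpm n j hj) hbd hD, hF.int_mul_zero (hpm n j hj) hbd hD
        (fun A hA => hM.mart _ _ (htj n j).1 (htj n j).2 le_rfl A hA)⟩
    · have hj : tj n j = T := min_eq_left hgt.le
      simp [hj]
  have hFsum : ∀ n p, F n p = ∑ j ∈ Finset.range (⌊((n : ℝ) + 1) * T⌋₊ + 1),
      {p | fl n p = j}.indicator (fun p => h p * k n j p) p * (M T p - M (tj n j) p) := by
    intro n p
    rw [Finset.sum_eq_single (fl n p)]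
    · simp [F]
    · intro j _ hj; simp [Set.indicator, Ne.symm hj]
    · intro hj
      exfalso; apply hj
      rw [Finset.mem_range, Nat.lt_succ_iff]
      apply Nat.floor_le_floor
      have := hτT p
      gcongr
  have hFint : ∀ n, Integrable (F n) Q := by
    intro n
    rw [show F n = _ from funext (hFsum n)]
    exact integrable_finsetSum _ (fun j _ => (hpz n j).1)
  have hFz : ∀ n, ∫ p, F n p ∂Q = 0 := by
    intro n
    simp_rw [hFsum n]
    rw [integral_finsetSum _ (fun j _ => (hpz n j).1)]
    exact Finset.sum_eq_zero (fun j _ => (hpz n j).2)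
  have htend : ∀ p, Tendsto (fun n => tj n (fl n p)) atTop (𝓝 (τ p)) := by
    intro p
    refine tendsto_of_tendsto_of_tendsto_of_le_of_le tendsto_const_nhds ?_ (fun n => hlow n p) (fun n => hup n p)
    simpa using tendsto_const_nhds.add (tendsto_one_div_add_atTop_nhds_zero_nat (𝕜 := ℝ))
  have hlim : Tendsto (fun n => ∫ p, F n p ∂Q) atTop (𝓝 (∫ p, h p * (M T p - M (τ p) p) ∂Q)) := by
    refine tendsto_integral_of_dominated_convergence (fun p => b * (|M T p| + (|c| + 1)))
      (fun n => (hFint n).aestronglyMeasurable) ?_ ?_ ?_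
    · exact (((hM.int T hT le_rfl).abs).add (integrable_const _)).const_mul _
    · intro n
      refine Eventually.of_forall fun p => ?_
      simp only [F, Real.norm_eq_abs]
      by_cases hk : C (tj n (fl n p)) p ≤ c + 1
      · rw [abs_mul, abs_mul]
        have h1 := hMC (tj n (fl n p)) p (htj _ _).1 (htj _ _).2
        have h2 : |M T p - M (tj n (fl n p)) p| ≤ |M T p| + (|c| + 1) := by
          refine (abs_sub _ _).trans ?_
          have := le_abs_self c
          linarith
        calc |h p| * |k n (fl n p) p| * |M T p - M (tj n (fl n p)) p|
            ≤ b * 1 * (|M T p| + (|c| + 1)) := by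
              gcongr; exact hb p; exact hk1 _ _ _
          _ = _ := by ring
      · have : k n (fl n p) p = 0 := by simp [k, Set.indicator, hk]
        rw [this]; simp; positivity
    · refine Eventually.of_forall fun p => ?_
      by_cases hp : h p = 0
      · simp [F, hp]
      have hCt : Tendsto (fun n => C (tj n (fl n p)) p) atTop (𝓝 (C (τ p) p)) :=
        ((Cc p).tendsto _).comp (htend p)
      have hMt : Tendsto (fun n => M (tj n (fl n p)) p) atTop (𝓝 (M (τ p) p)) :=
        ((hM.cont p).tendsto _).comp (htend p)
      have hev : ∀ᶠ n in atTop, C (tj n (fl n p)) p < c + 1 :=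
        hCt.eventually_lt_const (by linarith [hC p hp])
      have : Tendsto (fun n => h p * (M T p - M (tj n (fl n p)) p)) atTop
          (𝓝 (h p * (M T p - M (τ p) p))) := (tendsto_const_nhds.sub hMt).const_mul _
      refine this.congr' ?_
      filter_upwards [hev] with n hn
      simp [F, k, Set.indicator, hn.le]
  simp_rw [hFz] at hlim
  exact (tendsto_nhds_unique hlim tendsto_const_nhds)

/-- bounded martingale with adaptedness -/
structure BM (T : ℝ) (Q : Measure Ω) (G : ℝ → MeasurableSpace Ω) (c : ℝ) (M : ℝ → Ω → ℝ) : Prop where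
  gm : GM T Q G M
  ad : ∀ u, Measurable[G u] (M u)
  bdd : ∀ t p, |M t p| ≤ c

structure Tm (T : ℝ) (G : ℝ → MeasurableSpace Ω) (τ : Ω → ℝ) : Prop where
  opt : Opt G τ
  nonneg : ∀ p, 0 ≤ τ p
  le : ∀ p, τ p ≤ T

lemma Tm.inf {τ σ : Ω → ℝ} (h1 : Tm T G τ) (h2 : Tm T G σ) : Tm T G (fun p => min (τ p) (σ p)) :=
  ⟨h1.opt.inf h2.opt, fun p => le_min (h1.nonneg p) (h2.nonneg p),
    fun p => (min_le_left _ _).trans (h1.le p)⟩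

lemma BM.eval_ad {c : ℝ} (hF : Filt Q G) {M : ℝ → Ω → ℝ} (hM : BM T Q G c M) {τ : Ω → ℝ} (hτ : Tm T G τ) :
    HM G τ (fun p => M (τ p) p) := HM.eval hF hτ.opt hM.gm.cont hM.ad

lemma Tm.aem (hF : Filt Q G) {τ h : Ω → ℝ} (hτ : Tm T G τ) (hh : HM G τ h) : AEMeasurable h Q := by
  have h1 := hF.aem (hh (T + 1))
  have : {p | τ p < T + 1}.indicator h = h := by
    ext p
    have : τ p < T + 1 := by linarith [hτ.le p]
    simp [Set.indicator, this]
  rwa [this] at h1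

lemma BM.eval_aem {c : ℝ} (hF : Filt Q G) {M : ℝ → Ω → ℝ} (hM : BM T Q G c M) {τ : Ω → ℝ} (hτ : Tm T G τ) :
    AEMeasurable (fun p => M (τ p) p) Q := hτ.aem hF (hM.eval_ad hF hτ)

lemma integrable_of_bdd [IsProbabilityMeasure Q] {f : Ω → ℝ} (hf : AEMeasurable f Q) {c : ℝ}
    (hc : ∀ p, |f p| ≤ c) : Integrable f Q :=
  Integrable.of_bound hf.aestronglyMeasurable c (Eventually.of_forall hc)

lemma BM.eval_int [IsProbabilityMeasure Q] {c : ℝ} (hF : Filt Q G) {M : ℝ → Ω → ℝ} (hM : BM T Q G c M) {τ : Ω → ℝ} (hτ : Tm T G τ) :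
    Integrable (fun p => M (τ p) p) Q := integrable_of_bdd (hM.eval_aem hF hτ) (fun p => hM.bdd _ p)

lemma BM.os [IsProbabilityMeasure Q] {c : ℝ} (hF : Filt Q G) {M : ℝ → Ω → ℝ} (hM : BM T Q G c M)
    {τ : Ω → ℝ} (hτ : Tm T G τ) {h : Ω → ℝ} (hh : HM G τ h) {b : ℝ} (hb : ∀ p, |h p| ≤ b) :
    ∫ p, h p * (M T p - M (τ p) p) ∂Q = 0 :=
  GM.os hF hM.gm (C := fun _ _ => c) (fun _ => continuous_const) (fun u => @measurable_const _ _ _ (G u) c)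
    (fun t p _ _ => hM.bdd t p) hτ.opt hτ.nonneg hτ.le hh hb (fun _ _ => le_rfl)

lemma BM.os2 [IsProbabilityMeasure Q] {c : ℝ} (hF : Filt Q G) {M : ℝ → Ω → ℝ} (hM : BM T Q G c M)
    {τ σ : Ω → ℝ} (hτ : Tm T G τ) (hσ : Tm T G σ) (hle : ∀ p, τ p ≤ σ p) {h : Ω → ℝ} (hh : HM G τ h) {b : ℝ}
    (hb : ∀ p, |h p| ≤ b) :
    Integrable (fun p => h p * (M (σ p) p - M (τ p) p)) Q ∧
    ∫ p, h p * (M (σ p) p - M (τ p) p) ∂Q = 0 := by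
  have hT0 : Tm T G (fun p => σ p) := hσ
  have haem := hτ.aem hF hh
  have hiT : Integrable (M T) Q := by
    obtain ⟨p0⟩ : Nonempty Ω := nonempty_of_isProbabilityMeasure Q
    exact hM.gm.int T ((hτ.nonneg p0).trans (hτ.le p0)) le_rfl
  have i1 : Integrable (fun p => h p * (M T p - M (τ p) p)) Q :=
    (hiT.sub (hM.eval_int hF hτ)).bdd_mul haem.aestronglyMeasurable (Eventually.of_forall hb)
  have i2 : Integrable (fun p => h p * (M T p - M (σ p) p)) Q :=
    (hiT.sub (hM.eval_int hF hσ)).bdd_mul haem.aestronglyMeasurable (Eventually.of_forall hb)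
  have e : (fun p => h p * (M (σ p) p - M (τ p) p)) = fun p => h p * (M T p - M (τ p) p) -
      h p * (M T p - M (σ p) p) := by ext p; ring
  rw [e]
  refine ⟨i1.sub i2, ?_⟩
  rw [integral_sub i1 i2, hM.os hF hτ hh hb, hM.os hF hσ (hh.mono hσ.opt hle) hb, sub_zero]

end Abstract2

section Abstract3

set_option linter.unusedSectionVars false
variable {Ω : Type*} [m0 : MeasurableSpace Ω] {Q : Measure Ω} {G : ℝ → MeasurableSpace Ω} {T : ℝ}

lemma Tm.sup {τ σ : Ω → ℝ} (h1 : Tm T G τ) (h2 : Tm T G σ) : Tm T G (fun p => max (τ p) (σ p)) := by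
  refine ⟨?_, fun p => le_max_of_le_left (h1.nonneg p), fun p => max_le (h1.le p) (h2.le p)⟩
  intro s
  have : {p | max (τ p) (σ p) < s} = {p | τ p < s} ∩ {p | σ p < s} := by
    ext p; simp
  rw [this]
  exact (h1.opt s).inter (h2.opt s)

lemma ortho [IsProbabilityMeasure Q] (hF : Filt Q G) (D u : ℕ → Ω → ℝ) (hu : ∀ k, Tm T G (u k))
    (hmono : ∀ k p, u k p ≤ u (k+1) p) {d : ℝ} (hd : ∀ k p, |D k p| ≤ d)
    (hD : ∀ k, HM G (u (k+1)) (D k))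
    (hz : ∀ k (h : Ω → ℝ) b, HM G (u k) h → (∀ p, |h p| ≤ b) → ∫ p, h p * D k p ∂Q = 0) (n : ℕ) :
    ∫ p, (∑ k ∈ Finset.range n, D k p)^2 ∂Q = ∑ k ∈ Finset.range n, ∫ p, (D k p)^2 ∂Q := by
  have hP : ∀ n, HM G (u n) (fun p => ∑ k ∈ Finset.range n, D k p) ∧
      ∀ p, |∑ k ∈ Finset.range n, D k p| ≤ n * d := by
    intro n
    induction n with
    | zero => simpa using HM.const (hu 0).opt 0
    | succ n ih =>
      simp_rw [Finset.sum_range_succ]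
      refine ⟨(ih.1.mono (hu (n+1)).opt (hmono n)).add (hD n), fun p => ?_⟩
      refine (abs_add_le _ _).trans ?_
      push_cast
      linarith [ih.2 p, hd n p]
  have hDint : ∀ k, Integrable (fun p => (D k p)^2) Q := fun k =>
    integrable_of_bdd (c := d^2) (((hu (k+1)).aem hF (hD k)).pow_const 2) (fun p => by
      rw [abs_pow]; exact pow_le_pow_left₀ (abs_nonneg _) (hd k p) 2)
  have hPint : ∀ k, Integrable (fun p => (∑ k ∈ Finset.range k, D k p)^2) Q := fun k =>
    integrable_of_bdd (c := (k*d)^2) (((hu k).aem hF (hP k).1).pow_const 2) (fun p => by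
      rw [abs_pow]; exact pow_le_pow_left₀ (abs_nonneg _) ((hP k).2 p) 2)
  induction n with
  | zero => simp
  | succ n ih =>
    simp_rw [Finset.sum_range_succ]
    rw [← ih]
    have hXint : Integrable (fun p => (∑ k ∈ Finset.range n, D k p) * D n p) Q := by
      refine integrable_of_bdd (c := (n * d) * d) (((hu n).aem hF (hP n).1).mul ((hu (n+1)).aem hF (hD n))) ?_
      intro p
      rw [abs_mul]
      have := (hP n).2 p
      have h2 := hd n p
      exact mul_le_mul this h2 (abs_nonneg _) ((abs_nonneg _).trans this)
    have e : ∀ p, (∑ k ∈ Finset.range n, D k p + D n p)^2 = (∑ k ∈ Finset.range n, D k p)^2 +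
      (2 * ((∑ k ∈ Finset.range n, D k p) * D n p) + (D n p)^2) := fun p => by ring
    simp_rw [e]
    have hi2 : Integrable (fun p => 2 * ((∑ k ∈ Finset.range n, D k p) * D n p) + (D n p)^2) Q :=
      (hXint.const_mul 2).add (hDint n)
    rw [integral_add (hPint n) hi2, integral_add (hXint.const_mul 2) (hDint n),
      integral_const_mul, hz n _ _ (hP n).1 (hP n).2]
    ring

/-- increments of `2Y - 2 X_a X` -/
lemma incr [IsProbabilityMeasure Q] {c : ℝ} (hF : Filt Q G) {X Y : ℝ → Ω → ℝ} (hX : BM T Q G c X) (hY : BM T Q G c Y)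
    {a u v : Ω → ℝ} (ha : Tm T G a) (hu : Tm T G u) (hv : Tm T G v) (hau : ∀ p, a p ≤ u p) (huv : ∀ p, u p ≤ v p) :
    HM G v (fun p => 2 * (Y (v p) p - Y (u p) p) - 2 * X (a p) p * (X (v p) p - X (u p) p)) ∧
    (∀ p, |2 * (Y (v p) p - Y (u p) p) - 2 * X (a p) p * (X (v p) p - X (u p) p)| ≤ 4 * c + 4 * c^2) ∧
    ∀ (h : Ω → ℝ) b, HM G u h → (∀ p, |h p| ≤ b) →
      ∫ p, h p * (2 * (Y (v p) p - Y (u p) p) - 2 * X (a p) p * (X (v p) p - X (u p) p)) ∂Q = 0 := by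
  have hXa : HM G u (fun p => X (a p) p) := (hX.eval_ad hF ha).mono hu.opt hau
  have hXav : HM G v (fun p => X (a p) p) := hXa.mono hv.opt huv
  have hc : ∀ k : ℝ, HM G v (fun _ => k) := fun k => HM.const hv.opt k
  refine ⟨?_, ?_, ?_⟩
  · have h1 := hY.eval_ad hF hv
    have h2 := (hY.eval_ad hF hu).mono hv.opt huv
    have h3 := hX.eval_ad hF hv
    have h4 := (hX.eval_ad hF hu).mono hv.opt huv
    have := ((hc 2).mul (h1.add ((hc (-1)).mul h2))).add
      (((hc (-2)).mul hXav).mul (h3.add ((hc (-1)).mul h4)))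
    convert this using 2
    ring
  · intro p
    have h1 := abs_le.1 (hY.bdd (v p) p)
    have h2 := abs_le.1 (hY.bdd (u p) p)
    have h3 := hX.bdd (a p) p
    have h4 : |X (v p) p - X (u p) p| ≤ 2 * c := by
      refine (abs_sub _ _).trans ?_
      linarith [hX.bdd (v p) p, hX.bdd (u p) p]
    have h5 : |2 * (Y (v p) p - Y (u p) p)| ≤ 4 * c := by rw [abs_le]; constructor <;> linarith
    have h6 : |2 * X (a p) p * (X (v p) p - X (u p) p)| ≤ 4 * c^2 := by
      rw [abs_mul, abs_mul, abs_two]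
      have := mul_le_mul h3 h4 (abs_nonneg _) ((abs_nonneg _).trans h3)
      nlinarith
    exact (abs_sub _ _).trans (add_le_add h5 h6)
  · intro h b hh hb
    have e1 := hY.os2 hF hu hv huv hh hb
    have e2 := hX.os2 hF hu hv huv (hh.mul hXa) (b := b * c) (fun p => by
      rw [abs_mul]
      exact mul_le_mul (hb p) (hX.bdd _ p) (abs_nonneg _) ((abs_nonneg _).trans (hb p)))
    have e : (fun p => h p * (2 * (Y (v p) p - Y (u p) p) - 2 * X (a p) p * (X (v p) p - X (u p) p))) =
      fun p => 2 * (h p * (Y (v p) p - Y (u p) p)) - 2 * (h p * X (a p) p * (X (v p) p - X (u p) p)) := by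
      ext p; ring
    rw [e, integral_sub (e1.1.const_mul 2) (e2.1.const_mul 2), integral_const_mul, integral_const_mul, e1.2, e2.2]
    ring

/-- one-step estimate -/
lemma onestep [IsProbabilityMeasure Q] (hT : 0 ≤ T) {c : ℝ} (hF : Filt Q G) {X Y : ℝ → Ω → ℝ} (hX : BM T Q G c X) (hY : BM T Q G c Y)
    {a b : Ω → ℝ} (ha : Tm T G a) (hb : Tm T G b) (hab : ∀ p, a p ≤ b p) {δ : ℝ} (hδ : 0 < δ)
    (hX2 : ∀ p t, a p ≤ t → t ≤ b p → |X t p - X (a p) p| ≤ δ)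
    (B : ℝ → Ω → ℝ) (hB : ∀ t p, B t p = X t p ^2 - X 0 p ^2 - 2 * Y t p)
    (hmon : ∀ᵐ p ∂Q, MonotoneOn (fun t => B t p) (Icc 0 T)) :
    ∫ p, (2 * (Y (b p) p - Y (a p) p) - 2 * X (a p) p * (X (b p) p - X (a p) p))^2 ∂Q ≤
      34 * δ^2 * ∫ p, (B (b p) p - B (a p) p) ∂Q := by
  have hc0 : 0 ≤ c := by
    obtain ⟨p0⟩ : Nonempty Ω := nonempty_of_isProbabilityMeasure Q
    exact (abs_nonneg _).trans (hX.bdd 0 p0)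
  have hBb : ∀ t p, |B t p| ≤ 2 * c^2 + 2 * c := by
    intro t p
    rw [hB]
    have h1 : X t p ^2 ≤ c^2 := sq_le_sq' (abs_le.1 (hX.bdd t p)).1 (abs_le.1 (hX.bdd t p)).2
    have h2 : X 0 p ^2 ≤ c^2 := sq_le_sq' (abs_le.1 (hX.bdd 0 p)).1 (abs_le.1 (hX.bdd 0 p)).2
    have h3 := abs_le.1 (hY.bdd t p)
    have := sq_nonneg (X t p); have := sq_nonneg (X 0 p)
    rw [abs_le]; constructor <;> nlinarith
  have hBc : ∀ p, Continuous fun t => B t p := by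
    intro p
    simp_rw [hB]
    exact (((hX.gm.cont p).pow 2).sub continuous_const).sub ((hY.gm.cont p).const_mul 2 |>.congr fun _ => rfl)
  let Z : ℝ → Ω → ℝ := fun r p => B (min r (b p)) p - B (min r (a p)) p
  have hZc : ∀ p, Continuous fun t => Z t p := fun p =>
    ((hBc p).comp (continuous_id.min continuous_const)).sub ((hBc p).comp (continuous_id.min continuous_const))
  have hZe : ∀ r p, Z r p = (X (min (b p) r) p ^2 - 2 * Y (min (b p) r) p) -
      (X (min (a p) r) p ^2 - 2 * Y (min (a p) r) p) := by
    intro r p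
    simp only [Z, hB]
    rw [min_comm r, min_comm r]; ring
  have hZm : ∀ u, Measurable[G u] (Z u) := by
    intro u
    rw [show Z u = _ from funext (hZe u)]
    have h1 := adapted_stop hF hb.opt hX.gm.cont hX.ad u
    have h2 := adapted_stop hF hb.opt hY.gm.cont hY.ad u
    have h3 := adapted_stop hF ha.opt hX.gm.cont hX.ad u
    have h4 := adapted_stop hF ha.opt hY.gm.cont hY.ad u
    exact ((h1.pow_const 2).sub (h2.const_mul 2)).sub ((h3.pow_const 2).sub (h4.const_mul 2))
  have hη : 0 < δ^2 := by positivity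
  let σ : ℕ → Ω → ℝ := fun j p => hit T (fun t => Z t p) (j * δ^2)
  have hσ : ∀ j, Tm T G (σ j) := fun j =>
    ⟨hit_opt hT hF hZc hZm _, fun p => hit_nonneg hT _ _, fun p => hit_le hT _ _⟩
  let u : ℕ → Ω → ℝ := fun j p => min (b p) (max (a p) (σ j p))
  have hu : ∀ j, Tm T G (u j) := fun j => hb.inf (ha.sup (hσ j))
  have hau : ∀ j p, a p ≤ u j p := fun j p => le_min (hab p) (le_max_left _ _)
  have hub : ∀ j p, u j p ≤ b p := fun j p => min_le_left _ _
  have hZ0 : ∀ r p, r ≤ a p → Z r p = 0 := by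
    intro r p hr
    simp only [Z]
    rw [min_eq_left hr, min_eq_left (hr.trans (hab p)), sub_self]
  have hσm : ∀ j p, σ j p ≤ σ (j+1) p := by
    intro j p
    refine le_csInf (hit_nonempty _ _ _) ?_
    rintro r (⟨h1, h2⟩ | h)
    · refine hit_le_of h1 (le_trans ?_ h2)
      push_cast; nlinarith
    · rw [mem_singleton_iff] at h; rw [h]; exact hit_le hT _ _
  have humono : ∀ j p, u j p ≤ u (j+1) p := fun j p =>
    min_le_min le_rfl (max_le_max le_rfl (hσm j p))
  have hu0 : ∀ p, u 0 p = a p := by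
    intro p
    have : σ 0 p ≤ 0 := by
      refine hit_le_of ⟨le_rfl, hT⟩ ?_
      show ((0:ℕ):ℝ) * δ^2 ≤ Z 0 p
      rw [hZ0 0 p (ha.nonneg p)]; simp
    simp only [u]
    rw [max_eq_left (this.trans (ha.nonneg p)), min_eq_right (hab p)]
  obtain ⟨n, hn⟩ := exists_nat_gt ((4 * c^2 + 4 * c) / δ^2)
  have hun : ∀ p, u n p = b p := by
    intro p
    have : σ n p = T := by
      rcases hit_mem hT (hZc p) (c := n * δ^2) with h | h
      · exact h
      · exfalso
        rw [div_lt_iff₀ hη] at hn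
        have h1 := abs_le.1 (hBb (min (hit T (fun t => Z t p) (n * δ^2)) (b p)) p)
        have h2 := abs_le.1 (hBb (min (hit T (fun t => Z t p) (n * δ^2)) (a p)) p)
        simp only [Z] at h h1 h2
        linarith
    simp only [u]
    rw [this, max_eq_right (ha.le p), min_eq_left (hb.le p)]
  let D : ℕ → Ω → ℝ := fun k p => 2 * (Y (u (k+1) p) p - Y (u k p) p) - 2 * X (a p) p * (X (u (k+1) p) p - X (u k p) p)
  have hi := fun k => incr hF hX hY ha (hu k) (hu (k+1)) (hau k) (humono k)
  have horth := ortho hF D u hu humono (fun k => (hi k).2.1) (fun k => (hi k).1) (fun k => (hi k).2.2) n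
  have hsum : ∀ p, ∑ k ∈ Finset.range n, D k p =
      2 * (Y (b p) p - Y (a p) p) - 2 * X (a p) p * (X (b p) p - X (a p) p) := by
    intro p
    simp only [D]
    rw [Finset.sum_sub_distrib, ← Finset.mul_sum, ← Finset.mul_sum,
      Finset.sum_range_sub (fun k => Y (u k p) p), Finset.sum_range_sub (fun k => X (u k p) p), hun, hu0]
  simp_rw [hsum] at horth
  rw [horth]
  have hBi : ∀ {τ : Ω → ℝ}, Tm T G τ → Integrable (fun p => B (τ p) p) Q := by
    intro τ hτ
    refine integrable_of_bdd ?_ (fun p => hBb _ p)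
    simp_rw [hB]
    have h00 : Tm T G (fun _ => (0:ℝ)) := ⟨Opt.const 0, fun _ => le_rfl, fun _ => hT⟩
    exact (((hX.eval_aem hF hτ).pow_const 2).sub ((hX.eval_aem hF h00).pow_const 2)).sub
      ((hY.eval_aem hF hτ).const_mul 2)
  have hstep : ∀ k, ∫ p, (D k p)^2 ∂Q ≤ 34 * δ^2 * ∫ p, (B (u (k+1) p) p - B (u k p) p) ∂Q := by
    intro k
    have hXX := incr hF hX hY (hu k) (hu k) (hu (k+1)) (fun _ => le_rfl) (humono k)
    have hz := hXX.2.2 (fun _ => 1) 1 (HM.const (hu k).opt 1) (fun _ => by simp)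
    have hzi := integrable_of_bdd ((hu (k+1)).aem hF hXX.1) hXX.2.1
    have hDi : Integrable (fun p => (D k p)^2) Q :=
      integrable_of_bdd (c := (4 * c + 4 * c^2)^2) (((hu (k+1)).aem hF (hi k).1).pow_const 2) (fun p => by
        rw [abs_pow]; exact pow_le_pow_left₀ (abs_nonneg _) ((hi k).2.1 p) 2)
    have hBd : Integrable (fun p => B (u (k+1) p) p - B (u k p) p) Q := (hBi (hu (k+1))).sub (hBi (hu k))
    have hle : ∫ p, (D k p)^2 ∂Q ≤ ∫ p, (32 * δ^2 * (2 * (Y (u (k+1) p) p - Y (u k p) p) - 2 * X (u k p) p * (X (u (k+1) p) p - X (u k p) p))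
        + 34 * δ^2 * (B (u (k+1) p) p - B (u k p) p)) ∂Q := by
      refine integral_mono_ae hDi ((hzi.const_mul _).add (hBd.const_mul _)) ?_
      filter_upwards [hmon] with p hp
      have hI : ∀ {t}, a p ≤ t → t ≤ b p → t ∈ Icc 0 T := fun h1 h2 => ⟨(ha.nonneg p).trans h1, h2.trans (hb.le p)⟩
      have hBn : B (u k p) p ≤ B (u (k+1) p) p := hp (hI (hau k p) (hub k p)) (hI (hau _ p) (hub _ p)) (humono k p)
      have hZB : ∀ j, Z (u j p) p = B (u j p) p - B (a p) p := by
        intro j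
        simp only [Z]
        rw [min_eq_left (hub j p), min_eq_right (hau j p)]
      have hZmono : ∀ r r', r ∈ Icc 0 T → r' ∈ Icc 0 T → r ≤ r' → Z r p ≤ Z r' p := by
        intro r r' hr hr' hrr
        rcases le_total r' (a p) with h1 | h1
        · rw [hZ0 _ _ h1, hZ0 _ _ (hrr.trans h1)]
        have hbm : ∀ x, x ∈ Icc 0 T → min x (b p) ∈ Icc 0 T := fun x hx => ⟨le_min hx.1 (hb.nonneg p), (min_le_left _ _).trans hx.2⟩
        have hZr' : Z r' p = B (min r' (b p)) p - B (a p) p := by simp only [Z]; rw [min_eq_right h1]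
        rcases le_total r (a p) with h2 | h2
        · rw [hZ0 _ _ h2, hZr']
          have := hp (hI le_rfl (hab p)) (hbm r' hr') (le_min h1 (hab p))
          simp only at this; linarith
        · have hZr : Z r p = B (min r (b p)) p - B (a p) p := by simp only [Z]; rw [min_eq_right h2]
          rw [hZr, hZr']
          have := hp (hbm r hr) (hbm r' hr') (min_le_min hrr le_rfl)
          simp only at this; linarith
      have hBη : B (u (k+1) p) p - B (u k p) p ≤ δ^2 := by
        have e : B (u (k+1) p) p - B (u k p) p = Z (u (k+1) p) p - Z (u k p) p := by rw [hZB, hZB]; ring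
        rcases le_or_gt (b p) (max (a p) (σ k p)) with h1 | h1
        · have e1 : u k p = b p := min_eq_left h1
          have e2 : u (k+1) p = b p := le_antisymm (hub _ _) (e1 ▸ humono k p)
          rw [e1, e2]; simp [hη.le]
        · rw [e]
          have e1 : u k p = max (a p) (σ k p) := min_eq_right h1.le
          have l1 : (k:ℝ) * δ^2 ≤ Z (u k p) p := by
            have : σ k p < T := (le_max_right _ _).trans_lt (h1.trans_le (hb.le p))
            rcases hit_mem hT (hZc p) (c := k * δ^2) with h | h
            · exact absurd h this.ne
            · refine h.trans (hZmono _ _ ⟨hit_nonneg hT _ _, hit_le hT _ _⟩ (hI (hau k p) (hub k p)) ?_)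
              rw [e1]; exact le_max_right _ _
          have l2 : Z (u (k+1) p) p ≤ ((k+1:ℕ):ℝ) * δ^2 := by
            rcases le_total (σ (k+1) p) (a p) with h2 | h2
            · have : u (k+1) p ≤ a p := (min_le_right _ _).trans (max_le le_rfl h2)
              rw [hZ0 _ _ this]; positivity
            · refine hit_upper hT (hZc p) ?_ ((ha.nonneg p).trans (hau _ p)) ((min_le_right _ _).trans (max_le h2 le_rfl))
              rw [hZ0 0 p (ha.nonneg p)]; positivity
          push_cast at l2
          linarith
      have x1 := abs_le.1 (hX2 p _ (hau k p) (hub k p))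
      have x2 := abs_le.1 (hX2 p _ (hau (k+1) p) (hub (k+1) p))
      set x := X (u k p) p - X (a p) p with hx
      set y := X (u (k+1) p) p - X (a p) p with hy
      set w := B (u (k+1) p) p - B (u k p) p with hw
      have ew := hw
      rw [hB, hB] at ew
      have eD : D k p = (y - x) * (y + x) - w := by
        simp only [D]; rw [ew, hx, hy]; ring
      have e2 : (2 * (Y (u (k+1) p) p - Y (u k p) p) - 2 * X (u k p) p * (X (u (k+1) p) p - X (u k p) p)) = (y-x)^2 - w := by
        rw [ew, hx, hy]; ring
      have hw0 : 0 ≤ w := by rw [hw]; linarith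
      rw [eD, e2]
      have b1 : (y + x)^2 ≤ 4 * δ^2 := by nlinarith
      have b2 : ((y-x)*(y+x))^2 ≤ (y-x)^2 * (4 * δ^2) := by
        rw [mul_pow]; gcongr
      have b3 : w^2 ≤ δ^2 * w := by nlinarith
      have b4 := sq_nonneg ((y-x)*(y+x) + w)
      have b5 := mul_nonneg (sq_nonneg (y-x)) (sq_nonneg δ)
      nlinarith
    rw [integral_add (hzi.const_mul _) (hBd.const_mul _), integral_const_mul, integral_const_mul] at hle
    simp only [one_mul] at hz
    rw [hz] at hle
    linarith
  calc ∑ k ∈ Finset.range n, ∫ p, (D k p)^2 ∂Q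
      ≤ ∑ k ∈ Finset.range n, 34 * δ^2 * ∫ p, (B (u (k+1) p) p - B (u k p) p) ∂Q :=
        Finset.sum_le_sum (fun k _ => hstep k)
    _ = 34 * δ^2 * ∫ p, (B (b p) p - B (a p) p) ∂Q := by
        rw [← Finset.mul_sum]
        congr 1
        simp_rw [fun k => integral_sub (hBi (hu (k+1))) (hBi (hu k))]
        rw [Finset.sum_range_sub (fun k => ∫ p, B (u k p) p ∂Q), ← integral_sub (hBi (hu n)) (hBi (hu 0))]
        simp_rw [hun, hu0]

end Abstract3

section Abstract4

set_option linter.unusedSectionVars false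
variable {Ω : Type*} [m0 : MeasurableSpace Ω] {Q : Measure Ω} {G : ℝ → MeasurableSpace Ω} {T : ℝ}

lemma maxineq [IsProbabilityMeasure Q] (hT : 0 ≤ T) {c : ℝ} (hF : Filt Q G) {X Y : ℝ → Ω → ℝ} (hX : BM T Q G c X) (hY : BM T Q G c Y)
    {σ : ℕ → Ω → ℝ} (hσ : ∀ k, Tm T G (σ k)) (hσm : ∀ k p, σ k p ≤ σ (k+1) p) {δ : ℝ} (hδ : 0 < δ)
    (hX2 : ∀ k p t, σ k p ≤ t → t ≤ σ (k+1) p → |X t p - X (σ k p) p| ≤ δ)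
    (hmon : ∀ᵐ p ∂Q, MonotoneOn (fun t => X t p ^2 - X 0 p ^2 - 2 * Y t p) (Icc 0 T))
    {θ : Ω → ℝ} (hθ : Tm T G θ) {N : Ω → ℝ}
    (hN : ∀ p, ∀ᶠ n in atTop, ∑ k ∈ Finset.range n, (2 * (Y (min (σ (k+1) p) (θ p)) p - Y (min (σ k p) (θ p)) p)
      - 2 * X (min (σ k p) (θ p)) p * (X (min (σ (k+1) p) (θ p)) p - X (min (σ k p) (θ p)) p)) = N p)
    {ε : ℝ} (hε : 0 < ε) :
    Q {p | ε ≤ |N p|} ≤ ENNReal.ofReal (34 * δ^2 * (4 * c^2 + 4 * c) / ε^2) := by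
  have hc0 : 0 ≤ c := by
    obtain ⟨p0⟩ : Nonempty Ω := nonempty_of_isProbabilityMeasure Q
    exact (abs_nonneg _).trans (hX.bdd 0 p0)
  let B : ℝ → Ω → ℝ := fun t p => X t p ^2 - X 0 p ^2 - 2 * Y t p
  have hB : ∀ t p, B t p = X t p ^2 - X 0 p ^2 - 2 * Y t p := fun _ _ => rfl
  have hBb : ∀ t p, |B t p| ≤ 2 * c^2 + 2 * c := by
    intro t p
    rw [hB]
    have h1 : X t p ^2 ≤ c^2 := sq_le_sq' (abs_le.1 (hX.bdd t p)).1 (abs_le.1 (hX.bdd t p)).2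
    have h2 : X 0 p ^2 ≤ c^2 := sq_le_sq' (abs_le.1 (hX.bdd 0 p)).1 (abs_le.1 (hX.bdd 0 p)).2
    have h3 := abs_le.1 (hY.bdd t p)
    have := sq_nonneg (X t p); have := sq_nonneg (X 0 p)
    rw [abs_le]; constructor <;> nlinarith
  have hBi : ∀ {τ : Ω → ℝ}, Tm T G τ → Integrable (fun p => B (τ p) p) Q := by
    intro τ hτ
    refine integrable_of_bdd ?_ (fun p => hBb _ p)
    simp_rw [hB]
    have h00 : Tm T G (fun _ => (0:ℝ)) := ⟨Opt.const 0, fun _ => le_rfl, fun _ => hT⟩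
    exact (((hX.eval_aem hF hτ).pow_const 2).sub ((hX.eval_aem hF h00).pow_const 2)).sub
      ((hY.eval_aem hF hτ).const_mul 2)
  let u : ℕ → Ω → ℝ := fun k p => min (σ k p) (θ p)
  have hu : ∀ k, Tm T G (u k) := fun k => (hσ k).inf hθ
  have hum : ∀ k p, u k p ≤ u (k+1) p := fun k p => min_le_min (hσm k p) le_rfl
  let D : ℕ → Ω → ℝ := fun k p => 2 * (Y (u (k+1) p) p - Y (u k p) p) - 2 * X (u k p) p * (X (u (k+1) p) p - X (u k p) p)
  have hi := fun k => incr hF hX hY (hu k) (hu k) (hu (k+1)) (fun _ => le_rfl) (hum k)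
  have horth := ortho hF D u hu hum (fun k => (hi k).2.1) (fun k => (hi k).1) (fun k => (hi k).2.2)
  have hosc : ∀ k p t, u k p ≤ t → t ≤ u (k+1) p → |X t p - X (u k p) p| ≤ δ := by
    intro k p t h1 h2
    rcases le_total (σ k p) (θ p) with h | h
    · have e : u k p = σ k p := min_eq_left h
      rw [e] at h1 ⊢
      exact hX2 k p t h1 (h2.trans (min_le_left _ _))
    · have e : u k p = θ p := min_eq_right h
      have : t = θ p := le_antisymm (h2.trans (min_le_right _ _)) (e ▸ h1)
      rw [e, this]; simp [hδ.le]
  have hbound : ∀ n, ∫ p, (∑ k ∈ Finset.range n, D k p)^2 ∂Q ≤ 34 * δ^2 * (4 * c^2 + 4 * c) := by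
    intro n
    rw [horth n]
    calc ∑ k ∈ Finset.range n, ∫ p, (D k p)^2 ∂Q
      ≤ ∑ k ∈ Finset.range n, 34 * δ^2 * ∫ p, (B (u (k+1) p) p - B (u k p) p) ∂Q :=
        Finset.sum_le_sum (fun k _ => onestep hT hF hX hY (hu k) (hu (k+1)) (hum k) hδ (hosc k) B hB hmon)
    _ = 34 * δ^2 * ∫ p, (B (u n p) p - B (u 0 p) p) ∂Q := by
        rw [← Finset.mul_sum]
        congr 1
        simp_rw [fun k => integral_sub (hBi (hu (k+1))) (hBi (hu k))]
        rw [Finset.sum_range_sub (fun k => ∫ p, B (u k p) p ∂Q), ← integral_sub (hBi (hu n)) (hBi (hu 0))]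
    _ ≤ 34 * δ^2 * (4 * c^2 + 4 * c) := by
        gcongr
        calc ∫ p, (B (u n p) p - B (u 0 p) p) ∂Q ≤ ∫ p, (4 * c^2 + 4 * c) ∂Q := by
              refine integral_mono ((hBi (hu n)).sub (hBi (hu 0))) (integrable_const _) (fun p => ?_)
              have h1 := abs_le.1 (hBb (u n p) p)
              have h2 := abs_le.1 (hBb (u 0 p) p)
              show B (u n p) p - B (u 0 p) p ≤ _
              linarith
          _ = _ := by simp
  have hm : ∀ n, AEMeasurable (fun p => ∑ k ∈ Finset.range n, D k p) Q := fun n => by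
    have := Finset.aemeasurable_sum (Finset.range n) (fun k _ => (hu (k+1)).aem hF (hi k).1)
    refine this.congr (Eventually.of_forall fun p => ?_)
    simp [D]
  have hNm : AEMeasurable N Q := by
    refine aemeasurable_of_tendsto_metrizable_ae atTop hm (Eventually.of_forall fun p => ?_)
    exact tendsto_const_nhds.congr' ((hN p).mono fun n h => h.symm)
  have hfin : ∫⁻ p, ENNReal.ofReal (N p ^2) ∂Q ≤ ENNReal.ofReal (34 * δ^2 * (4 * c^2 + 4 * c)) := by
    calc ∫⁻ p, ENNReal.ofReal (N p ^2) ∂Q = ∫⁻ p, liminf (fun n => ENNReal.ofReal ((∑ k ∈ Finset.range n, D k p)^2)) atTop ∂Q := by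
          refine lintegral_congr fun p => ?_
          refine (Tendsto.liminf_eq ?_).symm
          exact tendsto_const_nhds.congr' ((hN p).mono fun n h => by rw [← h])
      _ ≤ liminf (fun n => ∫⁻ p, ENNReal.ofReal ((∑ k ∈ Finset.range n, D k p)^2) ∂Q) atTop :=
          lintegral_liminf_le' (fun n => ((hm n).pow_const 2).ennreal_ofReal)
      _ ≤ liminf (fun n : ℕ => ENNReal.ofReal (34 * δ^2 * (4 * c^2 + 4 * c))) atTop := by
          refine liminf_le_liminf (Eventually.of_forall fun n => ?_)
          rw [← ofReal_integral_eq_lintegral_ofReal]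
          · exact ENNReal.ofReal_le_ofReal (hbound n)
          · have hbd : ∀ p, |∑ k ∈ Finset.range n, D k p| ≤ n * (4 * c + 4 * c^2) := by
              intro p
              refine (Finset.abs_sum_le_sum_abs _ _).trans ?_
              refine (Finset.sum_le_sum (fun k _ => (hi k).2.1 p)).trans ?_
              rw [Finset.sum_const, Finset.card_range, nsmul_eq_mul]
            exact integrable_of_bdd (c := (n * (4 * c + 4 * c^2))^2) ((hm n).pow_const 2) (fun p => by
              rw [abs_pow]; exact pow_le_pow_left₀ (abs_nonneg _) (hbd p) 2)
          · exact Eventually.of_forall fun p => sq_nonneg _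
      _ = _ := by simp
  have hε2 : 0 < ε^2 := by positivity
  have hset : {p | ε ≤ |N p|} = {p | ENNReal.ofReal (ε^2) ≤ ENNReal.ofReal (N p ^2)} := by
    ext p
    simp only [mem_ofPred_eq]
    rw [ENNReal.ofReal_le_ofReal_iff (sq_nonneg _), sq_le_sq, abs_of_pos hε]
  rw [hset, ENNReal.ofReal_div_of_pos hε2]
  refine (meas_ge_le_lintegral_div ((hNm.pow_const 2).ennreal_ofReal) ?_ ENNReal.ofReal_ne_top).trans ?_
  · simpa using hε.ne'
  · gcongr

end Abstract4

section Abstract5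

set_option linter.unusedSectionVars false
variable {Ω : Type*} [m0 : MeasurableSpace Ω] {Q : Measure Ω} {G : ℝ → MeasurableSpace Ω} {T : ℝ}

lemma locBM [IsProbabilityMeasure Q] (hT : 0 ≤ T) (hF : Filt Q G) {X : ℝ → Ω → ℝ} (hXc : ∀ p, Continuous fun t => X t p)
    (hXa : ∀ u, Measurable[G u] (X u)) (τ : ℕ → Ω → ℝ) (hτo : ∀ m, Opt G (τ m))
    (hlim : ∀ᵐ p ∂Q, ∀ᶠ m in atTop, T ≤ τ m p)
    (hGM : ∀ m, GM T Q G (fun t p => X (min (τ m p) t) p)) {ρ : Ω → ℝ} (hρ : Tm T G ρ) {A0 : Set Ω}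
    (hA0 : ∀ u, MeasurableSet[G u] A0) {K : ℝ} (hK0 : 0 ≤ K)
    (hb : ∀ p ∈ A0, ∀ t ≤ ρ p, |X t p| ≤ K) :
    BM T Q G K (fun t p => A0.indicator (fun p => X (min (ρ p) t) p) p) := by
  have had : ∀ u, Measurable[G u] (fun p => A0.indicator (fun p => X (min (ρ p) u) p) p) := fun u =>
    Measurable.indicator (m := G u) (adapted_stop hF hρ.opt hXc hXa u) (hA0 u)
  have hbd : ∀ t p, |A0.indicator (fun p => X (min (ρ p) t) p) p| ≤ K := by
    intro t p
    by_cases hp : p ∈ A0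
    · rw [Set.indicator_of_mem hp]; exact hb p hp _ (min_le_left _ _)
    · rw [Set.indicator_of_notMem hp]; simpa using hK0
  have hint : ∀ t, Integrable (fun p => A0.indicator (fun p => X (min (ρ p) t) p) p) Q := fun t =>
    integrable_of_bdd (hF.aem (had t)) (hbd t)
  refine ⟨⟨?_, fun t _ _ => hint t, ?_⟩, had, hbd⟩
  · intro p
    by_cases hp : p ∈ A0
    · simp_rw [Set.indicator_of_mem hp]; exact (hXc p).comp (continuous_const.min continuous_id)
    · simp_rw [Set.indicator_of_notMem hp]; exact continuous_const
  intro s t hs hst ht A hA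
  let H : Set Ω := (A ∩ A0) ∩ {p | s ≤ ρ p}
  let h : Ω → ℝ := H.indicator (fun _ => 1)
  have hconst : ∀ r, 0 ≤ r → r ≤ T → Tm T G (fun _ => r) := fun r h1 h2 => ⟨Opt.const r, fun _ => h1, fun _ => h2⟩
  have hTs : Tm T G (fun p => min (ρ p) s) := hρ.inf (hconst s hs (hst.trans ht))
  have hTt : Tm T G (fun p => min (ρ p) t) := hρ.inf (hconst t (hs.trans hst) ht)
  have hstle : ∀ p, min (ρ p) s ≤ min (ρ p) t := fun p => min_le_min le_rfl hst
  have hHs : MeasurableSet[G s] H := by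
    refine (hA.inter (hA0 s)).inter ?_
    have : {p | s ≤ ρ p} = {p | ρ p < s}ᶜ := by ext p; simp
    rw [this]; exact (hρ.opt s).compl
  have hh : HM G (fun p => min (ρ p) s) h := by
    intro r
    rcases le_or_gt r s with hr | hr
    · have : {p | min (ρ p) s < r}.indicator h = fun _ => 0 := by
        ext p
        by_cases hp : min (ρ p) s < r
        · rw [Set.indicator_of_mem (show p ∈ {p | min (ρ p) s < r} from hp)]
          refine Set.indicator_of_notMem ?_ (fun _ => (1:ℝ))
          rintro ⟨_, h2⟩
          rw [mem_ofPred_eq] at h2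
          rw [min_eq_right h2] at hp
          linarith
        · exact Set.indicator_of_notMem (show p ∉ {p | min (ρ p) s < r} from hp) h
      rw [this]; exact @measurable_const _ _ _ (G r) (0:ℝ)
    · exact Measurable.indicator (m := G r) (Measurable.indicator (m := G r) measurable_const (hF.mono hr.le _ hHs)) (hTs.opt r)
  have hh' := hh.mono hTt.opt hstle
  have hh1 : ∀ p, |h p| ≤ 1 := by
    intro p; simp only [h, Set.indicator]; split_ifs <;> simp
  have hhH : ∀ p, h p ≠ 0 → p ∈ H := fun p hp => by
    by_contra h'; exact hp (Set.indicator_of_notMem h' (fun _ => (1:ℝ)))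
  have key : ∀ m, ∫ p, h p * (X (min (τ m p) (min (ρ p) t)) p - X (min (τ m p) (min (ρ p) s)) p) ∂Q = 0 ∧
      AEMeasurable (fun p => h p * (X (min (τ m p) (min (ρ p) t)) p - X (min (τ m p) (min (ρ p) s)) p)) Q := by
    intro m
    have hMa : ∀ u, Measurable[G u] (fun p => X (min (τ m p) u) p) := fun u => adapted_stop hF (hτo m) hXc hXa u
    have hMc : ∀ p, Continuous fun t => X (min (τ m p) t) p := (hGM m).cont
    have one : ∀ {σ : Ω → ℝ}, Tm T G σ → HM G σ h → (∀ p, σ p ≤ ρ p) →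
        ∫ p, h p * (X (min (τ m p) T) p - X (min (τ m p) (σ p)) p) ∂Q = 0 ∧
        Integrable (fun p => h p * (X (min (τ m p) T) p - X (min (τ m p) (σ p)) p)) Q := by
      intro σ hσ hhσ hle
      constructor
      · refine GM.os hF (hGM m) (C := fun u p => |X (min (τ m p) u) p|) (fun p => (hMc p).abs)
          (fun u => (continuous_abs.measurable.comp (hMa u))) (fun _ _ _ _ => le_rfl) hσ.opt hσ.nonneg hσ.le hhσ hh1 (c := K) ?_
        intro p hp
        exact hb p (hhH p hp).1.2 _ ((min_le_right _ _).trans (hle p))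
      · have i1 : Integrable (fun p => h p * X (min (τ m p) T) p) Q :=
          ((hGM m).int T hT le_rfl).bdd_mul (hσ.aem hF hhσ).aestronglyMeasurable (Eventually.of_forall hh1)
        have i2 : Integrable (fun p => h p * X (min (τ m p) (σ p)) p) Q := by
          refine integrable_of_bdd (c := K) ((hσ.aem hF hhσ).mul (hσ.aem hF (HM.eval hF hσ.opt hMc hMa))) ?_
          intro p
          by_cases hp : h p = 0
          · simp [hp, hK0]
          · rw [abs_mul]
            have := hb p (hhH p hp).1.2 (min (τ m p) (σ p)) ((min_le_right _ _).trans (hle p))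
            calc |h p| * _ ≤ 1 * K := mul_le_mul (hh1 p) this (abs_nonneg _) zero_le_one
              _ = K := one_mul K
        exact (i1.sub i2).congr (Eventually.of_forall fun p => by simp; ring)
    obtain ⟨z1, i1⟩ := one hTs hh (fun p => min_le_left _ _)
    obtain ⟨z2, i2⟩ := one hTt hh' (fun p => min_le_left _ _)
    have e : (fun p => h p * (X (min (τ m p) (min (ρ p) t)) p - X (min (τ m p) (min (ρ p) s)) p)) =
      fun p => h p * (X (min (τ m p) T) p - X (min (τ m p) (min (ρ p) s)) p) -
        h p * (X (min (τ m p) T) p - X (min (τ m p) (min (ρ p) t)) p) := by ext p; ring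
    rw [e]
    exact ⟨by rw [integral_sub i1 i2, z1, z2, sub_zero], (i1.sub i2).aemeasurable⟩
  have hlimI : Tendsto (fun m => ∫ p, h p * (X (min (τ m p) (min (ρ p) t)) p - X (min (τ m p) (min (ρ p) s)) p) ∂Q) atTop
      (𝓝 (∫ p, h p * (X (min (ρ p) t) p - X (min (ρ p) s) p) ∂Q)) := by
    refine tendsto_integral_of_dominated_convergence (fun _ => 2 * K) (fun m => (key m).2.aestronglyMeasurable)
      (integrable_const _) (fun m => Eventually.of_forall fun p => ?_) ?_
    · rw [Real.norm_eq_abs]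
      by_cases hp : h p = 0
      · simp [hp, hK0]
      · have hpA := (hhH p hp).1.2
        have h1 := hb p hpA (min (τ m p) (min (ρ p) t)) ((min_le_right _ _).trans (min_le_left _ _))
        have h2 := hb p hpA (min (τ m p) (min (ρ p) s)) ((min_le_right _ _).trans (min_le_left _ _))
        rw [abs_mul]
        have h3 := (abs_sub (X (min (τ m p) (min (ρ p) t)) p) (X (min (τ m p) (min (ρ p) s)) p))
        calc |h p| * _ ≤ 1 * (2 * K) := mul_le_mul (hh1 p) (by linarith) (abs_nonneg _) zero_le_one
          _ = _ := one_mul _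
    · filter_upwards [hlim] with p hp
      refine tendsto_const_nhds.congr' ?_
      filter_upwards [hp] with m hm
      rw [min_eq_right ((min_le_right _ _).trans (ht.trans hm)),
        min_eq_right ((min_le_right _ _).trans ((hst.trans ht).trans hm))]
  simp_rw [fun m => (key m).1] at hlimI
  have hfin := tendsto_nhds_unique hlimI tendsto_const_nhds
  have hAn := hF.null s A hA
  rw [← integral_indicator₀ hAn, ← hfin]
  refine integral_congr_ae (Eventually.of_forall fun p => ?_)
  simp only [h, H]
  by_cases h1 : p ∈ A
  · by_cases h2 : p ∈ A0
    · by_cases h3 : s ≤ ρ p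
      · simp [Set.indicator, h1, h2, h3]
      · have h4 : ρ p ≤ s := (not_le.1 h3).le
        simp [Set.indicator, h1, h2, h3, h4, h4.trans hst]
    · simp [Set.indicator, h1, h2]
  · simp [Set.indicator, h1]

end Abstract5

section Concrete

set_option linter.unusedSectionVars false
variable {T : ℝ} (hT : 0 ≤ T)

lemma ev_cont (ω : Path T) : Continuous fun t => ev T hT ω t :=
  ω.continuous.comp (continuous_projIcc (h := hT))

lemma ev_neg (ω : Path T) {t : ℝ} (ht : t ≤ 0) : ev T hT ω t = ev T hT ω 0 := by
  simp only [ev, clamp]; rw [projIcc_of_le_left hT ht, projIcc_left]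

lemma ev_big (ω : Path T) {t : ℝ} (ht : T ≤ t) : ev T hT ω t = ev T hT ω T := by
  simp only [ev, clamp]; rw [projIcc_of_right_le hT ht, projIcc_right]

lemma ev_Icc (ω : Path T) (t : Icc (0:ℝ) T) : ev T hT ω t = ω t := by
  simp only [ev, clamp]; rw [projIcc_val]

lemma clamp_le {t s : ℝ} (h : t ≤ s) (hs : 0 ≤ s) : (clamp T hT t : ℝ) ≤ s := by
  simp only [clamp, coe_projIcc]
  exact max_le hs ((min_le_right _ _).trans h)

lemma FbarRaw_mono {s t : ℝ} (h : s ≤ t) : FbarRaw T s ≤ FbarRaw T t := by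
  refine iSup_le fun r => iSup_le fun hr => ?_
  exact le_iSup₂_of_le r (hr.trans h) le_rfl

lemma FbarRaw_le (s : ℝ) : FbarRaw T s ≤ (inferInstance : MeasurableSpace (PathPair T)) := by
  refine iSup_le fun r => iSup_le fun _ => ?_
  rw [← measurable_iff_comap_le]
  have h : ∀ r : Icc (0:ℝ) T, Measurable (fun ω : Path T => ω r) := fun r =>
    (continuous_eval_const r).measurable
  exact ((h r).comp measurable_fst).prodMk ((h r).comp measurable_snd)

lemma raw_pair {s : ℝ} (r : Icc (0:ℝ) T) (hr : (r : ℝ) ≤ s) :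
    Measurable[FbarRaw T s] (fun p : PathPair T => (p.1 r, p.2 r)) := by
  rw [measurable_iff_comap_le]
  exact le_iSup₂_of_le r hr le_rfl

lemma raw_ev1 {s : ℝ} (hs : 0 ≤ s) {t : ℝ} (hts : t ≤ s) :
    Measurable[FbarRaw T s] (fun p : PathPair T => ev T hT p.1 t) :=
  measurable_fst.comp (raw_pair (clamp T hT t) (clamp_le hT hts hs))

lemma raw_ev2 {s : ℝ} (hs : 0 ≤ s) {t : ℝ} (hts : t ≤ s) :
    Measurable[FbarRaw T s] (fun p : PathPair T => ev T hT p.2 t) :=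
  measurable_snd.comp (raw_pair (clamp T hT t) (clamp_le hT hts hs))

/-- completed filtration -/
def Gc (Q : Measure (PathPair T)) (s : ℝ) : MeasurableSpace (PathPair T) :=
  eventuallyMeasurableSpace (FbarRaw T (max s 0)) (ae Q)

lemma raw_le_Gc (Q : Measure (PathPair T)) {r s : ℝ} (h : r ≤ max s 0) : FbarRaw T r ≤ Gc Q s := by
  intro A hA
  exact ⟨A, FbarRaw_mono h _ hA, EventuallyEq.refl _ _⟩

lemma Gc_filt (Q : Measure (PathPair T)) : Filt Q (Gc Q) := by
  constructor
  · rintro s t hst A ⟨B, hB, hAB⟩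
    exact ⟨B, FbarRaw_mono (max_le_max hst le_rfl) _ hB, hAB⟩
  · rintro s A ⟨B, hB, hAB⟩
    exact ⟨B, FbarRaw_le _ _ hB, hAB⟩

lemma Gc_null (Q : Measure (PathPair T)) {A : Set (PathPair T)} (hA : Q A = 0) (s : ℝ) : MeasurableSet[Gc Q s] A := by
  refine ⟨∅, @MeasurableSet.empty _ (FbarRaw T (max s 0)), ?_⟩
  exact ae_eq_empty.2 hA

lemma S_ad (Q : Measure (PathPair T)) (u : ℝ) : Measurable[Gc Q u] (SbarProc T hT u) :=
  (raw_ev1 hT (le_max_right u 0) (le_max_left u 0)).mono (raw_le_Gc Q le_rfl) le_rfl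

lemma SS_ad (Q : Measure (PathPair T)) (u : ℝ) : Measurable[Gc Q u] (SSbarProc T hT u) := by
  refine Measurable.mono ?_ (raw_le_Gc Q (le_refl (max u 0))) le_rfl
  have h1 := raw_ev1 hT (le_max_right u 0) (le_max_left u 0)
  have h2 := raw_ev1 hT (le_max_right u 0) (le_max_right u 0)
  have h3 := raw_ev2 hT (le_max_right u 0) (le_max_left u 0)
  exact ((((h1.pow_const 2).sub (h2.pow_const 2)).sub h3).div_const 2)

lemma S_cont (p : PathPair T) : Continuous fun t => SbarProc T hT t p := ev_cont hT p.1

lemma SS_cont (p : PathPair T) : Continuous fun t => SSbarProc T hT t p :=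
  (((((ev_cont hT p.1).pow 2).sub continuous_const).sub (ev_cont hT p.2)).div_const 2)

/-- size process -/
def RR (t : ℝ) (p : PathPair T) : ℝ := |ev T hT p.1 t| + |ev T hT p.2 t|

lemma RR_cont (p : PathPair T) : Continuous fun t => RR hT t p :=
  (ev_cont hT p.1).abs.add (ev_cont hT p.2).abs

lemma RR_ad (Q : Measure (PathPair T)) (u : ℝ) : Measurable[Gc Q u] (RR hT u) := by
  refine Measurable.mono ?_ (raw_le_Gc Q (le_refl (max u 0))) le_rfl
  have h1 := raw_ev1 hT (le_max_right u 0) (le_max_left u 0)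
  have h3 := raw_ev2 hT (le_max_right u 0) (le_max_left u 0)
  exact (continuous_abs.measurable.comp h1).add (continuous_abs.measurable.comp h3)

lemma RR_le (t : ℝ) (p : PathPair T) : RR hT t p ≤ ‖p.1‖ + ‖p.2‖ :=
  add_le_add (p.1.norm_coe_le_norm _) (p.2.norm_coe_le_norm _)

/-- localising time -/
def rho (c : ℝ) (p : PathPair T) : ℝ := hit T (fun t => RR hT t p) c

/-- localising set -/
def Aset (c : ℝ) : Set (PathPair T) := {p | RR hT 0 p ≤ c}

lemma rho_Tm (Q : Measure (PathPair T)) (c : ℝ) : Tm T (Gc Q) (rho hT c) :=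
  ⟨hit_opt hT (Gc_filt Q) (RR_cont hT) (RR_ad hT Q) c, fun _ => hit_nonneg hT _ _, fun _ => hit_le hT _ _⟩

lemma Aset_meas (Q : Measure (PathPair T)) (c u : ℝ) : MeasurableSet[Gc Q u] (Aset hT c) := by
  have h1 := raw_ev1 (T := T) hT (le_max_right u 0) (le_max_right u 0)
  have h3 := raw_ev2 (T := T) hT (le_max_right u 0) (le_max_right u 0)
  have : Measurable[FbarRaw T (max u 0)] (RR hT 0) :=
    (continuous_abs.measurable.comp h1).add (continuous_abs.measurable.comp h3)
  exact raw_le_Gc Q (le_refl (max u 0)) _ (this measurableSet_Iic)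

lemma RR_bd {c : ℝ} {p : PathPair T} (hp : p ∈ Aset hT c) {t : ℝ} (ht : t ≤ rho hT c p) : RR hT t p ≤ c := by
  rcases le_total 0 t with h0 | h0
  · exact hit_upper hT (RR_cont hT p) hp h0 ht
  · have : RR hT t p = RR hT 0 p := by simp only [RR]; rw [ev_neg hT _ h0, ev_neg hT _ h0]
    rw [this]; exact hp

lemma rho_big {c : ℝ} {p : PathPair T} (hc : ‖p.1‖ + ‖p.2‖ < c) : rho hT c p = T ∧ p ∈ Aset hT c := by
  constructor
  · rcases hit_mem hT (RR_cont hT p) (c := c) with h | h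
    · exact h
    · have h2 := RR_le hT (hit T (fun t => RR hT t p) c) p
      linarith
  · exact (RR_le hT 0 p).trans hc.le

lemma stop_norm {τ : PathPair T → ℝ} (hτ : IsStopBarRaw T τ) (Q : Measure (PathPair T)) :
    Opt (Gc Q) (fun p => max 0 (min (τ p) T)) := by
  intro s
  rcases le_or_gt s 0 with h | h
  · have : {p | max 0 (min (τ p) T) < s} = ∅ := by
      ext p; simp; intro h1; linarith
    rw [this]; exact @MeasurableSet.empty _ (Gc Q s)
  rcases le_or_gt s T with h' | h'
  · have : {p | max 0 (min (τ p) T) < s} = ⋃ (q : ℚ) (_ : 0 ≤ (q:ℝ) ∧ (q:ℝ) < s), {p | τ p ≤ q} := by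
      ext p
      simp only [mem_ofPred_eq, mem_iUnion]
      constructor
      · intro hp
        obtain ⟨q, hq1, hq2⟩ := exists_rat_btwn hp
        refine ⟨q, ⟨(le_max_left _ _).trans hq1.le, hq2⟩, ?_⟩
        have h3 : min (τ p) T < q := (le_max_right _ _).trans_lt hq1
        rcases min_lt_iff.1 h3 with h4 | h4
        · exact h4.le
        · linarith
      · rintro ⟨q, ⟨hq1, hq2⟩, h3⟩
        exact max_lt h ((min_le_left _ _).trans_lt (h3.trans_lt hq2))
    rw [this]
    refine MeasurableSet.iUnion fun q => MeasurableSet.iUnion fun hq => ?_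
    exact raw_le_Gc Q (hq.2.le.trans (le_max_left _ _)) _ (hτ q ⟨hq.1, hq.2.le.trans h'⟩)
  · have : {p | max 0 (min (τ p) T) < s} = univ := by
      ext p; simp [h, h']
    rw [this]; exact @MeasurableSet.univ _ (Gc Q s)

lemma conc_BM {Q : Measure (PathPair T)} [IsProbabilityMeasure Q] {X : ℝ → PathPair T → ℝ}
    (hX : IsLocalMartBar T Q X) (hXc : ∀ p, Continuous fun t => X t p) (hXa : ∀ u, Measurable[Gc Q u] (X u))
    (hneg : ∀ t p, t ≤ 0 → X t p = X 0 p) (c : ℝ) {K : ℝ} (hK : 0 ≤ K)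
    (hb : ∀ p ∈ Aset hT c, ∀ t ≤ rho hT c p, |X t p| ≤ K) :
    BM T Q (Gc Q) K (fun t p => (Aset hT c).indicator (fun p => X (min (rho hT c p) t) p) p) := by
  obtain ⟨τ, h1, h2, h3⟩ := hX
  have hpos : ∀ t p, X (max 0 t) p = X t p := by
    intro t p
    rcases le_total 0 t with h | h
    · rw [max_eq_right h]
    · rw [max_eq_left h, hneg t p h]
  have heq : ∀ m t p, 0 ≤ t → t ≤ T → X (min (max 0 (min (τ m p) T)) t) p = X (min (τ m p) t) p := by
    intro m t p h0 ht
    rw [← hpos (min (τ m p) t)]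
    congr 1
    rw [max_min_distrib_left, max_min_distrib_left, max_eq_right h0, max_eq_right hT, min_assoc, min_eq_right ht]
  refine locBM hT (Gc_filt Q) hXc hXa (fun m p => max 0 (min (τ m p) T)) (fun m => stop_norm (h1 m) Q) ?_ ?_
    (rho_Tm hT Q c) (Aset_meas hT Q c) hK hb
  · filter_upwards [h2] with p hp
    filter_upwards [hp.2.eventually_ge_atTop T] with m hm
    rw [min_eq_right hm]; exact le_max_right _ _
  · intro m
    obtain ⟨i1, i2⟩ := h3 m
    have hint : ∀ t, 0 ≤ t → t ≤ T → Integrable (fun p => X (min (max 0 (min (τ m p) T)) t) p) Q := by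
      intro t h0 ht
      simp_rw [fun p => heq m t p h0 ht]
      exact i1 t ⟨h0, ht⟩
    refine ⟨fun p => (hXc p).comp (continuous_const.min continuous_id), hint, ?_⟩
    rintro s t hs hst ht A ⟨A', hA', hAA⟩
    have e : ∫ p in A, (X (min (max 0 (min (τ m p) T)) t) p - X (min (max 0 (min (τ m p) T)) s) p) ∂Q =
        ∫ p in A', (X (min (max 0 (min (τ m p) T)) t) p - X (min (max 0 (min (τ m p) T)) s) p) ∂Q :=
      setIntegral_congr_set hAA
    rw [e, integral_sub (hint t (hs.trans hst) ht).integrableOn (hint s hs (hst.trans ht)).integrableOn]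
    simp_rw [fun p => heq m t p (hs.trans hst) ht, fun p => heq m s p hs (hst.trans ht)]
    rw [max_eq_left hs] at hA'
    rw [i2 s t ⟨hs, hst.trans ht⟩ ⟨hs.trans hst, ht⟩ hst A' hA', sub_self]

lemma S_bd (c : ℝ) : ∀ p ∈ Aset hT c, ∀ t ≤ rho hT c p, |SbarProc T hT t p| ≤ c + c^2 := by
  intro p hp t ht
  have := RR_bd hT hp ht
  have h2 : |SbarProc T hT t p| ≤ RR hT t p := le_add_of_nonneg_right (abs_nonneg _)
  nlinarith [sq_nonneg c]

lemma SS_bd (c : ℝ) : ∀ p ∈ Aset hT c, ∀ t ≤ rho hT c p, |SSbarProc T hT t p| ≤ c + c^2 := by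
  intro p hp t ht
  have h1 := RR_bd hT hp ht
  have h2 : RR hT 0 p ≤ c := hp
  simp only [RR] at h1 h2
  simp only [SSbarProc]
  set x := ev T hT p.1 t
  set y := ev T hT p.1 0
  set z := ev T hT p.2 t
  have hx : |x| ≤ c := by linarith [abs_nonneg z]
  have hz : |z| ≤ c := by linarith [abs_nonneg x]
  have hy : |y| ≤ c := by linarith [abs_nonneg (ev T hT p.2 0)]
  have hc : 0 ≤ c := (abs_nonneg _).trans hx
  have hx2 : x^2 ≤ c^2 := sq_le_sq' (abs_le.1 hx).1 (abs_le.1 hx).2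
  have hy2 : y^2 ≤ c^2 := sq_le_sq' (abs_le.1 hy).1 (abs_le.1 hy).2
  have hz2 := abs_le.1 hz
  rw [abs_le]
  constructor <;> nlinarith [sq_nonneg x, sq_nonneg y]

lemma S_BM {Q : Measure (PathPair T)} [IsProbabilityMeasure Q] (hX : IsLocalMartBar T Q (SbarProc T hT)) {c : ℝ} (hc : 0 ≤ c) :
    BM T Q (Gc Q) (c + c^2) (fun t p => (Aset hT c).indicator (fun p => SbarProc T hT (min (rho hT c p) t) p) p) :=
  conc_BM hT hX (S_cont hT) (S_ad hT Q) (fun _ _ h => ev_neg hT _ h) c (by positivity) (S_bd hT c)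

lemma SS_BM {Q : Measure (PathPair T)} [IsProbabilityMeasure Q] (hX : IsLocalMartBar T Q (SSbarProc T hT)) {c : ℝ} (hc : 0 ≤ c) :
    BM T Q (Gc Q) (c + c^2) (fun t p => (Aset hT c).indicator (fun p => SSbarProc T hT (min (rho hT c p) t) p) p) :=
  conc_BM hT hX (SS_cont hT) (SS_ad hT Q) (fun t p h => by simp only [SSbarProc]; rw [ev_neg hT _ h, ev_neg hT _ h]) c (by positivity) (SS_bd hT c)

end Concrete

section Concrete2

set_option linter.unusedSectionVars false
variable {T : ℝ} (hT : 0 ≤ T)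

lemma ev_minT (ω : Path T) (t : ℝ) : ev T hT ω (min t T) = ev T hT ω t := by
  rcases le_total t T with h | h
  · rw [min_eq_left h]
  · rw [min_eq_right h, ev_big hT ω h]

lemma sig_succ (m k : ℕ) (ω : Path T) : sig T hT m (k+1) ω =
    sInf ({t : ℝ | sig T hT m k ω ≤ t ∧ t ≤ T ∧
        (2:ℝ) ^ (-(m:ℤ)) ≤ |ev T hT ω t - ev T hT ω (sig T hT m k ω)|} ∪ {T + 1}) := rfl

lemma sig_bdd (m k : ℕ) (ω : Path T) (h : sig T hT m k ω ≤ T + 1) : BddBelow ({t : ℝ | sig T hT m k ω ≤ t ∧ t ≤ T ∧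
        (2:ℝ) ^ (-(m:ℤ)) ≤ |ev T hT ω t - ev T hT ω (sig T hT m k ω)|} ∪ {T + 1}) := by
  refine ⟨sig T hT m k ω, ?_⟩
  rintro r (h1 | h1)
  · exact h1.1
  · rw [mem_singleton_iff] at h1; rw [h1]; exact h

lemma sig_basic (m k : ℕ) (ω : Path T) : 0 ≤ sig T hT m k ω ∧ sig T hT m k ω ≤ T + 1 ∧
    sig T hT m k ω ≤ sig T hT m (k+1) ω := by
  have step : ∀ k, sig T hT m k ω ≤ T + 1 → sig T hT m k ω ≤ sig T hT m (k+1) ω := by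
    intro k h
    rw [sig_succ]
    refine le_csInf ⟨T+1, by simp⟩ ?_
    rintro r (h1 | h1)
    · exact h1.1
    · rw [mem_singleton_iff] at h1; rw [h1]; exact h
  have : 0 ≤ sig T hT m k ω ∧ sig T hT m k ω ≤ T + 1 := by
    induction k with
    | zero => exact ⟨le_rfl, by show (0:ℝ) ≤ T + 1; linarith⟩
    | succ k ih =>
      refine ⟨ih.1.trans (step k ih.2), ?_⟩
      rw [sig_succ]
      exact csInf_le (sig_bdd hT m k ω ih.2) (by simp)
  exact ⟨this.1, this.2, step k this.2⟩

lemma sig_closed (m k : ℕ) (ω : Path T) : IsClosed ({t : ℝ | sig T hT m k ω ≤ t ∧ t ≤ T ∧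
        (2:ℝ) ^ (-(m:ℤ)) ≤ |ev T hT ω t - ev T hT ω (sig T hT m k ω)|} ∪ {T + 1}) := by
  refine IsClosed.union ?_ isClosed_singleton
  refine (isClosed_le continuous_const continuous_id).inter ((isClosed_le continuous_id continuous_const).inter ?_)
  exact isClosed_le continuous_const (((ev_cont hT ω).sub continuous_const).abs)

lemma sig_mem (m k : ℕ) (ω : Path T) (h : sig T hT m (k+1) ω ≤ T) :
    (2:ℝ) ^ (-(m:ℤ)) ≤ |ev T hT ω (sig T hT m (k+1) ω) - ev T hT ω (sig T hT m k ω)| := by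
  have := (sig_closed hT m k ω).csInf_mem ⟨T+1, by simp⟩ (sig_bdd hT m k ω (sig_basic hT m k ω).2.1)
  rw [← sig_succ] at this
  rcases this with h1 | h1
  · exact h1.2.2
  · rw [mem_singleton_iff] at h1; linarith

lemma sig_mono (m : ℕ) (ω : Path T) : Monotone fun k => sig T hT m k ω :=
  monotone_nat_of_le_succ fun k => (sig_basic hT m k ω).2.2

lemma sig_event (m : ℕ) (ω : Path T) : ∃ k, T < sig T hT m k ω := by
  by_contra hcon
  push Not at hcon
  have hlim := tendsto_atTop_ciSup (sig_mono hT m ω) ⟨T, by rintro _ ⟨k, rfl⟩; exact hcon k⟩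
  set L := ⨆ k, sig T hT m k ω
  have h1 : Tendsto (fun k => ev T hT ω (sig T hT m k ω)) atTop (𝓝 (ev T hT ω L)) :=
    ((ev_cont hT ω).tendsto L).comp hlim
  have h2 := (h1.comp (tendsto_add_atTop_nat 1)).sub h1
  have h3 := h2.abs
  rw [sub_self, abs_zero] at h3
  have hpos : (0:ℝ) < (2:ℝ) ^ (-(m:ℤ)) := by positivity
  have h4 := ge_of_tendsto' h3 (fun k => sig_mem hT m k ω (hcon (k+1)))
  linarith

/-- capped times -/
def sg (m k : ℕ) (p : PathPair T) : ℝ := min (sig T hT m k p.1) T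

lemma sg_succ (m k : ℕ) (p : PathPair T) : sg hT m (k+1) p =
    hit T (fun r => |ev T hT p.1 r - ev T hT p.1 (min (sg hT m k p) r)|) ((2:ℝ) ^ (-(m:ℤ))) := by
  have hpos : (0:ℝ) < (2:ℝ) ^ (-(m:ℤ)) := by positivity
  have hE : {r | r ∈ Icc 0 T ∧ (2:ℝ) ^ (-(m:ℤ)) ≤ |ev T hT p.1 r - ev T hT p.1 (min (sg hT m k p) r)|} =
    {t : ℝ | sig T hT m k p.1 ≤ t ∧ t ≤ T ∧
        (2:ℝ) ^ (-(m:ℤ)) ≤ |ev T hT p.1 t - ev T hT p.1 (sig T hT m k p.1)|} := by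
    ext r
    simp only [mem_ofPred_eq, mem_Icc, sg]
    constructor
    · rintro ⟨⟨h0, h1⟩, h2⟩
      rcases le_total (sig T hT m k p.1) r with h | h
      · rw [min_eq_left (h.trans h1), min_eq_left h] at h2
        exact ⟨h, h1, h2⟩
      · rw [min_eq_right (le_min h h1)] at h2
        rw [sub_self, abs_zero] at h2; linarith
    · rintro ⟨h0, h1, h2⟩
      refine ⟨⟨(sig_basic hT m k p.1).1.trans h0, h1⟩, ?_⟩
      rw [min_eq_left (h0.trans h1), min_eq_left h0]; exact h2
  simp only [sg, hit]
  simp only [sg] at hE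
  rw [hE, sig_succ]
  set E := {t : ℝ | sig T hT m k p.1 ≤ t ∧ t ≤ T ∧
        (2:ℝ) ^ (-(m:ℤ)) ≤ |ev T hT p.1 t - ev T hT p.1 (sig T hT m k p.1)|}
  rcases E.eq_empty_or_nonempty with h | h
  · rw [h]; simp
  · have hb : BddBelow E := ⟨sig T hT m k p.1, fun r hr => hr.1⟩
    rw [csInf_union hb h (bddBelow_singleton) (singleton_nonempty _), csInf_union hb h (bddBelow_singleton) (singleton_nonempty _)]
    simp [inf_assoc]

lemma sg_zero (m : ℕ) (p : PathPair T) : sg hT m 0 p = 0 := min_eq_left hT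

lemma sg_mono (m k : ℕ) (p : PathPair T) : sg hT m k p ≤ sg hT m (k+1) p :=
  min_le_min (sig_basic hT m k p.1).2.2 le_rfl

lemma sg_nonneg (m k : ℕ) (p : PathPair T) : 0 ≤ sg hT m k p := le_min (sig_basic hT m k p.1).1 hT

lemma sg_Tm (Q : Measure (PathPair T)) (m k : ℕ) : Tm T (Gc Q) (sg hT m k) := by
  refine ⟨?_, sg_nonneg hT m k, fun p => min_le_right _ _⟩
  induction k with
  | zero =>
    rw [show sg hT m 0 = fun _ => 0 from funext (sg_zero hT m)]; exact Opt.const 0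
  | succ k ih =>
    rw [show sg hT m (k+1) = _ from funext (sg_succ hT m k)]
    refine hit_opt hT (Gc_filt Q) (Z := fun r p => |ev T hT p.1 r - ev T hT p.1 (min (sg hT m k p) r)|) ?_ ?_ _
    · intro p
      exact ((ev_cont hT p.1).sub ((ev_cont hT p.1).comp (continuous_const.min continuous_id))).abs
    · intro u
      exact continuous_abs.measurable.comp ((S_ad hT Q u).sub (adapted_stop (Gc_filt Q) ih (S_cont hT) (S_ad hT Q) u))

lemma sg_osc (m k : ℕ) (p : PathPair T) {t : ℝ} (h1 : sg hT m k p ≤ t) (h2 : t ≤ sg hT m (k+1) p) :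
    |ev T hT p.1 t - ev T hT p.1 (sg hT m k p)| ≤ (2:ℝ) ^ (-(m:ℤ)) := by
  rw [sg_succ] at h2
  have := hit_upper hT (Z := fun r => |ev T hT p.1 r - ev T hT p.1 (min (sg hT m k p) r)|)
    ((ev_cont hT p.1).sub ((ev_cont hT p.1).comp (continuous_const.min continuous_id))).abs ?_
    ((sg_nonneg hT m k p).trans h1) h2
  · simpa [min_eq_left h1] using this
  · simp only [min_eq_right (sg_nonneg hT m k p), sub_self, abs_zero]; positivity

/-- error process -/
def Nm (m : ℕ) (t : ℝ) (p : PathPair T) : ℝ := 2 * (SSbarProc T hT t p - SSbarProc T hT 0 p) - 2 * Sm T hT m t p.1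

lemma SS_minT (t : ℝ) (p : PathPair T) : SSbarProc T hT (min T t) p = SSbarProc T hT t p := by
  simp only [SSbarProc]; rw [min_comm, ev_minT, ev_minT]

lemma SS_neg (t : ℝ) (p : PathPair T) (h : t ≤ 0) : SSbarProc T hT t p = SSbarProc T hT 0 p := by
  simp only [SSbarProc]; rw [ev_neg hT _ h, ev_neg hT _ h]

lemma Nm_sum (m : ℕ) (p : PathPair T) : ∀ᶠ n in atTop, ∀ t, ∑ k ∈ Finset.range n,
    (2 * (SSbarProc T hT (min (sg hT m (k+1) p) t) p - SSbarProc T hT (min (sg hT m k p) t) p)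
      - 2 * SbarProc T hT (min (sg hT m k p) t) p *
        (SbarProc T hT (min (sg hT m (k+1) p) t) p - SbarProc T hT (min (sg hT m k p) t) p)) = Nm hT m t p := by
  obtain ⟨k0, hk0⟩ := sig_event hT m p.1
  have hbig : ∀ k, k0 ≤ k → T < sig T hT m k p.1 := fun k hk => hk0.trans_le (sig_mono hT m p.1 hk)
  have hev : ∀ k t, ev T hT p.1 (min (sig T hT m k p.1) t) = ev T hT p.1 (min (sg hT m k p) t) := by
    intro k t
    rw [← ev_minT hT p.1 (min (sig T hT m k p.1) t), sg, min_right_comm]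
  filter_upwards [eventually_ge_atTop k0] with n hn t
  have hsgn : sg hT m n p = T := min_eq_right (hbig n hn).le
  have hSm : Sm T hT m t p.1 = ∑ k ∈ Finset.range n, SbarProc T hT (min (sg hT m k p) t) p *
        (SbarProc T hT (min (sg hT m (k+1) p) t) p - SbarProc T hT (min (sg hT m k p) t) p) := by
    rw [Sm, tsum_eq_sum (s := Finset.range n)]
    · refine Finset.sum_congr rfl fun k _ => ?_
      rw [hev, hev]
      simp only [SbarProc]
      rcases le_total (sg hT m k p) t with h | h
      · have : ev T hT p.1 (sig T hT m k p.1) = ev T hT p.1 (min (sg hT m k p) t) := by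
          rw [min_eq_left h, sg, ev_minT]
        rw [this]
      · rw [min_eq_right h, min_eq_right (h.trans (sg_mono hT m k p))]; simp
    · intro k hk
      have hk' : n ≤ k := by simpa using hk
      rw [hev, hev]
      have h1 : sg hT m k p = T := min_eq_right (hbig k (hn.trans hk')).le
      have h2 : sg hT m (k+1) p = T := min_eq_right (hbig (k+1) (by omega)).le
      rw [h1, h2]; simp
  rw [Finset.sum_sub_distrib, ← Finset.mul_sum, Finset.sum_range_sub (fun k => SSbarProc T hT (min (sg hT m k p) t) p)]
  simp only [Nm]
  rw [hSm, hsgn, sg_zero, Finset.mul_sum]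
  simp_rw [mul_assoc]
  rw [SS_minT]
  congr 3
  rcases le_total 0 t with h | h
  · rw [min_eq_left h]
  · rw [min_eq_right h, SS_neg hT t p h]

lemma Nm_cont (m : ℕ) (p : PathPair T) : Continuous fun t => Nm hT m t p := by
  obtain ⟨n, hn⟩ := (Nm_sum hT m p).exists
  simp_rw [← hn]
  refine continuous_finsetSum _ fun k _ => ?_
  have h1 : ∀ k, Continuous fun t => SSbarProc T hT (min (sg hT m k p) t) p := fun k =>
    (SS_cont hT p).comp (continuous_const.min continuous_id)
  have h2 : ∀ k, Continuous fun t => SbarProc T hT (min (sg hT m k p) t) p := fun k =>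
    (S_cont hT p).comp (continuous_const.min continuous_id)
  exact (continuous_const.mul ((h1 _).sub (h1 _))).sub ((continuous_const.mul (h2 _)).mul ((h2 _).sub (h2 _)))

lemma Nm_ad (Q : Measure (PathPair T)) (m : ℕ) (u : ℝ) : Measurable[Gc Q u] (Nm hT m u) := by
  refine @measurable_of_tendsto_metrizable _ _ (Gc Q u) _ _ _ _ (fun n p => ∑ k ∈ Finset.range n,
    (2 * (SSbarProc T hT (min (sg hT m (k+1) p) u) p - SSbarProc T hT (min (sg hT m k p) u) p)
      - 2 * SbarProc T hT (min (sg hT m k p) u) p *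
        (SbarProc T hT (min (sg hT m (k+1) p) u) p - SbarProc T hT (min (sg hT m k p) u) p))) _ ?_ ?_
  · intro n
    have h1 := fun k => adapted_stop (Gc_filt Q) (sg_Tm hT Q m k).opt (SS_cont hT) (SS_ad hT Q) u
    have h2 := fun k => adapted_stop (Gc_filt Q) (sg_Tm hT Q m k).opt (S_cont hT) (S_ad hT Q) u
    refine @Finset.measurable_fun_sum _ _ _ _ _ _ (Gc Q u) _ _ fun k _ => ?_
    exact ((Measurable.sub (h1 (k+1)) (h1 k)).const_mul 2).sub (((h2 k).const_mul 2).mul ((h2 (k+1)).sub (h2 k)))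
  · rw [tendsto_pi_nhds]
    intro p
    exact tendsto_const_nhds.congr' ((Nm_sum hT m p).mono fun n h => (h u).symm)

lemma Nm_prob {Q : Measure (PathPair T)} [IsProbabilityMeasure Q] (h1 : IsLocalMartBar T Q (SbarProc T hT))
    (h2 : IsLocalMartBar T Q (SSbarProc T hT)) (hmon : ∀ᵐ p ∂Q, Monotone p.2) {c : ℝ} (hc : 0 ≤ c) (m : ℕ) {ε : ℝ} (hε : 0 < ε) :
    Q {p | ‖p.1‖ + ‖p.2‖ < c ∧ ∃ t ∈ Icc 0 T, ε ≤ |Nm hT m t p|} ≤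
      ENNReal.ofReal (34 * ((2:ℝ) ^ (-(m:ℤ)))^2 * (4 * (c+c^2)^2 + 4 * (c+c^2)) / ε^2) := by
  have hθ : Tm T (Gc Q) (fun p => hit T (fun t => |Nm hT m t p|) ε) :=
    ⟨hit_opt hT (Gc_filt Q) (Z := fun t p => |Nm hT m t p|) (fun p => (Nm_cont hT m p).abs)
      (fun u => continuous_abs.measurable.comp (Nm_ad hT Q m u)) ε, fun _ => hit_nonneg hT _ _, fun _ => hit_le hT _ _⟩
  have hρ0 : ∀ p, 0 ≤ rho hT c p := (rho_Tm hT Q c).nonneg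
  have key := maxineq (N := fun p => (Aset hT c).indicator (fun p => Nm hT m (min (rho hT c p) (hit T (fun t => |Nm hT m t p|) ε)) p) p)
    hT (Gc_filt Q) (S_BM hT h1 hc) (SS_BM hT h2 hc) (sg_Tm hT Q m) (sg_mono hT m)
    (δ := (2:ℝ) ^ (-(m:ℤ))) (by positivity) ?_ ?_ hθ ?_ hε
  · refine (measure_mono ?_).trans key
    rintro p ⟨hp, t, ht, hN⟩
    obtain ⟨r1, r2⟩ := rho_big hT hp
    rw [mem_ofPred_eq, Set.indicator_of_mem r2, r1, min_eq_right (hit_le hT _ _)]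
    exact hit_spec (Z := fun t => |Nm hT m t p|) (Nm_cont hT m p).abs ht hN
  · intro k p t ht1 ht2
    by_cases hp : p ∈ Aset hT c
    · simp only [Set.indicator_of_mem hp, SbarProc]
      rcases le_total (rho hT c p) (sg hT m k p) with h | h
      · rw [min_eq_left h, min_eq_left (h.trans ht1)]
        simp only [sub_self, abs_zero]; positivity
      · rw [min_eq_right h]
        exact sg_osc hT m k p (le_min h ht1) ((min_le_right _ _).trans ht2)
    · simp only [Set.indicator_of_notMem hp, sub_self, abs_zero]; positivity
  · filter_upwards [hmon] with p hp s hs t ht hst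
    by_cases hpA : p ∈ Aset hT c
    · simp only [Set.indicator_of_mem hpA, SbarProc, SSbarProc]
      have : ev T hT p.2 (min (rho hT c p) s) ≤ ev T hT p.2 (min (rho hT c p) t) :=
        hp (monotone_projIcc hT (min_le_min le_rfl hst))
      linarith
    · simp [Set.indicator_of_notMem hpA]
  · intro p
    filter_upwards [Nm_sum hT m p] with n hn
    by_cases hpA : p ∈ Aset hT c
    · simp only [Set.indicator_of_mem hpA]
      rw [← hn]
      refine Finset.sum_congr rfl fun k _ => ?_
      rw [min_left_comm (rho hT c p), min_left_comm (rho hT c p)]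
    · simp [Set.indicator_of_notMem hpA]

lemma Delta_ae {Q : Measure (PathPair T)} [IsProbabilityMeasure Q] (h1 : IsLocalMartBar T Q (SbarProc T hT))
    (h2 : IsLocalMartBar T Q (SSbarProc T hT)) (hmon : ∀ᵐ p ∂Q, p.2 (t0 T hT) = 0 ∧ Monotone p.2) :
    ∀ᵐ p ∂Q, p ∈ Delta T hT := by
  have hBC : ∀ᵐ p ∂Q, ∀ c : ℕ, ∀ᶠ m in atTop, p ∉ {p : PathPair T | ‖p.1‖ + ‖p.2‖ < c ∧ ∃ t ∈ Icc 0 T, ((3:ℝ)/4)^m ≤ |Nm hT m t p|} := by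
    rw [ae_all_iff]
    intro c
    refine ae_eventually_notMem ?_
    have hle : ∀ m : ℕ, Q {p : PathPair T | ‖p.1‖ + ‖p.2‖ < c ∧ ∃ t ∈ Icc 0 T, ((3:ℝ)/4)^m ≤ |Nm hT m t p|} ≤
        ENNReal.ofReal ((34 * (4 * ((c:ℝ)+c^2)^2 + 4 * (c+c^2))) * ((4:ℝ)/9)^m) := by
      intro m
      refine (Nm_prob hT h1 h2 (hmon.mono fun p h => h.2) (Nat.cast_nonneg c) m (by positivity)).trans (le_of_eq ?_)
      congr 1
      have e1 : ((2:ℝ) ^ (-(m:ℤ)))^2 = (1/4)^m := by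
        rw [zpow_neg, zpow_natCast, ← inv_pow, ← pow_mul, mul_comm, pow_mul]; norm_num
      have e2 : (((3:ℝ)/4)^m)^2 = (9/16)^m := by rw [← pow_mul, mul_comm, pow_mul]; norm_num
      rw [e1, e2]
      have e3 : ((4:ℝ)/9)^m = (1/4)^m / (9/16)^m := by rw [← div_pow]; norm_num
      rw [e3]; ring
    refine ne_top_of_le_ne_top ?_ (ENNReal.tsum_le_tsum hle)
    have hs : Summable (fun m : ℕ => (34 * (4 * ((c:ℝ)+c^2)^2 + 4 * (c+c^2))) * ((4:ℝ)/9)^m) :=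
      (summable_geometric_of_lt_one (by norm_num) (by norm_num)).mul_left _
    rw [← ENNReal.ofReal_tsum_of_nonneg (fun m => by positivity) hs]
    exact ENNReal.ofReal_ne_top
  filter_upwards [hBC, hmon] with p hp hpm
  obtain ⟨c, hc⟩ := exists_nat_gt (‖p.1‖ + ‖p.2‖)
  have hN : ∀ᶠ m in atTop, ∀ t ∈ Icc 0 T, |Nm hT m t p| < ((3:ℝ)/4)^m := by
    filter_upwards [hp c] with m hm t ht
    by_contra hcon
    exact hm ⟨hc, t, ht, not_lt.1 hcon⟩
  have hV0 : ev T hT p.2 0 = 0 := by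
    have := ev_Icc hT p.2 (t0 T hT)
    exact this.trans hpm.1
  have hSS0 : SSbarProc T hT 0 p = 0 := by simp [SSbarProc, hV0]
  have hTU : TendstoUniformly (fun m (t : Set.Icc (0:ℝ) T) => Sm T hT m (t : ℝ) p.1)
        (fun t => SSbarProc T hT (t : ℝ) p) Filter.atTop := by
    rw [Metric.tendstoUniformly_iff]
    intro ε hε
    have h0 : Tendsto (fun m : ℕ => ((3:ℝ)/4)^m) atTop (𝓝 0) :=
      tendsto_pow_atTop_nhds_zero_of_lt_one (by norm_num) (by norm_num)
    filter_upwards [hN, h0.eventually_lt_const hε] with m hm1 hm2 t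
    have := abs_lt.1 (hm1 t t.2)
    simp only [Nm, hSS0] at this
    rw [Real.dist_eq, abs_lt]
    constructor <;> linarith
  have hSS : ∀ t : Icc (0:ℝ) T, SS T hT (t:ℝ) p.1 = SSbarProc T hT (t:ℝ) p := fun t =>
    (hTU.tendsto_at t).liminf_eq
  have hqv : ∀ t : Icc (0:ℝ) T, qvRaw T hT p.1 t = p.2 t := by
    intro t
    rw [qvRaw, hSS, SSbarProc, ← ev_Icc hT p.2 t]; ring
  have hBO : p.1 ∈ BigOmega T hT := by
    refine ⟨?_, ?_⟩
    · simp_rw [hSS]; exact hTU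
    · intro s hs t ht hst
      have e1 := hqv ⟨s, hs⟩
      have e2 := hqv ⟨t, ht⟩
      simp only at e1 e2
      rw [e1, e2]; exact hpm.2 hst
  refine ⟨p.1, hBO, ?_⟩
  have hcont : Continuous fun t : Set.Icc (0:ℝ) T => qvRaw T hT p.1 (t : ℝ) := by
    simp_rw [hqv]; exact p.2.continuous
  refine Prod.ext rfl ?_
  simp only [psiMap, qv]
  rw [dif_pos ⟨hBO, hcont⟩]
  ext t
  exact hqv t

end Concrete2

section Weak
variable {T : ℝ} (hT : 0 ≤ T)

lemma DP_le_Gc {Q : Measure (PathPair T)} (hΔ : ∀ᵐ p ∂Q, p ∈ Delta T hT) {t s : ℝ} (hts : t < s) :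
    FbarDeltaPlus T hT t ≤ Gc Q s := by
  refine sup_le ?_ ?_
  · refine (iInf₂_le s hts).trans ?_
    exact raw_le_Gc Q ((min_le_left _ _).trans (le_max_left _ _))
  · refine MeasurableSpace.generateFrom_le ?_
    intro N hN
    refine Gc_null Q ?_ s
    exact measure_mono_null hN hΔ

lemma DP_lt {Q : Measure (PathPair T)} (hΔ : ∀ᵐ p ∂Q, p ∈ Delta T hT) {τ : PathPair T → ℝ}
    (h0 : ∀ p, 0 ≤ τ p) (h1 : ∀ p, τ p ≤ T) {A : Set (PathPair T)}
    (hA : ∀ t ∈ Icc (0:ℝ) T, MeasurableSet[FbarDeltaPlus T hT t] (A ∩ {p | τ p ≤ t})) (s : ℝ) :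
    MeasurableSet[Gc Q s] (A ∩ {p | τ p < s}) := by
  rcases lt_or_ge T s with hs | hs
  · have : A ∩ {p | τ p < s} = A ∩ {p | τ p ≤ T} := by
      ext p; simp only [Set.mem_inter_iff, Set.mem_ofPred_eq]
      constructor
      · rintro ⟨a, -⟩; exact ⟨a, h1 p⟩
      · rintro ⟨a, b⟩; exact ⟨a, b.trans_lt hs⟩
    rw [this]
    exact DP_le_Gc hT hΔ hs _ (hA T ⟨hT, le_rfl⟩)
  · have : A ∩ {p | τ p < s} = ⋃ (q : ℚ) (_ : 0 ≤ (q:ℝ) ∧ (q:ℝ) < s), A ∩ {p | τ p ≤ q} := by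
      ext p; simp only [Set.mem_inter_iff, Set.mem_ofPred_eq, Set.mem_iUnion]
      constructor
      · rintro ⟨a, b⟩
        obtain ⟨q, hq1, hq2⟩ := exists_rat_btwn b
        exact ⟨q, ⟨(h0 p).trans hq1.le, hq2⟩, a, hq1.le⟩
      · rintro ⟨q, ⟨_, hq⟩, a, b⟩
        exact ⟨a, b.trans_lt hq⟩
    rw [this]
    refine @MeasurableSet.iUnion _ _ (Gc Q s) _ _ fun q => ?_
    refine @MeasurableSet.iUnion _ _ (Gc Q s) _ _ fun hq => ?_
    exact DP_le_Gc hT hΔ hq.2 _ (hA q ⟨hq.1, hq.2.le.trans hs⟩)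

lemma strat_pos (H : SimpleStrategyBar T hT) (l : Fin (H.L + 1)) (p : PathPair T) : 0 ≤ H.τ l p := by
  induction l using Fin.induction with
  | zero => exact H.τ_nonneg p
  | succ i ih => exact ih.trans (H.τ_mono i p)

lemma strat_le (H : SimpleStrategyBar T hT) (l : Fin (H.L + 1)) (p : PathPair T) : H.τ l p ≤ T := by
  induction l using Fin.reverseInduction with
  | last => exact H.τ_le p
  | cast i ih => exact (H.τ_mono i p).trans ih

lemma strat_Tm {Q : Measure (PathPair T)} (hΔ : ∀ᵐ p ∂Q, p ∈ Delta T hT) (H : SimpleStrategyBar T hT)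
    (l : Fin (H.L + 1)) : Tm T (Gc Q) (H.τ l) := by
  refine ⟨fun s => ?_, strat_pos hT H l, strat_le hT H l⟩
  have := DP_lt hT hΔ (strat_pos hT H l) (strat_le hT H l) (A := univ) ?_ s
  · rwa [Set.univ_inter] at this
  · intro t ht; rw [Set.univ_inter]; obtain ⟨_, _, _, _, _, _, h7, _, _⟩ := H; exact h7 l t ht

lemma strat_HM {Q : Measure (PathPair T)} (hΔ : ∀ᵐ p ∂Q, p ∈ Delta T hT) (H : SimpleStrategyBar T hT)
    (l : Fin H.L) : HM (Gc Q) (H.τ l.castSucc) (H.coeff l) := by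
  intro s B hB
  rw [Set.indicator_preimage, Set.ite]
  refine @MeasurableSet.union _ (Gc Q s) _ _ ?_ ?_
  · exact DP_lt hT hΔ (strat_pos hT H _) (strat_le hT H _) (H.coeff_meas l B hB) s
  · refine @MeasurableSet.diff _ (Gc Q s) _ _ ?_ ((strat_Tm hT hΔ H _).opt s)
    exact @measurable_const _ _ _ (Gc Q s) (0:ℝ) B hB

lemma wk_int {Q : Measure (PathPair T)} [IsProbabilityMeasure Q] (hΔ : ∀ᵐ p ∂Q, p ∈ Delta T hT)
    {X : ℝ → PathPair T → ℝ} {c K : ℝ}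
    (hB : BM T Q (Gc Q) K (fun t p => (Aset hT c).indicator (fun p => X (min (rho hT c p) t) p) p))
    (H : SimpleStrategyBar T hT) :
    Integrable (fun p => (Aset hT c).indicator (fun p => integBar T hT H X (rho hT c p) p) p) Q ∧
    ∫ p, (Aset hT c).indicator (fun p => integBar T hT H X (rho hT c p) p) p ∂Q = 0 := by
  set M : ℝ → PathPair T → ℝ := fun t p => (Aset hT c).indicator (fun p => X (min (rho hT c p) t) p) p with hM
  have key : (fun p => (Aset hT c).indicator (fun p => integBar T hT H X (rho hT c p) p) p)
      = fun p => ∑ l : Fin H.L, H.coeff l p * (M (H.τ l.succ p) p - M (H.τ l.castSucc p) p) := by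
    funext p
    by_cases hp : p ∈ Aset hT c
    · simp only [hM, Set.indicator_of_mem hp, integBar]
      refine Finset.sum_congr rfl fun l _ => ?_
      rw [min_comm (rho hT c p), min_comm (rho hT c p)]
    · simp only [hM, Set.indicator_of_notMem hp]; simp
  have h2 : ∀ l : Fin H.L, Integrable (fun p => H.coeff l p * (M (H.τ l.succ p) p - M (H.τ l.castSucc p) p)) Q ∧
      ∫ p, H.coeff l p * (M (H.τ l.succ p) p - M (H.τ l.castSucc p) p) ∂Q = 0 := by
    intro l
    obtain ⟨C, hC⟩ := H.coeff_bdd l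
    exact hB.os2 (Gc_filt Q) (strat_Tm hT hΔ H _) (strat_Tm hT hΔ H _) (H.τ_mono l) (strat_HM hT hΔ H l) hC
  rw [key]
  refine ⟨integrable_finsetSum _ fun l _ => (h2 l).1, ?_⟩
  rw [integral_finsetSum _ fun l _ => (h2 l).1]
  exact Finset.sum_eq_zero fun l _ => (h2 l).2

lemma weak_one {Q : Measure (PathPair T)} [IsProbabilityMeasure Q]
    (h1 : IsLocalMartBar T Q (SbarProc T hT)) (h2 : IsLocalMartBar T Q (SSbarProc T hT))
    (hΔ : ∀ᵐ p ∂Q, p ∈ Delta T hT) (H G : SimpleStrategyBar T hT) {lam : ℝ} (hl : 0 ≤ lam)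
    (hadm : ∀ᵐ p ∂Q, ∀ t ∈ Icc (0:ℝ) T, 0 ≤ lam + integBar T hT H (SbarProc T hT) t p
            + integBar T hT G (SSbarProc T hT) t p) :
    AEMeasurable (fun p => ENNReal.ofReal (lam + integBar T hT H (SbarProc T hT) T p
            + integBar T hT G (SSbarProc T hT) T p)) Q ∧
    ∫⁻ p, ENNReal.ofReal (lam + integBar T hT H (SbarProc T hT) T p
            + integBar T hT G (SSbarProc T hT) T p) ∂Q ≤ ENNReal.ofReal lam := by
  set Y : ℝ → PathPair T → ℝ := fun t p => lam + integBar T hT H (SbarProc T hT) t p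
            + integBar T hT G (SSbarProc T hT) t p with hY
  let Z : ℕ → PathPair T → ℝ := fun c p => (Aset hT (c:ℝ)).indicator (fun p => Y (rho hT (c:ℝ) p) p) p
  have hAm : ∀ c : ℕ, NullMeasurableSet (Aset hT (c:ℝ)) Q := fun c =>
    (Gc_filt Q).null 0 _ (Aset_meas hT Q c 0)
  have hZ : ∀ c, Z c = fun p => (Aset hT (c:ℝ)).indicator (fun _ => lam) p
      + (Aset hT (c:ℝ)).indicator (fun p => integBar T hT H (SbarProc T hT) (rho hT c p) p) p
      + (Aset hT (c:ℝ)).indicator (fun p => integBar T hT G (SSbarProc T hT) (rho hT c p) p) p := by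
    intro c; funext p
    by_cases hp : p ∈ Aset hT (c:ℝ)
    · simp only [Z, hY, Set.indicator_of_mem hp]
    · simp only [Z, Set.indicator_of_notMem hp]; simp
  have hi1 : ∀ c : ℕ, Integrable (fun p => (Aset hT (c:ℝ)).indicator (fun _ => lam) p) Q := fun c =>
    (integrable_const lam).indicator₀ (hAm c)
  have hi2 := fun c : ℕ => wk_int hT hΔ (S_BM hT h1 (c := (c:ℝ)) (Nat.cast_nonneg c)) H
  have hi3 := fun c : ℕ => wk_int hT hΔ (SS_BM hT h2 (c := (c:ℝ)) (Nat.cast_nonneg c)) G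
  have hZi : ∀ c, Integrable (Z c) Q := by
    intro c; rw [hZ c]; exact ((hi1 c).add (hi2 c).1).add (hi3 c).1
  have hZe : ∀ c, ∫ p, Z c p ∂Q ≤ lam := by
    intro c
    rw [hZ c]
    have ha : Integrable (fun p => (Aset hT (c:ℝ)).indicator (fun _ => lam) p
      + (Aset hT (c:ℝ)).indicator (fun p => integBar T hT H (SbarProc T hT) (rho hT c p) p) p) Q :=
      (hi1 c).add (hi2 c).1
    rw [integral_add ha (hi3 c).1, integral_add (hi1 c) (hi2 c).1, (hi2 c).2, (hi3 c).2, add_zero, add_zero]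
    have : ∫ p, (Aset hT (c:ℝ)).indicator (fun _ => lam) p ∂Q ≤ ∫ _p, lam ∂Q :=
      integral_mono (hi1 c) (integrable_const _) fun p => Set.indicator_le_self' (fun _ _ => hl) p
    simpa using this
  have hZ0 : ∀ c, 0 ≤ᵐ[Q] Z c := by
    intro c
    filter_upwards [hadm] with p hp
    by_cases h : p ∈ Aset hT (c:ℝ)
    · simp only [Z, Set.indicator_of_mem h]
      exact hp _ ⟨(rho_Tm hT Q c).nonneg p, (rho_Tm hT Q c).le p⟩
    · simp only [Z, Set.indicator_of_notMem h]; exact le_rfl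
  have hev : ∀ p, ∀ᶠ c : ℕ in atTop, Z c p = Y T p := by
    intro p
    obtain ⟨N, hN⟩ := exists_nat_gt (‖p.1‖ + ‖p.2‖)
    filter_upwards [eventually_ge_atTop N] with c hc
    obtain ⟨ha, hb⟩ := rho_big hT (p := p) (c := (c:ℝ)) (hN.trans_le (by exact_mod_cast hc))
    simp only [Z, Set.indicator_of_mem hb, ha]
  have hlim : ∀ p, Tendsto (fun c => ENNReal.ofReal (Z c p)) atTop (𝓝 (ENNReal.ofReal (Y T p))) := fun p =>
    tendsto_const_nhds.congr' ((hev p).mono fun c hc => by simp only [hc])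
  have hm : ∀ c, AEMeasurable (fun p => ENNReal.ofReal (Z c p)) Q := fun c =>
    (hZi c).aemeasurable.ennreal_ofReal
  refine ⟨aemeasurable_of_tendsto_metrizable_ae' hm (Eventually.of_forall hlim), ?_⟩
  calc ∫⁻ p, ENNReal.ofReal (Y T p) ∂Q = ∫⁻ p, liminf (fun c => ENNReal.ofReal (Z c p)) atTop ∂Q := by
        refine lintegral_congr fun p => ((hlim p).liminf_eq).symm
    _ ≤ liminf (fun c => ∫⁻ p, ENNReal.ofReal (Z c p) ∂Q) atTop := lintegral_liminf_le' hm
    _ ≤ ENNReal.ofReal lam := by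
        refine liminf_le_of_frequently_le' (Frequently.of_forall fun c => ?_)
        rw [← ofReal_integral_eq_lintegral_ofReal (hZi c) (hZ0 c)]
        exact ENNReal.ofReal_le_ofReal (hZe c)

lemma integ_zero (H : SimpleStrategyBar T hT) (X : ℝ → PathPair T → ℝ) (p : PathPair T) :
    integBar T hT H X 0 p = 0 := by
  refine Finset.sum_eq_zero fun l _ => ?_
  rw [min_eq_right (strat_pos hT H _ p), min_eq_right (strat_pos hT H _ p), sub_self, mul_zero]

lemma liminf_conv {x : ℝ≥0∞} {lam : ℝ} {I : ℕ → ℝ}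
    (h : (x : EReal) ≤ (lam : EReal) + liminf (fun n => ((I n : ℝ) : EReal)) atTop) :
    x ≤ liminf (fun n => ENNReal.ofReal (lam + I n)) atTop := by
  refine le_of_forall_lt fun a ha => ?_
  obtain ⟨b, hab, hb⟩ := exists_between ha
  refine hab.trans_le ?_
  have hbt : b ≠ ⊤ := hb.ne_top
  have h1 : ((b.toReal : ℝ) : EReal) < (lam : EReal) + liminf (fun n => ((I n : ℝ) : EReal)) atTop := by
    refine lt_of_lt_of_le ?_ h
    rw [EReal.coe_ennreal_toReal hbt]
    exact_mod_cast hb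
  have h2 : ((b.toReal - lam : ℝ) : EReal) < liminf (fun n => ((I n : ℝ) : EReal)) atTop := by
    rw [EReal.coe_sub]
    exact EReal.sub_lt_of_lt_add' h1
  refine le_liminf_of_le (by isBoundedDefault) ?_
  filter_upwards [eventually_lt_of_lt_liminf h2] with n hn
  have hn' : b.toReal - lam < I n := by exact_mod_cast hn
  rw [← ENNReal.ofReal_toReal hbt]
  exact ENNReal.ofReal_le_ofReal (by linarith)

theorem weak_dir {Ξ : Set (Path T)} {Xibar : Set (PathPair T)} (hA : AssumptionA T hT Ξ Xibar)
    (ξ : PathPair T → ℝ≥0∞) :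
    (supMartBar T hT Xibar ξ : EReal) ≤ PhiBar T hT Xibar (fun p => (ξ p : EReal)) := by
  refine le_sInf ?_
  rintro _ ⟨lam, ⟨H, G, hadm, hsup⟩, rfl⟩
  have hl : 0 ≤ lam := by
    obtain ⟨ω, hω⟩ := hA.xi_nonempty
    rw [hA.xi_eq] at hω
    have := hadm 0 0 ⟨le_rfl, hT⟩ (ω, qv T hT ω) ⟨⟨ω, hω.1, rfl⟩, hω.2⟩
    rw [integ_zero, integ_zero] at this
    linarith
  have hmain : supMartBar T hT Xibar ξ ≤ ENNReal.ofReal lam := by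
    refine iSup₂_le fun Q hQ => ?_
    obtain ⟨hP, h1, h2, h3⟩ := hQ
    have hXm : MeasurableSet Xibar := by
      obtain ⟨K, hK, rfl⟩ := hA.A1
      exact MeasurableSet.iUnion fun n => (hK n).measurableSet
    have hX : ∀ᵐ p ∂Q, p ∈ Xibar := (mem_ae_iff_prob_eq_one hXm).2 h3
    have hΔ : ∀ᵐ p ∂Q, p ∈ Delta T hT := Delta_ae hT h1 h2 (hX.mono fun p hp => hA.A2 p hp)
    have hone := fun n => weak_one hT h1 h2 hΔ (H n) (G n) hl (by
      filter_upwards [hX, hΔ] with p a b t ht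
      exact hadm n t ht p ⟨b, a⟩)
    calc ∫⁻ p, ξ p ∂Q ≤ ∫⁻ p, liminf (fun n => ENNReal.ofReal (lam + integBar T hT (H n) (SbarProc T hT) T p
            + integBar T hT (G n) (SSbarProc T hT) T p)) atTop ∂Q := by
          refine lintegral_mono_ae ?_
          filter_upwards [hX, hΔ] with p a b
          have := liminf_conv (hsup p ⟨b, a⟩)
          simpa only [add_assoc] using this
      _ ≤ _ := lintegral_liminf_le' fun n => (hone n).1
      _ ≤ ENNReal.ofReal lam := liminf_le_of_frequently_le' (Frequently.of_forall fun n => (hone n).2)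
  calc (supMartBar T hT Xibar ξ : EReal) ≤ ((ENNReal.ofReal lam : ℝ≥0∞) : EReal) := by exact_mod_cast hmain
    _ = (lam : EReal) := by rw [EReal.coe_ennreal_ofReal, max_eq_left hl]

end Weak

section Stop
variable {T : ℝ} (hT : 0 ≤ T)

/-- stopped pair -/
def sp (p : PathPair T) (t : Icc (0:ℝ) T) : PathPair T := (stopPath T p.1 t, stopPath T p.2 t)

lemma sp1 (p : PathPair T) (t s : Icc (0:ℝ) T) : (sp p t).1 s = p.1 (min t s) := by
  show p.1 _ = p.1 _
  congr 1

lemma sp2 (p : PathPair T) (t s : Icc (0:ℝ) T) : (sp p t).2 s = p.2 (min t s) := by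
  show p.2 _ = p.2 _
  congr 1

lemma sp_sp (p : PathPair T) (t s : Icc (0:ℝ) T) : sp (sp p t) s = sp p (min t s) := by
  refine Prod.ext ?_ ?_
  · ext r; rw [sp1, sp1, sp1, min_assoc]
  · ext r; rw [sp2, sp2, sp2, min_assoc]

lemma sp_top (p : PathPair T) (t : Icc (0:ℝ) T) (h : (t:ℝ) = T) : sp p t = p := by
  refine Prod.ext ?_ ?_
  · ext r; rw [sp1]; congr 1; exact min_eq_right (Subtype.coe_le_coe.1 (r.2.2.trans h.ge))
  · ext r; rw [sp2]; congr 1; exact min_eq_right (Subtype.coe_le_coe.1 (r.2.2.trans h.ge))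

lemma stopPath_cont : Continuous (fun q : Path T × Icc (0:ℝ) T => stopPath T q.1 q.2) := by
  refine ContinuousMap.continuous_of_continuous_uncurry _ ?_
  have h2 : Continuous (fun x : (Path T × Icc (0:ℝ) T) × Icc (0:ℝ) T => (x.1.1 : Path T) (min x.1.2 x.2)) := by
    fun_prop
  have h3 : (Function.uncurry fun (x : Path T × Icc (0:ℝ) T) y => (stopPath T x.1 x.2) y)
      = fun x : (Path T × Icc (0:ℝ) T) × Icc (0:ℝ) T => (x.1.1 : Path T) (min x.1.2 x.2) := by
    funext x
    exact sp1 (x.1.1, x.1.1) x.1.2 x.2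
  rw [h3]; exact h2

lemma sp_cont : Continuous (fun q : PathPair T × Icc (0:ℝ) T => sp q.1 q.2) := by
  refine Continuous.prodMk ?_ ?_
  · exact stopPath_cont.comp ((continuous_fst.comp continuous_fst).prodMk continuous_snd)
  · exact stopPath_cont.comp ((continuous_snd.comp continuous_fst).prodMk continuous_snd)

lemma sp_cont_left (t : Icc (0:ℝ) T) : Continuous (fun p : PathPair T => sp p t) :=
  sp_cont.comp (continuous_id.prodMk continuous_const)

lemma sp_cont_right (p : PathPair T) : Continuous (fun t : Icc (0:ℝ) T => sp p t) :=
  sp_cont.comp (continuous_const.prodMk continuous_id)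

lemma path_meas {X : Type*} {m : MeasurableSpace X} {f : X → Path T}
    (hf : ∀ r : Icc (0:ℝ) T, Measurable[m] fun x => f x r) : Measurable[m] f := by
  obtain ⟨D, hDc, hD⟩ := TopologicalSpace.exists_countable_dense (Icc (0:ℝ) T)
  obtain ⟨E, hEc, hE⟩ := TopologicalSpace.exists_countable_dense (Path T)
  have hball : ∀ (x : Path T) (q : ℝ), 0 ≤ q → MeasurableSet[m] (f ⁻¹' Metric.closedBall x q) := by
    intro x q hq
    have : f ⁻¹' Metric.closedBall x q = ⋂ r ∈ D, (fun y => f y r) ⁻¹' Metric.closedBall (x r) q := by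
      ext y
      simp only [Set.mem_preimage, Metric.mem_closedBall, Set.mem_iInter]
      rw [ContinuousMap.dist_le hq]
      refine ⟨fun h r _ => h r, fun h => ?_⟩
      have hcl : IsClosed {r | dist (f y r) (x r) ≤ q} :=
        isClosed_le ((f y).continuous.dist x.continuous) continuous_const
      intro r
      have : D ⊆ {r | dist (f y r) (x r) ≤ q} := fun r hr => h r hr
      exact hcl.closure_subset_iff.2 this (hD r)
    rw [this]
    exact MeasurableSet.biInter hDc fun r _ => hf r Metric.isClosed_closedBall.measurableSet
  refine measurable_of_isOpen fun U hU => ?_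
  have : f ⁻¹' U = ⋃ x ∈ E, ⋃ (q : ℚ) (_ : 0 ≤ (q:ℝ) ∧ Metric.closedBall x (q:ℝ) ⊆ U),
      f ⁻¹' Metric.closedBall x (q:ℝ) := by
    ext y
    simp only [Set.mem_iUnion, Set.mem_preimage]
    constructor
    · intro hy
      obtain ⟨ε, hε, hεU⟩ := Metric.isOpen_iff.1 hU _ hy
      obtain ⟨x, hx, hxd⟩ := hE.exists_dist_lt (f y) (half_pos hε)
      obtain ⟨q, hq1, hq2⟩ := exists_rat_btwn hxd
      refine ⟨x, hx, q, ⟨dist_nonneg.trans hq1.le, fun z hz => hεU ?_⟩, hq1.le⟩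
      have h1 := Metric.mem_closedBall.1 hz
      rw [Metric.mem_ball]
      calc dist z (f y) ≤ dist z x + dist x (f y) := dist_triangle _ _ _
        _ < ε := by rw [dist_comm x]; linarith
    · rintro ⟨x, _, q, ⟨_, h⟩, h2⟩
      exact h h2
  rw [this]
  refine MeasurableSet.biUnion hEc fun x _ => MeasurableSet.iUnion fun q => MeasurableSet.iUnion fun h => hball x q h.1

lemma sp_meas (t : Icc (0:ℝ) T) {s : ℝ} (h : (t:ℝ) ≤ s) : Measurable[FbarRaw T s] (fun p : PathPair T => sp p t) := by
  have h0 : ∀ r : Icc (0:ℝ) T, ((min t r : Icc (0:ℝ) T) : ℝ) ≤ s := fun r => le_trans (min_le_left t r) h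
  refine Measurable.prodMk ?_ ?_
  · refine path_meas fun r => ?_
    have := (raw_pair (min t r) (h0 r)).fst
    have h5 : (fun x : PathPair T => (stopPath T x.1 t) r) = fun p => p.1 (min t r) := funext fun p => sp1 p t r
    show Measurable[FbarRaw T s] (fun x : PathPair T => (stopPath T x.1 t) r)
    rw [h5]; exact this
  · refine path_meas fun r => ?_
    have := (raw_pair (min t r) (h0 r)).snd
    have h5 : (fun x : PathPair T => (stopPath T x.2 t) r) = fun p => p.2 (min t r) := funext fun p => sp2 p t r
    show Measurable[FbarRaw T s] (fun x : PathPair T => (stopPath T x.2 t) r)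
    rw [h5]; exact this

lemma raw_eq {s : Icc (0:ℝ) T} {A : Set (PathPair T)} (hA : MeasurableSet[FbarRaw T s] A) :
    ∃ B, MeasurableSet B ∧ A = (fun p => sp p s) ⁻¹' B := by
  have : FbarRaw T (s:ℝ) ≤ MeasurableSpace.comap (fun p : PathPair T => sp p s) inferInstance := by
    refine iSup₂_le fun r hr => ?_
    rintro _ ⟨B, hB, rfl⟩
    refine ⟨(fun p : PathPair T => (p.1 r, p.2 r)) ⁻¹' B, ?_, ?_⟩
    · refine Measurable.prodMk ?_ ?_ hB
      · exact ((continuous_eval_const r).comp continuous_fst).measurable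
      · exact ((continuous_eval_const r).comp continuous_snd).measurable
    · ext p
      have hrs : min s r = r := min_eq_right (Subtype.coe_le_coe.1 hr)
      simp only [Set.mem_preimage, sp1, sp2, hrs]
  obtain ⟨B, hB, h⟩ := this A hA
  exact ⟨B, hB, h.symm⟩

end Stop

section HB

lemma usc_int {X : Type*} [PseudoMetricSpace X] [MeasurableSpace X] [BorelSpace X] {μ : Measure X}
    [IsProbabilityMeasure μ] {η : X → ℝ} (hη : UpperSemicontinuous η) {C : ℝ} (h0 : ∀ x, 0 ≤ η x)
    (hC : ∀ x, η x ≤ C) {lam : ℝ} (h : ∀ g : C(X, ℝ), (∀ x, η x ≤ g x) → (∀ x, |g x| ≤ C) → lam ≤ ∫ x, g x ∂μ) :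
    lam ≤ ∫ x, η x ∂μ := by
  let e : ℕ → X → ℝ := fun k x => ⨆ y, (η y - k * dist x y)
  have hbd : ∀ (k : ℕ) x, BddAbove (Set.range fun y => η y - (k:ℝ) * dist x y) := by
    intro k x
    refine ⟨C, ?_⟩
    rintro _ ⟨y, rfl⟩
    have : 0 ≤ (k:ℝ) * dist x y := by positivity
    have := hC y
    simp only; linarith
  have hge : ∀ k x, η x ≤ e k x := by
    intro k x
    have := le_ciSup (hbd k x) x
    simpa using this
  have hle : ∀ k x, e k x ≤ C := by
    intro k x
    have : Nonempty X := ⟨x⟩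
    refine ciSup_le fun y => ?_
    have : 0 ≤ (k:ℝ) * dist x y := by positivity
    have := hC y
    linarith
  have hlip : ∀ k : ℕ, LipschitzWith (Real.toNNReal (k:ℝ)) (e k) := by
    intro k
    refine LipschitzWith.of_le_add_mul' _ fun x y => ?_
    have : Nonempty X := ⟨x⟩
    refine ciSup_le fun z => ?_
    have h1 := le_ciSup (hbd k y) z
    have h2 := dist_triangle y x z
    have h3 : (k:ℝ) * dist y z ≤ k * (dist x y + dist x z) := by
      rw [dist_comm x y]; gcongr
    have h4 : η z - (k:ℝ) * dist y z ≤ e k y := h1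
    linarith
  have hab : ∀ k x, |e k x| ≤ C := fun k x => abs_le.2 ⟨by linarith [h0 x, hge k x, hle k x], hle k x⟩
  have hlim : ∀ x, Tendsto (fun k => e k x) atTop (𝓝 (η x)) := by
    intro x
    have : Nonempty X := ⟨x⟩
    rw [Metric.tendsto_atTop]
    intro ε hε
    have hu := hη x (η x + ε/2) (by linarith)
    obtain ⟨δ, hδ, hδ2⟩ := Metric.eventually_nhds_iff.1 hu
    obtain ⟨N, hN⟩ := exists_nat_gt (C / δ)
    refine ⟨N, fun k hk => ?_⟩
    have hkN : (N:ℝ) ≤ k := by exact_mod_cast hk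
    rw [Real.dist_eq, abs_of_nonneg (by linarith [hge k x])]
    have : e k x ≤ η x + ε/2 := by
      refine ciSup_le fun y => ?_
      rcases lt_or_ge (dist y x) δ with hd | hd
      · have := hδ2 hd
        have h2 : 0 ≤ (k:ℝ) * dist x y := by positivity
        linarith
      · rw [dist_comm x y]
        have h1 : C < N * δ := (div_lt_iff₀ hδ).1 hN
        have h2 : (N:ℝ) * δ ≤ k * dist y x := by gcongr
        linarith [hC y, h0 x]
    linarith
  have hT : Tendsto (fun k => ∫ x, e k x ∂μ) atTop (𝓝 (∫ x, η x ∂μ)) := by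
    refine tendsto_integral_of_dominated_convergence (fun _ => C) ?_ (integrable_const _) ?_ ?_
    · exact fun k => (hlip k).continuous.measurable.aestronglyMeasurable
    · exact fun k => Eventually.of_forall fun x => hab k x
    · exact Eventually.of_forall hlim
  exact ge_of_tendsto' hT fun k => h ⟨e k, (hlip k).continuous⟩ (hge k) (hab k)

lemma hb_riesz {X : Type*} [TopologicalSpace X] [CompactSpace X] [T2Space X] [MeasurableSpace X] [BorelSpace X]
    (U : Submodule ℝ C(X, ℝ)) (η : X → ℝ) {C : ℝ} (hC : ∀ x, η x ≤ C) {lam : ℝ}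
    (hno : ¬ ∃ u ∈ U, ∀ x, η x ≤ lam + u x) :
    ∃ μ : Measure X, IsProbabilityMeasure μ ∧ (∀ u ∈ U, ∫ x, u x ∂μ = 0) ∧
      ∀ g : C(X, ℝ), (∀ x, η x ≤ g x) → lam ≤ ∫ x, g x ∂μ := by
  let one : C(X, ℝ) := ContinuousMap.const X 1
  let D : Set C(X, ℝ) := {φ | ∀ x, 0 < φ x}
  let B : Set C(X, ℝ) := {b | ∃ u ∈ U, ∃ g : C(X, ℝ), (∀ x, η x ≤ g x) ∧ b = lam • one + u - g}
  have hDo : IsOpen D := by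
    have := ContinuousMap.isOpen_setOfPred_mapsTo (X := X) (Y := ℝ) isCompact_univ (isOpen_Ioi (a := (0:ℝ)))
    convert this using 1
    ext φ
    simp [D, Set.MapsTo]
  have hDc : Convex ℝ D := by
    intro φ hφ ψ hψ a b ha hb hab x
    simp only [ContinuousMap.add_apply, ContinuousMap.smul_apply, smul_eq_mul]
    have := hφ x; have := hψ x
    rcases ha.eq_or_lt with h | h
    · have : b = 1 := by linarith
      subst this; rw [← h]; simpa using hψ x
    · have : 0 < a * φ x := mul_pos h (hφ x)
      have : 0 ≤ b * ψ x := mul_nonneg hb (hψ x).le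
      linarith
  have hBc : Convex ℝ B := by
    rintro _ ⟨u, hu, g, hg, rfl⟩ _ ⟨v, hv, k, hk, rfl⟩ a b ha hb hab
    refine ⟨a • u + b • v, U.add_mem (U.smul_mem _ hu) (U.smul_mem _ hv), a • g + b • k, ?_, ?_⟩
    · intro x
      simp only [ContinuousMap.add_apply, ContinuousMap.smul_apply, smul_eq_mul]
      have h1 := mul_le_mul_of_nonneg_left (hg x) ha
      have h2 := mul_le_mul_of_nonneg_left (hk x) hb
      have h3 : η x = a * η x + b * η x := by rw [← add_mul, hab, one_mul]
      linarith
    · ext x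
      simp only [ContinuousMap.add_apply, ContinuousMap.sub_apply, ContinuousMap.smul_apply, smul_eq_mul]
      have : lam * one x = (a + b) * (lam * one x) := by rw [hab, one_mul]
      linear_combination -this
  have hdis : Disjoint D B := by
    rw [Set.disjoint_left]
    rintro _ hD ⟨u, hu, g, hg, rfl⟩
    refine hno ⟨u, hu, fun x => ?_⟩
    have := hD x
    simp only [ContinuousMap.add_apply, ContinuousMap.sub_apply, ContinuousMap.smul_apply, smul_eq_mul, one,
      ContinuousMap.const_apply, mul_one] at this
    linarith [hg x]
  obtain ⟨l, c, h1, h2⟩ := geometric_hahn_banach_open hDc hDo hBc hdis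
  have hone : one ∈ D := fun x => by simp [one]
  have hDl : ∀ φ ∈ D, l φ ≤ 0 := by
    intro φ hφ
    by_contra hcon
    push Not at hcon
    obtain ⟨n, hn⟩ := exists_nat_gt (c / l φ)
    have hn1 : c < n * l φ := (div_lt_iff₀ hcon).1 hn
    have hm : ((n:ℝ) + 1) • φ ∈ D := fun x => by
      simp only [ContinuousMap.smul_apply, smul_eq_mul]; exact mul_pos (by positivity) (hφ x)
    have := h1 _ hm
    rw [map_smul, smul_eq_mul] at this
    linarith
  have hc0 : 0 ≤ c := by
    by_contra hcon
    push Not at hcon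
    have ha : 0 < -c / (2 * (1 - l one)) := by
      have := hDl one hone
      apply div_pos <;> linarith
    have hm : (-c / (2 * (1 - l one))) • one ∈ D := fun x => by
      simp only [ContinuousMap.smul_apply, smul_eq_mul]; exact mul_pos ha (hone x)
    have := h1 _ hm
    rw [map_smul, smul_eq_mul] at this
    have hl := hDl one hone
    have hpos : 0 < 1 - l one := by linarith
    rw [div_mul_eq_mul_div, div_lt_iff₀ (by linarith)] at this
    nlinarith
  have hB : ∀ u ∈ U, ∀ g : C(X, ℝ), (∀ x, η x ≤ g x) → c ≤ lam * l one + l u - l g := by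
    intro u hu g hg
    have := h2 _ ⟨u, hu, g, hg, rfl⟩
    simpa [map_add, map_sub, map_smul] using this
  have hgC : ∀ x, η x ≤ (C • one) x := fun x => by simpa [one] using hC x
  have hU : ∀ u ∈ U, l u = 0 := by
    intro u hu
    by_contra hne
    have := hB (((c - 1 - (lam * l one - l (C • one))) / l u) • u) (U.smul_mem _ hu) _ hgC
    rw [map_smul, smul_eq_mul, div_mul_cancel₀ _ hne] at this
    linarith
  have hone_neg : l one < 0 := by
    refine lt_of_le_of_ne (hDl one hone) fun h => ?_
    have a := h1 one hone
    have b := hB 0 U.zero_mem _ hgC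
    rw [map_smul, h, map_zero] at b
    simp at b
    linarith
  have hpos : ∀ φ : C(X, ℝ), (∀ x, 0 ≤ φ x) → l φ ≤ 0 := by
    intro φ hφ
    refine le_of_forall_pos_le_add fun ε hε => ?_
    have hm : φ + (ε / (-l one)) • one ∈ D := fun x => by
      simp only [ContinuousMap.add_apply, ContinuousMap.smul_apply, smul_eq_mul, one, ContinuousMap.const_apply]
      have : 0 < ε / (-l one) := div_pos hε (by linarith)
      linarith [hφ x]
    have := hDl _ hm
    rw [map_add, map_smul, smul_eq_mul] at this
    have h3 : ε / (-l one) * l one = -ε := by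
      rw [div_mul_eq_mul_div, div_eq_iff (by linarith)]; ring
    linarith
  set a : ℝ := -l one with ha
  have ha0 : 0 < a := by linarith
  let Lam : CompactlySupportedContinuousMap X ℝ →ₚ[ℝ] ℝ :=
  { toFun := fun g => - l (g : C(X, ℝ)) / a
    map_add' := fun g g' => by
      have : ((g + g' : CompactlySupportedContinuousMap X ℝ) : C(X, ℝ)) = (g : C(X, ℝ)) + (g' : C(X, ℝ)) := rfl
      simp only [this, map_add]; ring
    map_smul' := fun c g => by
      have : ((c • g : CompactlySupportedContinuousMap X ℝ) : C(X, ℝ)) = c • (g : C(X, ℝ)) := rfl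
      simp only [this, map_smul, smul_eq_mul, RingHom.id_apply]; ring
    monotone' := fun g g' h => by
      have := hpos ((g' : C(X, ℝ)) - (g : C(X, ℝ))) (fun x => sub_nonneg.2 (h x))
      rw [map_sub] at this
      simp only
      gcongr
      linarith }
  let cc : C(X, ℝ) → CompactlySupportedContinuousMap X ℝ := fun g =>
    { toFun := g, continuous_toFun := g.continuous, hasCompactSupport' := HasCompactSupport.of_compactSpace _ }
  let μ := RealRMK.rieszMeasure Lam
  have hint : ∀ g : C(X, ℝ), ∫ x, g x ∂μ = - l g / a := fun g =>
    RealRMK.integral_rieszMeasure Lam (cc g)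
  have : IsFiniteMeasure μ := by
    have : μ univ ≤ ENNReal.ofReal (Lam (cc one)) := RealRMK.rieszMeasure_le_of_eq_one Lam
      (fun x => by simp [cc, one]) isCompact_univ (fun x _ => by simp [cc, one])
    exact ⟨this.trans_lt ENNReal.ofReal_lt_top⟩
  have hP : IsProbabilityMeasure μ := by
    have h3 := hint one
    simp only [one, ContinuousMap.const_apply, integral_const, smul_eq_mul, mul_one] at h3
    have h4 : -l (ContinuousMap.const X 1) / a = 1 := div_self ha0.ne'
    rw [h4] at h3
    constructor
    rw [← ENNReal.toReal_eq_one_iff]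
    exact h3
  refine ⟨μ, hP, fun u hu => ?_, fun g hg => ?_⟩
  · rw [hint, hU u hu]; simp
  · rw [hint, le_div_iff₀ ha0]
    have := hB 0 U.zero_mem g hg
    rw [map_zero] at this
    have : lam * a = - (lam * l one) := by rw [ha]; ring
    linarith

end HB

section Grid
variable {T : ℝ} (hT : 0 ≤ T)

open BoundedContinuousFunction

/-- dyadic grid -/
def gr (N j : ℕ) : Icc (0:ℝ) T := clamp T hT (T * j / 2 ^ N)

lemma clamp_mono {s t : ℝ} (h : s ≤ t) : clamp T hT s ≤ clamp T hT t := Set.monotone_projIcc hT h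

lemma clamp_self (s : Icc (0:ℝ) T) : clamp T hT s = s := Set.projIcc_val hT s

lemma clamp_min (s t : ℝ) : clamp T hT (min s t) = min (clamp T hT s) (clamp T hT t) :=
  (Set.monotone_projIcc hT).map_min

lemma gr_mono (N : ℕ) {i j : ℕ} (h : i ≤ j) : gr hT N i ≤ gr hT N j := by
  refine clamp_mono hT ?_
  have : (i:ℝ) ≤ j := by exact_mod_cast h
  gcongr

lemma gr_double (N j : ℕ) : gr hT (N+1) (2*j) = gr hT N j := by
  unfold gr
  congr 1
  push_cast
  rw [pow_succ]; field_simp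

lemma gr_zero (N : ℕ) : gr hT N 0 = t0 T hT := by
  have : gr hT N 0 = clamp T hT 0 := by simp [gr]
  rw [this]; exact clamp_self hT (t0 T hT)

lemma gr_last (N : ℕ) : (gr hT N (2^N) : ℝ) = T := by
  have : gr hT N (2^N) = clamp T hT T := by
    unfold gr; congr 1; push_cast; field_simp
  rw [this]; exact congrArg Subtype.val (clamp_self hT ⟨T, hT, le_rfl⟩)

lemma S_stop (p : PathPair T) (s : Icc (0:ℝ) T) (t : ℝ) :
    SbarProc T hT t (sp p s) = SbarProc T hT (min t s) p := by
  simp only [SbarProc, ev, sp1, clamp_min, clamp_self, min_comm]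

lemma SS_stop (p : PathPair T) (s : Icc (0:ℝ) T) (t : ℝ) :
    SSbarProc T hT t (sp p s) = SSbarProc T hT (min t s) p := by
  have h0 : min s (clamp T hT 0) = clamp T hT 0 := by
    have : clamp T hT 0 = t0 T hT := clamp_self hT (t0 T hT)
    rw [this]; exact min_eq_right (Subtype.coe_le_coe.1 s.2.1)
  simp only [SSbarProc, ev, sp1, sp2, clamp_min, clamp_self, h0]
  rw [min_comm s]

lemma S_contp (t : ℝ) : Continuous (SbarProc T hT t) :=
  (continuous_eval_const (clamp T hT t)).comp continuous_fst

lemma SS_contp (t : ℝ) : Continuous (SSbarProc T hT t) := by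
  have h1 : ∀ t, Continuous fun p : PathPair T => ev T hT p.1 t := fun t => S_contp hT t
  have h2 : Continuous fun p : PathPair T => ev T hT p.2 t :=
    (continuous_eval_const (clamp T hT t)).comp continuous_snd
  exact ((((h1 t).pow 2).sub ((h1 0).pow 2)).sub h2).div_const 2

/-- gains of a grid strategy -/
def gain (X : ℝ → PathPair T → ℝ) (N : ℕ) (f : ℕ → PathPair T →ᵇ ℝ) (p : PathPair T) : ℝ :=
  ∑ j ∈ Finset.range (2^N), f j (sp p (gr hT N j)) * (X (gr hT N (j+1)) p - X (gr hT N j) p)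

lemma gain_cont {X : ℝ → PathPair T → ℝ} (hX : ∀ t, Continuous (X t)) (N : ℕ) (f : ℕ → PathPair T →ᵇ ℝ) :
    Continuous (gain hT X N f) := by
  refine continuous_finsetSum _ fun j _ => ?_
  exact ((f j).continuous.comp (sp_cont_left _)).mul ((hX _).sub (hX _))

lemma gain_add (X : ℝ → PathPair T → ℝ) (N : ℕ) (f g : ℕ → PathPair T →ᵇ ℝ) (p : PathPair T) :
    gain hT X N (fun j => f j + g j) p = gain hT X N f p + gain hT X N g p := by
  simp only [gain, ← Finset.sum_add_distrib]
  refine Finset.sum_congr rfl fun j _ => ?_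
  rw [BoundedContinuousFunction.add_apply]; ring

lemma gain_smul (X : ℝ → PathPair T → ℝ) (N : ℕ) (c : ℝ) (f : ℕ → PathPair T →ᵇ ℝ) (p : PathPair T) :
    gain hT X N (fun j => c • f j) p = c * gain hT X N f p := by
  simp only [gain, Finset.mul_sum]
  refine Finset.sum_congr rfl fun j _ => ?_
  rw [BoundedContinuousFunction.smul_apply, smul_eq_mul]; ring

lemma gain_zero (X : ℝ → PathPair T → ℝ) (N : ℕ) (p : PathPair T) :
    gain hT X N (fun _ => 0) p = 0 := by
  simp [gain]

/-- precomposition with stopping -/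
def stopF (F : PathPair T →ᵇ ℝ) (s : Icc (0:ℝ) T) : PathPair T →ᵇ ℝ :=
  F.compContinuous ⟨fun p => sp p s, sp_cont_left s⟩

lemma stopF_apply (F : PathPair T →ᵇ ℝ) (s : Icc (0:ℝ) T) (p : PathPair T) : stopF F s p = F (sp p s) := rfl

lemma stopF_stop (F : PathPair T →ᵇ ℝ) {s t : Icc (0:ℝ) T} (h : s ≤ t) (p : PathPair T) :
    stopF F s (sp p t) = F (sp p s) := by
  rw [stopF_apply, sp_sp, min_eq_right h]

lemma sum_double (M : ℕ) (a : ℕ → ℝ) :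
    ∑ j ∈ Finset.range (2*M), a j = ∑ i ∈ Finset.range M, (a (2*i) + a (2*i+1)) := by
  induction M with
  | zero => simp
  | succ n ih => rw [Finset.sum_range_succ, ← ih, mul_add, mul_one, Finset.sum_range_succ, Finset.sum_range_succ]; ring

lemma gain_ref1 (N : ℕ) (f : ℕ → PathPair T →ᵇ ℝ) : ∃ f' : ℕ → PathPair T →ᵇ ℝ,
    ∀ X p, gain hT X (N+1) f' p = gain hT X N f p := by
  refine ⟨fun j => stopF (f (j/2)) (gr hT N (j/2)), fun X p => ?_⟩
  unfold gain
  rw [pow_succ', sum_double]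
  refine Finset.sum_congr rfl fun i _ => ?_
  have e1 : 2 * i / 2 = i := by omega
  have e2 : (2 * i + 1) / 2 = i := by omega
  have e3 : 2 * i + 1 + 1 = 2 * (i + 1) := by ring
  beta_reduce
  rw [e1, e2, e3, gr_double, gr_double, stopF_stop _ le_rfl, stopF_stop]
  · ring
  · rw [← gr_double]; exact gr_mono hT _ (by omega)

lemma gain_ref {N M : ℕ} (h : N ≤ M) (f : ℕ → PathPair T →ᵇ ℝ) : ∃ f' : ℕ → PathPair T →ᵇ ℝ,
    ∀ X p, gain hT X M f' p = gain hT X N f p := by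
  induction M, h using Nat.le_induction with
  | base => exact ⟨f, fun _ _ => rfl⟩
  | succ M _ ih =>
    obtain ⟨f', hf'⟩ := ih
    obtain ⟨f'', hf''⟩ := gain_ref1 hT M f'
    exact ⟨f'', fun X p => (hf'' X p).trans (hf' X p)⟩

/-- space of gains on `K` -/
def UU (K : Set (PathPair T)) : Submodule ℝ C(K, ℝ) where
  carrier := {u | ∃ N f g, ∀ x : K, u x = gain hT (SbarProc T hT) N f x + gain hT (SSbarProc T hT) N g x}
  zero_mem' := ⟨0, fun _ => 0, fun _ => 0, fun x => by rw [gain_zero, gain_zero]; simp⟩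
  add_mem' := by
    rintro u v ⟨N, f, g, h⟩ ⟨M, k, l, h'⟩
    obtain ⟨f', hf⟩ := gain_ref hT (le_max_left N M) f
    obtain ⟨g', hg⟩ := gain_ref hT (le_max_left N M) g
    obtain ⟨k', hk⟩ := gain_ref hT (le_max_right N M) k
    obtain ⟨l', hl⟩ := gain_ref hT (le_max_right N M) l
    refine ⟨max N M, fun j => f' j + k' j, fun j => g' j + l' j, fun x => ?_⟩
    rw [gain_add, gain_add, hf, hg, hk, hl, ContinuousMap.add_apply, h, h']; ring
  smul_mem' := by
    rintro c u ⟨N, f, g, h⟩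
    refine ⟨N, fun j => c • f j, fun j => c • g j, fun x => ?_⟩
    rw [gain_smul, gain_smul, ContinuousMap.smul_apply, h, smul_eq_mul]; ring

end Grid

section MartMeas
variable {T : ℝ} (hT : 0 ≤ T)

open BoundedContinuousFunction

lemma sign_ext {Ω E : Type*} [MeasurableSpace Ω] [TopologicalSpace E] [MeasurableSpace E] [BorelSpace E]
    [HasOuterApproxClosed E] {Q : Measure Ω} {π : Ω → E} (hπ : Measurable π) {D : Ω → ℝ} (hD : Integrable D Q)
    (h : ∀ F : E →ᵇ ℝ, ∫ x, F (π x) * D x ∂Q = 0) {B : Set E} (hB : MeasurableSet B) :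
    ∫ x in π ⁻¹' B, D x ∂Q = 0 := by
  let ν : (Ω → ℝ) → Measure E := fun D => (Q.withDensity fun x => ENNReal.ofReal (D x)).map π
  have hfin : ∀ D : Ω → ℝ, Integrable D Q → IsFiniteMeasure (ν D) := by
    intro D hD
    have : IsFiniteMeasure (Q.withDensity fun x => ENNReal.ofReal (D x)) := by
      refine isFiniteMeasure_withDensity_ofReal hD.2
    exact Measure.isFiniteMeasure_map _ _
  have hint : ∀ D : Ω → ℝ, Integrable D Q → ∀ F : E →ᵇ ℝ, ∫ y, F y ∂(ν D) = ∫ x, max (D x) 0 * F (π x) ∂Q := by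
    intro D hD F
    rw [integral_map hπ.aemeasurable F.continuous.measurable.aestronglyMeasurable]
    rw [integral_withDensity_eq_integral_toReal_smul₀ hD.aemeasurable.ennreal_ofReal
      (Eventually.of_forall fun x => ENNReal.ofReal_lt_top)]
    refine integral_congr_ae (Eventually.of_forall fun x => ?_)
    simp only [ENNReal.toReal_ofReal', smul_eq_mul]
  have hbm : ∀ D : Ω → ℝ, Integrable D Q → ∀ F : E →ᵇ ℝ, Integrable (fun x => max (D x) 0 * F (π x)) Q := by
    intro D hD F
    refine hD.pos_part.mul_bdd (c := ‖F‖) ?_ (Eventually.of_forall fun x => F.norm_coe_le_norm _)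
    exact (F.continuous.measurable.comp hπ).aestronglyMeasurable
  have := hfin D hD
  have := hfin (fun x => - D x) hD.neg
  have heq : ν D = ν (fun x => - D x) := by
    refine ext_of_forall_integral_eq_of_IsFiniteMeasure fun F => ?_
    rw [hint D hD F, hint (fun x => - D x) hD.neg F, ← sub_eq_zero,
      ← integral_sub (hbm D hD F) (hbm (fun x => - D x) hD.neg F)]
    refine (integral_congr_ae (Eventually.of_forall fun x => ?_)).trans (h F)
    rcases le_total (D x) 0 with hx | hx
    · rw [max_eq_right hx, max_eq_left (by linarith)]; ring
    · rw [max_eq_left hx, max_eq_right (by linarith)]; ring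
  have h1 : ∫⁻ x in π ⁻¹' B, ENNReal.ofReal (D x) ∂Q = ∫⁻ x in π ⁻¹' B, ENNReal.ofReal (- D x) ∂Q := by
    have h2 : ν D B = ν (fun x => - D x) B := by rw [heq]
    simp only [ν] at h2
    rwa [Measure.map_apply hπ hB, Measure.map_apply hπ hB, withDensity_apply _ (hπ hB), withDensity_apply _ (hπ hB)] at h2
  rw [integral_eq_lintegral_pos_part_sub_lintegral_neg_part hD.integrableOn, h1, sub_self]

/-- upper dyadic index -/
def up (T : ℝ) (N : ℕ) (s : ℝ) : ℕ := ⌈s * 2 ^ N / T⌉₊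

lemma up_spec (N : ℕ) (s : Icc (0:ℝ) T) : up T N s ≤ 2^N ∧ s ≤ gr hT N (up T N s) ∧
    (gr hT N (up T N s) : ℝ) ≤ s + T / 2^N := by
  rcases hT.eq_or_lt with h | h
  · subst h
    have hs : (s:ℝ) = 0 := le_antisymm s.2.2 s.2.1
    have h1 : ∀ r : Icc (0:ℝ) 0, r = s := fun r => Subtype.ext ((le_antisymm r.2.2 r.2.1).trans hs.symm)
    refine ⟨by simp [up], (h1 _).ge, ?_⟩
    rw [h1 (gr _ _ _)]; simp
  · have hp : (0:ℝ) < 2^N := by positivity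
    have h0 : 0 ≤ (s:ℝ) * 2^N / T := by have := s.2.1; positivity
    refine ⟨?_, ?_, ?_⟩
    · refine Nat.ceil_le.2 ?_
      rw [div_le_iff₀ h]; push_cast
      rw [mul_comm]; gcongr; exact s.2.2
    · rw [← clamp_self hT s]
      refine clamp_mono hT ?_
      have h1 : (s:ℝ) * 2^N / T ≤ up T N s := Nat.le_ceil _
      rw [clamp_self, le_div_iff₀ hp]
      rw [div_le_iff₀ h] at h1
      linarith
    · have h2 : (up T N s : ℝ) < s * 2^N / T + 1 := Nat.ceil_lt_add_one h0
      refine clamp_le hT ?_ (by have := s.2.1; positivity)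
      rw [div_le_iff₀ hp, add_mul, div_mul_cancel₀ _ hp.ne']
      have h3 : T * (up T N s) ≤ T * (s * 2^N / T + 1) := by gcongr
      have h4 : T * (s * 2^N / T + 1) = s * 2^N + T := by field_simp
      linarith

lemma up_mono (hT : 0 ≤ T) (N : ℕ) {s t : ℝ} (h : s ≤ t) : up T N s ≤ up T N t := by
  refine Nat.ceil_mono ?_
  gcongr

lemma up_tendsto (s : Icc (0:ℝ) T) : Tendsto (fun N => (gr hT N (up T N s) : ℝ)) atTop (𝓝 s) := by
  have h0 : Tendsto (fun N : ℕ => T / 2^N) atTop (𝓝 0) := by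
    have := (tendsto_pow_atTop_nhds_zero_of_lt_one (r := (1/2:ℝ)) (by norm_num) (by norm_num)).const_mul T
    rw [mul_zero] at this
    refine this.congr fun N => ?_
    rw [div_pow, one_pow]; ring
  have h1 : Tendsto (fun N : ℕ => (s:ℝ) + T / 2^N) atTop (𝓝 s) := by
    simpa using tendsto_const_nhds.add h0
  exact tendsto_of_tendsto_of_tendsto_of_le_of_le tendsto_const_nhds h1
    (fun N => (up_spec hT N s).2.1) (fun N => (up_spec hT N s).2.2)

lemma mart_of_gain {Q : Measure (PathPair T)} [IsProbabilityMeasure Q] {X : ℝ → PathPair T → ℝ}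
    (hXc : ∀ t, Continuous (X t)) (hXt : ∀ p, Continuous fun t => X t p) {C : ℝ}
    (hb : ∀ᵐ p ∂Q, ∀ t, |X t p| ≤ C) (hg : ∀ N f, ∫ p, gain hT X N f p ∂Q = 0) :
    IsLocalMartBar T Q X := by
  have hi : ∀ t, Integrable (X t) Q := fun t =>
    Integrable.of_bound (hXc t).measurable.aestronglyMeasurable C (hb.mono fun p hp => hp t)
  have hFi : ∀ (F : PathPair T →ᵇ ℝ) (r s t : Icc (0:ℝ) T), Integrable (fun p => F (sp p r) * (X t p - X s p)) Q := by
    intro F r s t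
    refine ((hi t).sub (hi s)).bdd_mul (c := ‖F‖) ?_ (Eventually.of_forall fun x => F.norm_coe_le_norm _)
    exact (F.continuous.comp (sp_cont_left r)).measurable.aestronglyMeasurable
  have hstep : ∀ (F : PathPair T →ᵇ ℝ) (N j : ℕ), j < 2^N →
      ∫ p, F (sp p (gr hT N j)) * (X (gr hT N (j+1)) p - X (gr hT N j) p) ∂Q = 0 := by
    intro F N j hj
    refine Eq.trans (integral_congr_ae (Eventually.of_forall fun p => ?_)) (hg N (fun i => if i = j then F else 0))
    simp only [gain]
    rw [Finset.sum_eq_single j]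
    · simp
    · intro i _ hij; simp [hij]
    · intro hn; exact absurd (Finset.mem_range.2 hj) hn
  have htel : ∀ (F : PathPair T →ᵇ ℝ) (N j k : ℕ), j ≤ k → k ≤ 2^N → ∀ r ≤ gr hT N j,
      ∫ p, F (sp p r) * (X (gr hT N k) p - X (gr hT N j) p) ∂Q = 0 := by
    intro F N j k hjk hk r hr
    induction k, hjk using Nat.le_induction with
    | base => simp
    | succ k hjk ih =>
      have h1 := ih (by omega)
      have h2 := hstep (stopF F r) N k (by omega)
      have h3 : ∀ p, stopF F r (sp p (gr hT N k)) = F (sp p r) := fun p =>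
        stopF_stop F (hr.trans (gr_mono hT N hjk)) p
      simp only [h3] at h2
      have h4 := integral_add (hFi F r (gr hT N j) (gr hT N k)) (hFi F r (gr hT N k) (gr hT N (k+1)))
      rw [h1, h2, add_zero] at h4
      refine Eq.trans (integral_congr_ae (Eventually.of_forall fun p => ?_)) h4
      beta_reduce; ring
  have hst : ∀ (F : PathPair T →ᵇ ℝ) (s t : Icc (0:ℝ) T), s ≤ t →
      ∫ p, F (sp p s) * (X t p - X s p) ∂Q = 0 := by
    intro F s t hst
    have hlim : Tendsto (fun N => ∫ p, F (sp p s) * (X (gr hT N (up T N t)) p - X (gr hT N (up T N s)) p) ∂Q) atTop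
        (𝓝 (∫ p, F (sp p s) * (X t p - X s p) ∂Q)) := by
      refine tendsto_integral_of_dominated_convergence (fun _ => ‖F‖ * (C + C)) ?_ (integrable_const _) ?_ ?_
      · exact fun N => (hFi F s _ _).aestronglyMeasurable
      · intro N
        filter_upwards [hb] with p hp
        rw [norm_mul]
        refine mul_le_mul (F.norm_coe_le_norm _) ?_ (norm_nonneg _) (norm_nonneg _)
        exact (norm_sub_le _ _).trans (add_le_add (hp _) (hp _))
      · refine Eventually.of_forall fun p => ?_
        refine tendsto_const_nhds.mul (Tendsto.sub ?_ ?_)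
        · exact ((hXt p).tendsto _).comp (up_tendsto hT t)
        · exact ((hXt p).tendsto _).comp (up_tendsto hT s)
    refine tendsto_nhds_unique hlim ?_
    refine tendsto_const_nhds.congr fun N => ?_
    exact (htel F N _ _ (up_mono hT N hst) (up_spec hT N t).1 s (up_spec hT N s).2.1).symm
  refine ⟨fun m _ => T + 1 + m, ?_, ?_, ?_⟩
  · intro m t _
    exact @MeasurableSet.const _ (FbarRaw T t) _
  · refine Eventually.of_forall fun p => ⟨?_, ?_⟩
    · intro a b hab
      have : (a:ℝ) ≤ b := by exact_mod_cast hab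
      simp only; linarith
    · exact tendsto_atTop_add_const_left _ _ tendsto_natCast_atTop_atTop
  · intro m
    have hmin : ∀ t ∈ Icc (0:ℝ) T, min (T + 1 + (m:ℝ)) t = t := fun t ht =>
      min_eq_right (by have := ht.2; have : (0:ℝ) ≤ m := Nat.cast_nonneg m; linarith)
    refine ⟨fun t ht => ?_, fun s t hs ht hst' A hA => ?_⟩
    · simp only [hmin t ht]; exact hi t
    · simp only [hmin t ht, hmin s hs]
      obtain ⟨B, hB, rfl⟩ := raw_eq (s := ⟨s, hs⟩) hA
      have h4 := sign_ext (Q := Q) (sp_cont_left (⟨s, hs⟩ : Icc (0:ℝ) T)).measurable ((hi t).sub (hi s))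
        (fun F => hst F ⟨s, hs⟩ ⟨t, ht⟩ hst') hB
      rw [← sub_eq_zero, ← integral_sub (hi t).integrableOn (hi s).integrableOn]
      exact h4

lemma exists_Q {K Xibar : Set (PathPair T)} (hK : IsCompact K) (hKX : K ⊆ Xibar) (hXm : MeasurableSet Xibar)
    {η : PathPair T → ℝ} (hη : UpperSemicontinuous η) {C : ℝ} (h0 : ∀ x, 0 ≤ η x) (hC : ∀ x, η x ≤ C) {lam : ℝ}
    (hno : ¬ ∃ N f g, ∀ p ∈ K, η p ≤ lam + gain hT (SbarProc T hT) N f p + gain hT (SSbarProc T hT) N g p) :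
    ∃ Q ∈ MbarSet T hT Xibar, ENNReal.ofReal lam ≤ ∫⁻ p, ENNReal.ofReal (η p) ∂Q := by
  have : CompactSpace K := isCompact_iff_compactSpace.1 hK
  obtain ⟨μ, hμ, hU, hlam⟩ := hb_riesz (UU hT K) (fun x : K => η x) (C := C) (fun x => hC x) (lam := lam) (by
    rintro ⟨u, ⟨N, f, g, h⟩, hu⟩
    refine hno ⟨N, f, g, fun p hp => ?_⟩
    have := hu ⟨p, hp⟩
    rw [h] at this
    simp only at this
    linarith)
  have hvm : Measurable (Subtype.val : K → PathPair T) := measurable_subtype_coe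
  let Q : Measure (PathPair T) := μ.map Subtype.val
  have hQ : IsProbabilityMeasure Q := Measure.isProbabilityMeasure_map hvm.aemeasurable
  have hcin : ∀ f : PathPair T → ℝ, Measurable f → ∫ p, f p ∂Q = ∫ x : K, f x ∂μ := fun f hf =>
    integral_map hvm.aemeasurable hf.aestronglyMeasurable
  have hgain : ∀ N f g, ∫ p, (gain hT (SbarProc T hT) N f p + gain hT (SSbarProc T hT) N g p) ∂Q = 0 := by
    intro N f g
    have hc : Continuous fun p => gain hT (SbarProc T hT) N f p + gain hT (SSbarProc T hT) N g p :=
      (gain_cont hT (S_contp hT) N f).add (gain_cont hT (SS_contp hT) N g)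
    rw [hcin _ hc.measurable]
    exact hU ⟨fun x : K => gain hT (SbarProc T hT) N f x + gain hT (SSbarProc T hT) N g x,
      hc.comp continuous_subtype_val⟩ ⟨N, f, g, fun x => rfl⟩
  have hKae : ∀ᵐ p ∂Q, p ∈ K := by
    refine (ae_map_iff (p := fun p => p ∈ K) hvm.aemeasurable hK.measurableSet).2 ?_
    exact Eventually.of_forall fun x => x.2
  obtain ⟨R, hR⟩ := hK.isBounded.exists_norm_le
  have hR1 : ∀ p ∈ K, ∀ t, |ev T hT p.1 t| ≤ R := fun p hp t =>
    (p.1.norm_coe_le_norm _).trans ((norm_fst_le p).trans (hR p hp))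
  have hR2 : ∀ p ∈ K, ∀ t, |ev T hT p.2 t| ≤ R := fun p hp t =>
    (p.2.norm_coe_le_norm _).trans ((norm_snd_le p).trans (hR p hp))
  have hS : IsLocalMartBar T Q (SbarProc T hT) := by
    refine mart_of_gain hT (C := R) (S_contp hT) (S_cont hT) (hKae.mono fun p hp t => hR1 p hp t) fun N f => ?_
    have := hgain N f (fun _ => 0)
    simpa only [gain_zero, add_zero] using this
  have hSS : IsLocalMartBar T Q (SSbarProc T hT) := by
    refine mart_of_gain hT (C := (R^2 + R^2 + R)/2) (SS_contp hT) (SS_cont hT) (hKae.mono fun p hp t => ?_) fun N f => ?_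
    · have a := hR1 p hp t
      have b := hR1 p hp 0
      have c := hR2 p hp t
      simp only [SSbarProc]
      have a2 : (ev T hT p.1 t)^2 ≤ R^2 := sq_le_sq' (abs_le.1 a).1 (abs_le.1 a).2
      have b2 : (ev T hT p.1 0)^2 ≤ R^2 := sq_le_sq' (abs_le.1 b).1 (abs_le.1 b).2
      have c2 := abs_le.1 c
      rw [abs_le]
      constructor <;> nlinarith [sq_nonneg (ev T hT p.1 t), sq_nonneg (ev T hT p.1 0)]
    · have := hgain N (fun _ => 0) f
      simpa only [gain_zero, zero_add] using this
  refine ⟨Q, ⟨hQ, hS, hSS, ?_⟩, ?_⟩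
  · exact (mem_ae_iff_prob_eq_one hXm).1 (hKae.mono hKX)
  · have hηm : Measurable η := hη.measurable
    have hi : Integrable η Q := Integrable.of_bound hηm.aestronglyMeasurable C (Eventually.of_forall fun p => by
      rw [Real.norm_eq_abs, abs_of_nonneg (h0 p)]; exact hC p)
    rw [← ofReal_integral_eq_lintegral_ofReal hi (Eventually.of_forall h0)]
    refine ENNReal.ofReal_le_ofReal ?_
    rw [hcin η hηm]
    refine usc_int (μ := μ) (η := fun x : K => η x) (C := C) ?_ (fun x => h0 x) (fun x => hC x) fun g hg _ => hlam g hg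
    exact fun x y hy => continuous_subtype_val.continuousAt.eventually (hη x y hy)

end MartMeas

section StopStrat
variable {T : ℝ} (hT : 0 ≤ T)

open BoundedContinuousFunction

/-- last time in `K` -/
def tK (K : Set (PathPair T)) (p : PathPair T) : ℝ :=
  sSup (Subtype.val '' {t : Icc (0:ℝ) T | sp p t ∈ K} ∪ {0})

lemma tK_bdd (K : Set (PathPair T)) (p : PathPair T) (hT : 0 ≤ T) :
    ∀ x ∈ (Subtype.val '' {t : Icc (0:ℝ) T | sp p t ∈ K} ∪ {0}), x ≤ T := by
  rintro x (⟨t, _, rfl⟩ | h)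
  · exact t.2.2
  · rw [mem_singleton_iff] at h; rw [h]; exact hT

lemma tK_le (hT : 0 ≤ T) (K : Set (PathPair T)) (p : PathPair T) : tK K p ≤ T :=
  csSup_le ⟨0, Or.inr rfl⟩ (tK_bdd K p hT)

lemma tK_nonneg (hT : 0 ≤ T) (K : Set (PathPair T)) (p : PathPair T) : 0 ≤ tK K p :=
  le_csSup ⟨T, tK_bdd K p hT⟩ (Or.inr rfl)

lemma le_tK (hT : 0 ≤ T) {K : Set (PathPair T)} {p : PathPair T} {t : Icc (0:ℝ) T} (h : sp p t ∈ K) : (t:ℝ) ≤ tK K p :=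
  le_csSup ⟨T, tK_bdd K p hT⟩ (Or.inl ⟨t, h, rfl⟩)

lemma tK_le_iff (hT : 0 ≤ T) {K : Set (PathPair T)} {p : PathPair T} {t : ℝ} (ht : 0 ≤ t) :
    tK K p ≤ t ↔ ∀ s : Icc (0:ℝ) T, sp p s ∈ K → (s:ℝ) ≤ t := by
  refine ⟨fun h s hs => (le_tK hT hs).trans h, fun h => csSup_le ⟨0, Or.inr rfl⟩ ?_⟩
  rintro x (⟨s, hs, rfl⟩ | hx)
  · exact h s hs
  · rw [mem_singleton_iff] at hx; rw [hx]; exact ht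

lemma sp_stab {K : Set (PathPair T)} (hst : ∀ p ∈ K, ∀ t, sp p t ∈ K) {p : PathPair T} {s t : Icc (0:ℝ) T}
    (h : s ≤ t) (ht : sp p t ∈ K) : sp p s ∈ K := by
  have := hst _ ht s
  rwa [sp_sp, min_eq_right h] at this

lemma tK_mem {K : Set (PathPair T)} (hK : IsClosed K) (hst : ∀ p ∈ K, ∀ t, sp p t ∈ K) {p : PathPair T}
    (h0 : sp p (t0 T hT) ∈ K) {s : Icc (0:ℝ) T} (hs : (s:ℝ) ≤ tK K p) : sp p s ∈ K := by
  have hcl : IsClosed {t : Icc (0:ℝ) T | sp p t ∈ K} := hK.preimage (sp_cont_right p)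
  have hc : IsCompact (Subtype.val '' {t : Icc (0:ℝ) T | sp p t ∈ K}) :=
    hcl.isCompact.image continuous_subtype_val
  have hu : Subtype.val '' {t : Icc (0:ℝ) T | sp p t ∈ K} ∪ {0} = Subtype.val '' {t : Icc (0:ℝ) T | sp p t ∈ K} := by
    refine union_eq_left.2 ?_
    rintro x hx
    rw [mem_singleton_iff] at hx; subst hx
    exact ⟨t0 T hT, h0, rfl⟩
  have := hc.sSup_mem ⟨0, t0 T hT, h0, rfl⟩
  rw [← hu] at this
  obtain ⟨t, ht, he⟩ | h := this
  · refine sp_stab hst ?_ ht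
    refine Subtype.coe_le_coe.1 (hs.trans ?_)
    exact he.ge
  · rw [mem_singleton_iff] at h
    have h1 : s = t0 T hT := Subtype.ext (le_antisymm (hs.trans h.le) s.2.1)
    rw [h1]; exact h0

lemma plus_le (t : ℝ) : FbarPlus T t ≤ FbarDeltaPlus T hT t := le_sup_left

lemma plus_meas {t : ℝ} {A : Set (PathPair T)} (h : ∀ s, t < s → MeasurableSet[FbarRaw T (min s T)] A) :
    MeasurableSet[FbarDeltaPlus T hT t] A := by
  refine plus_le hT t _ ?_
  unfold FbarPlus
  simp only [MeasurableSpace.measurableSet_iInf]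
  exact h

lemma tK_stop {K : Set (PathPair T)} (hK : IsClosed K) (hst : ∀ p ∈ K, ∀ t, sp p t ∈ K) {t : ℝ}
    (ht : t ∈ Icc (0:ℝ) T) : MeasurableSet[FbarDeltaPlus T hT t] {p | tK K p ≤ t} := by
  refine plus_meas hT fun u hu => ?_
  rcases ht.2.eq_or_lt with h | h
  · have : {p : PathPair T | tK K p ≤ t} = univ := eq_univ_of_forall fun p => (tK_le hT K p).trans h.ge
    rw [this]; exact @MeasurableSet.univ _ (FbarRaw T (min u T))
  · have hv : t < min u T := lt_min hu h
    set v := min u T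
    have hvT : v ≤ T := min_le_right _ _
    have hs : ∀ n : ℕ, t < t + (v - t) / (n + 1) ∧ t + (v - t) / (n + 1) ≤ v := by
      intro n
      have hn : (0:ℝ) < n + 1 := by positivity
      have h1 : 0 < (v - t) / (n + 1) := div_pos (by linarith) hn
      have h2 : (v - t) / (n + 1) ≤ v - t := div_le_self (by linarith) (by linarith [(Nat.cast_nonneg n : (0:ℝ) ≤ n)])
      constructor <;> linarith
    let s : ℕ → Icc (0:ℝ) T := fun n => ⟨t + (v - t) / (n + 1), ht.1.trans (hs n).1.le, (hs n).2.trans hvT⟩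
    have he : {p : PathPair T | tK K p ≤ t} = ⋂ n, ((fun p => sp p (s n)) ⁻¹' K)ᶜ := by
      ext p
      rw [mem_ofPred_eq, tK_le_iff hT ht.1, mem_iInter]
      refine ⟨fun H n hn => ?_, fun H r hr => ?_⟩
      · exact absurd (H (s n) hn) (not_le.2 (hs n).1)
      · by_contra hcon
        push Not at hcon
        have hl : Tendsto (fun n : ℕ => t + (v - t) / ((n:ℝ) + 1)) atTop (𝓝 t) := by
          have := (tendsto_one_div_add_atTop_nhds_zero_nat (𝕜 := ℝ)).const_mul (v - t)
          have := this.const_add t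
          rw [mul_zero, add_zero] at this
          refine this.congr fun n => ?_
          rw [mul_one_div]
        obtain ⟨n, hn⟩ := (hl.eventually (gt_mem_nhds hcon)).exists
        refine H n (sp_stab hst ?_ hr)
        exact Subtype.coe_le_coe.1 hn.le
    rw [he]
    refine @MeasurableSet.iInter _ _ (FbarRaw T v) _ _ fun n => ?_
    refine @MeasurableSet.compl _ _ (FbarRaw T v) ?_
    exact sp_meas (s n) (hs n).2 hK.measurableSet

/-- coefficient -/
def cK (K : Set (PathPair T)) (N : ℕ) (f : ℕ → PathPair T →ᵇ ℝ) (l : ℕ) (p : PathPair T) : ℝ :=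
  K.indicator (f l) (sp p (gr hT N l))

/-- stopped grid strategy -/
def stratK {K : Set (PathPair T)} (hK : IsClosed K) (hst : ∀ p ∈ K, ∀ t, sp p t ∈ K) (N : ℕ)
    (f : ℕ → PathPair T →ᵇ ℝ) : SimpleStrategyBar T hT where
  L := 2^N
  τ l p := min (gr hT N l) (tK K p)
  coeff l p := cK hT K N f l p
  τ_nonneg p := le_min (gr hT N _).2.1 (tK_nonneg hT K p)
  τ_mono l p := min_le_min_right _ (Subtype.coe_le_coe.2 (gr_mono hT N (by simp)))
  τ_le p := (min_le_right _ _).trans (tK_le hT K p)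
  τ_stop l t ht := by
    by_cases h : (gr hT N l : ℝ) ≤ t
    · have : {p : PathPair T | min (gr hT N l : ℝ) (tK K p) ≤ t} = univ :=
        eq_univ_of_forall fun p => (min_le_left _ _).trans h
      rw [this]; exact @MeasurableSet.univ _ (FbarDeltaPlus T hT t)
    · have : {p : PathPair T | min (gr hT N l : ℝ) (tK K p) ≤ t} = {p | tK K p ≤ t} := by
        ext p; simp only [mem_ofPred_eq, min_le_iff, h, false_or]
      rw [this]; exact tK_stop hT hK hst ht
  coeff_bdd l := ⟨‖f l‖, fun p => by
    unfold cK
    by_cases h : sp p (gr hT N l) ∈ K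
    · rw [indicator_of_mem h]; exact (f l).norm_coe_le_norm _
    · rw [indicator_of_notMem h, abs_zero]; exact norm_nonneg _⟩
  coeff_meas l B hB t ht := by
    have hcs : ((l.castSucc : Fin (2^N+1)) : ℕ) = l := rfl
    rw [hcs]
    by_cases h : (gr hT N l : ℝ) ≤ t
    · have : {p : PathPair T | min (gr hT N l : ℝ) (tK K p) ≤ t} = univ :=
        eq_univ_of_forall fun p => (min_le_left _ _).trans h
      rw [this, inter_univ]
      refine plus_meas hT fun u hu => ?_
      have h1 : Measurable (K.indicator (f l)) := (f l).continuous.measurable.indicator hK.measurableSet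
      exact sp_meas (gr hT N l) (le_min (h.trans hu.le) (gr hT N l).2.2) (h1 hB)
    · have h1 : ∀ p, tK K p ≤ t → cK hT K N f l p = 0 := by
        intro p hp
        refine indicator_of_notMem (fun hm => h ?_) _
        exact (le_tK hT hm).trans hp
      have : {p : PathPair T | min (gr hT N l : ℝ) (tK K p) ≤ t} = {p | tK K p ≤ t} := by
        ext p; simp only [mem_ofPred_eq, min_le_iff, h, false_or]
      rw [this]
      by_cases h0 : (0:ℝ) ∈ B
      · have : (fun p => cK hT K N f l p) ⁻¹' B ∩ {p | tK K p ≤ t} = {p | tK K p ≤ t} := by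
          refine inter_eq_right.2 fun p hp => ?_
          rw [mem_preimage, h1 p hp]; exact h0
        rw [this]; exact tK_stop hT hK hst ht
      · have : (fun p => cK hT K N f l p) ⁻¹' B ∩ {p | tK K p ≤ t} = ∅ := by
          refine eq_empty_of_forall_notMem fun p hp => h0 ?_
          have := hp.1
          rwa [mem_preimage, h1 p hp.2] at this
        rw [this]; exact @MeasurableSet.empty _ (FbarDeltaPlus T hT t)

lemma integ_stratK {K : Set (PathPair T)} (hK : IsClosed K) (hst : ∀ p ∈ K, ∀ t, sp p t ∈ K) (N : ℕ)
    (f : ℕ → PathPair T →ᵇ ℝ) {X : ℝ → PathPair T → ℝ} (t : ℝ) (p : PathPair T) :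
    integBar T hT (stratK hT hK hst N f) X t p = ∑ l ∈ Finset.range (2^N), cK hT K N f l p *
      (X (min (min (gr hT N (l+1)) (tK K p)) t) p - X (min (min (gr hT N l) (tK K p)) t) p) := by
  rw [Finset.sum_range]
  rfl

lemma integ_stratK_in {K : Set (PathPair T)} (hK : IsClosed K) (hst : ∀ p ∈ K, ∀ t, sp p t ∈ K) (N : ℕ)
    (f : ℕ → PathPair T →ᵇ ℝ) {X : ℝ → PathPair T → ℝ} (hX : ∀ p (s : Icc (0:ℝ) T) t, X t (sp p s) = X (min t s) p)
    {p : PathPair T} (h0 : sp p (t0 T hT) ∈ K) (m : Icc (0:ℝ) T) {t : ℝ} (hm : (m:ℝ) = min (tK K p) t) :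
    integBar T hT (stratK hT hK hst N f) X t p = gain hT X N f (sp p m) := by
  rw [integ_stratK]
  unfold gain
  refine Finset.sum_congr rfl fun l _ => ?_
  rw [hX, hX, sp_sp, min_assoc, min_assoc, ← hm]
  rcases le_or_gt (gr hT N l) m with h | h
  · rw [min_eq_right h]
    congr 1
    refine indicator_of_mem (tK_mem hT hK hst h0 ?_) _
    exact (Subtype.coe_le_coe.2 h).trans (hm.le.trans (min_le_left _ _))
  · have h1 : (m:ℝ) ≤ gr hT N l := Subtype.coe_le_coe.2 h.le
    have h2 : (m:ℝ) ≤ gr hT N (l+1) := h1.trans (Subtype.coe_le_coe.2 (gr_mono hT N (Nat.le_succ l)))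
    rw [min_eq_right h1, min_eq_right h2, sub_self, mul_zero, mul_zero]

lemma integ_stratK_out {K : Set (PathPair T)} (hK : IsClosed K) (hst : ∀ p ∈ K, ∀ t, sp p t ∈ K) (N : ℕ)
    (f : ℕ → PathPair T →ᵇ ℝ) {X : ℝ → PathPair T → ℝ}
    {p : PathPair T} (h0 : sp p (t0 T hT) ∉ K) {t : ℝ} :
    integBar T hT (stratK hT hK hst N f) X t p = 0 := by
  rw [integ_stratK]
  refine Finset.sum_eq_zero fun l _ => ?_
  have : cK hT K N f l p = 0 := indicator_of_notMem (fun hm => h0 (sp_stab hst (Subtype.coe_le_coe.1 (gr hT N l).2.1) hm)) _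
  rw [this, zero_mul]

lemma hedge_K {K : Set (PathPair T)} (hK : IsClosed K) (hst : ∀ p ∈ K, ∀ t, sp p t ∈ K)
    {η : PathPair T → ℝ} (hη : ∀ p, 0 ≤ η p) {lam : ℝ} (hlam : 0 ≤ lam)
    (h : ∃ N f g, ∀ p ∈ K, η p ≤ lam + gain hT (SbarProc T hT) N f p + gain hT (SSbarProc T hT) N g p) :
    ∃ H G : SimpleStrategyBar T hT, (∀ t ∈ Icc (0:ℝ) T, ∀ p, 0 ≤ lam + integBar T hT H (SbarProc T hT) t p
      + integBar T hT G (SSbarProc T hT) t p) ∧ ∀ p ∈ K, η p ≤ lam + (integBar T hT H (SbarProc T hT) T p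
      + integBar T hT G (SSbarProc T hT) T p) := by
  obtain ⟨N, f, g, h⟩ := h
  refine ⟨stratK hT hK hst N f, stratK hT hK hst N g, fun t ht p => ?_, fun p hp => ?_⟩
  · by_cases h0 : sp p (t0 T hT) ∈ K
    · let m : Icc (0:ℝ) T := ⟨min (tK K p) t, le_min (tK_nonneg hT K p) ht.1, (min_le_right _ _).trans ht.2⟩
      rw [integ_stratK_in hT hK hst N f (S_stop hT) h0 m rfl, integ_stratK_in hT hK hst N g (SS_stop hT) h0 m rfl]
      exact (hη _).trans (h _ (tK_mem hT hK hst h0 (min_le_left _ _)))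
    · rw [integ_stratK_out hT hK hst N f h0, integ_stratK_out hT hK hst N g h0]; linarith
  · let m : Icc (0:ℝ) T := ⟨T, hT, le_rfl⟩
    have hm : sp p m = p := sp_top p m rfl
    have h1 : T ≤ tK K p := le_tK hT (t := m) (by rw [hm]; exact hp)
    have h2 : (m:ℝ) = min (tK K p) T := (min_eq_right h1).symm
    rw [integ_stratK_in hT hK hst N f (S_stop hT) (hst p hp _) m h2,
      integ_stratK_in hT hK hst N g (SS_stop hT) (hst p hp _) m h2, hm, ← add_assoc]
    exact h p hp

end StopStrat

section Final
variable {T : ℝ} (hT : 0 ≤ T)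

lemma exhaust {Ξ : Set (Path T)} {Xibar : Set (PathPair T)} (hA : AssumptionA T hT Ξ Xibar) :
    ∃ K : ℕ → Set (PathPair T), (∀ n, IsCompact (K n)) ∧ (∀ n, K n ⊆ Xibar) ∧
      (∀ n, ∀ p ∈ K n, ∀ t, sp p t ∈ K n) ∧ ∀ p ∈ Xibar, ∀ᶠ n in atTop, p ∈ K n := by
  obtain ⟨K, hK, hX⟩ := hA.A1
  refine ⟨fun n => (fun q : PathPair T × Icc (0:ℝ) T => sp q.1 q.2) '' ((⋃ k ∈ Finset.range (n+1), K k) ×ˢ univ),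
    fun n => ?_, fun n => ?_, fun n => ?_, ?_⟩
  · refine IsCompact.image ?_ sp_cont
    exact (Finset.isCompact_biUnion _ fun k _ => hK k).prod isCompact_univ
  · rintro _ ⟨⟨p, t⟩, ⟨hp, _⟩, rfl⟩
    refine hA.A3 p ?_ t
    rw [hX]
    simp only [mem_iUnion] at hp ⊢
    obtain ⟨k, _, hk⟩ := hp
    exact ⟨k, hk⟩
  · rintro _ ⟨⟨p, t⟩, ⟨hp, _⟩, rfl⟩ s
    refine ⟨⟨p, min t s⟩, ⟨hp, mem_univ _⟩, ?_⟩
    simp only [sp_sp]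
  · intro p hp
    rw [hX] at hp
    obtain ⟨k, hk⟩ := mem_iUnion.1 hp
    filter_upwards [eventually_ge_atTop k] with n hn
    refine ⟨⟨p, ⟨T, hT, le_rfl⟩⟩, ⟨?_, mem_univ _⟩, sp_top p _ rfl⟩
    simp only [mem_iUnion]
    exact ⟨k, Finset.mem_range.2 (by omega), hk⟩

lemma strong_mem {Ξ : Set (Path T)} {Xibar : Set (PathPair T)} (hA : AssumptionA T hT Ξ Xibar)
    (ξbar : PathPair T → ℝ≥0∞) (ξn : ℕ → PathPair T → ℝ)
    (hbdd : ∀ n, ∃ C : ℝ, ∀ p, |ξn n p| ≤ C)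
    (husc : ∀ n, UpperSemicontinuous (ξn n))
    (hnonneg : ∀ n p, 0 ≤ ξn n p)
    (hrep : ∀ p : PathPair T, ξbar p =
      Filter.liminf (fun n => ENNReal.ofReal (ξn n p)) Filter.atTop) {lam : ℝ}
    (hlam : (supMartBar T hT Xibar ξbar : EReal) < lam) :
    lam ∈ PhiBarSet T hT Xibar (fun p => (ξbar p : EReal)) := by
  have hl0 : 0 ≤ lam := by
    have h1 : (0:EReal) < lam := (EReal.coe_ennreal_nonneg _).trans_lt hlam
    exact (EReal.coe_pos.1 h1).le
  obtain ⟨K, hKc, hKX, hKs, hKe⟩ := exhaust hT hA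
  have hXm : MeasurableSet Xibar := by
    obtain ⟨K, hK, hX⟩ := hA.A1
    rw [hX]; exact MeasurableSet.iUnion fun n => (hK n).measurableSet
  let η : ℕ → PathPair T → ℝ := fun n p => ⨅ k, ξn (n + k) p
  have hbb : ∀ n p, BddBelow (range fun k => ξn (n + k) p) := fun n p =>
    ⟨0, by rintro _ ⟨k, rfl⟩; exact hnonneg _ _⟩
  have hη0 : ∀ n p, 0 ≤ η n p := fun n p => le_ciInf fun k => hnonneg _ _
  have hηle : ∀ n k p, η n p ≤ ξn (n + k) p := fun n k p => ciInf_le (hbb n p) k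
  have hηu : ∀ n, UpperSemicontinuous (η n) := by
    intro n x y hy
    obtain ⟨k, hk⟩ := exists_lt_of_ciInf_lt hy
    exact (husc (n+k) x y hk).mono fun z hz => (hηle n k z).trans_lt hz
  have hηξ : ∀ n p, ENNReal.ofReal (η n p) ≤ ξbar p := by
    intro n p
    rw [hrep]
    refine le_liminf_of_le (by isBoundedDefault) ?_
    filter_upwards [eventually_ge_atTop n] with m hm
    obtain ⟨k, rfl⟩ := Nat.exists_eq_add_of_le hm
    exact ENNReal.ofReal_le_ofReal (hηle n k p)
  have hstr : ∀ n, ∃ H G : SimpleStrategyBar T hT,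
      (∀ t ∈ Icc (0:ℝ) T, ∀ p, 0 ≤ lam + integBar T hT H (SbarProc T hT) t p
      + integBar T hT G (SSbarProc T hT) t p) ∧ ∀ p ∈ K n, η n p ≤ lam + (integBar T hT H (SbarProc T hT) T p
      + integBar T hT G (SSbarProc T hT) T p) := by
    intro n
    refine hedge_K hT (hKc n).isClosed (hKs n) (hη0 n) hl0 ?_
    by_contra hno
    obtain ⟨C, hC⟩ := hbdd n
    obtain ⟨Q, hQ, hle⟩ := exists_Q hT (hKc n) (hKX n) hXm (hηu n) (C := C) (hη0 n)
      (fun p => (hηle n 0 p).trans ((le_abs_self _).trans (hC p))) hno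
    have h1 : ENNReal.ofReal lam ≤ supMartBar T hT Xibar ξbar :=
      (hle.trans (lintegral_mono fun p => hηξ n p)).trans
        (le_iSup₂ (f := fun Q (_ : Q ∈ MbarSet T hT Xibar) => ∫⁻ p, ξbar p ∂Q) Q hQ)
    have h2 : ((ENNReal.ofReal lam : ℝ≥0∞) : EReal) ≤ (supMartBar T hT Xibar ξbar : EReal) :=
      EReal.coe_ennreal_le_coe_ennreal_iff.2 h1
    rw [EReal.coe_ennreal_ofReal, max_eq_left hl0] at h2
    exact absurd hlam (not_lt.2 h2)
  choose H G hadm hsup using hstr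
  refine ⟨H, G, fun n t ht p _ => hadm n t ht p, fun p hp => ?_⟩
  set a : ℕ → ℝ := fun n => integBar T hT (H n) (SbarProc T hT) T p + integBar T hT (G n) (SSbarProc T hT) T p with ha
  have hev : ∀ᶠ n in atTop, η n p ≤ lam + a n := (hKe p hp.2).mono fun n hn => hsup n p hn
  set L : EReal := liminf (fun n => ((lam + a n : ℝ) : EReal)) atTop with hL
  have hLle : L ≤ (lam : EReal) + liminf (fun n => (a n : EReal)) atTop := by
    have h1 := EReal.liminf_add_le (f := (atTop : Filter ℕ)) (u := fun _ => (lam : EReal)) (v := fun n => (a n : EReal))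
      (by left; simp) (by left; simp)
    rw [limsup_const] at h1
    refine le_trans (le_of_eq ?_) h1
    rw [hL]; congr 1
  refine le_trans ?_ hLle
  have hcn : ∀ n, ((⨅ i ≥ n, ENNReal.ofReal (ξn i p) : ℝ≥0∞) : EReal) ≤ L := by
    intro n
    set c : ℝ≥0∞ := ⨅ i ≥ n, ENNReal.ofReal (ξn i p) with hc
    have hci : ∀ i ≥ n, c ≤ ENNReal.ofReal (ξn i p) := fun i hi => iInf₂_le i hi
    have hct : c ≠ ⊤ := ne_top_of_le_ne_top ENNReal.ofReal_ne_top (hci n le_rfl)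
    rw [← EReal.coe_ennreal_toReal hct]
    refine le_liminf_of_le (by isBoundedDefault) ?_
    filter_upwards [hev, eventually_ge_atTop n] with m hm hmn
    refine EReal.coe_le_coe_iff.2 (le_trans ?_ hm)
    refine le_ciInf fun k => ?_
    exact ENNReal.toReal_le_of_le_ofReal (hnonneg _ _) (hci _ (by omega))
  have hL0 : 0 ≤ L := (EReal.coe_ennreal_nonneg _).trans (hcn 0)
  beta_reduce
  rw [hrep, liminf_eq_iSup_iInf_of_nat, ← EReal.coe_toENNReal hL0]
  refine EReal.coe_ennreal_le_coe_ennreal_iff.2 (iSup_le fun n => ?_)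
  refine EReal.coe_ennreal_le_coe_ennreal_iff.1 ?_
  rw [EReal.coe_toENNReal hL0]; exact hcn n

end Final

/-- **Proposition 4.8 (duality on the enlarged space).** Under Assumption A,
`Φ̄(ξ̄) = sup_{Q̄ ∈ M̄(Ξ̄)} E_{Q̄}[ξ̄]` for every `ξ̄ : Ω̄ → [0,∞]` which is the liminf of
a sequence of bounded nonnegative upper semicontinuous functions. -/
theorem enlarged_space_duality (T : ℝ) (hT : 0 ≤ T)
    (Ξ : Set (Path T)) (Xibar : Set (PathPair T)) (hA : AssumptionA T hT Ξ Xibar)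
    (ξbar : PathPair T → ℝ≥0∞) (ξn : ℕ → PathPair T → ℝ)
    (hbdd : ∀ n, ∃ C : ℝ, ∀ p, |ξn n p| ≤ C)
    (husc : ∀ n, UpperSemicontinuous (ξn n))
    (hnonneg : ∀ n p, 0 ≤ ξn n p)
    (hrep : ∀ p : PathPair T, ξbar p =
      Filter.liminf (fun n => ENNReal.ofReal (ξn n p)) Filter.atTop) :
    PhiBar T hT Xibar (fun p => (ξbar p : EReal)) = (supMartBar T hT Xibar ξbar : EReal) := by
  refine le_antisymm ?_ (weak_dir hT hA ξbar)
  refine le_of_forall_gt_imp_ge_of_dense fun c hc => ?_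
  obtain ⟨lam, h1, h2⟩ := EReal.lt_iff_exists_real_btwn.1 hc
  refine le_trans (sInf_le ⟨lam, ?_, rfl⟩) h2.le
  exact strong_mem hT hA ξbar ξn hbdd husc hnonneg hrep h1

end PathwiseSuperhedging
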